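/- arXiv:1909.07277 — 3 statements merged into one kernel-verified Lean document; each statement's English description precedes it below -/
import Mathlib

section
/- For every n ≥ 1, the quadruple (asc, rep, zero, max) on ascent sequences of length n is equidistributed with the quadruple (rep, asc, rmin, zero): for all a, b, c, d, the number of ascent sequences s of length n with asc(s)=a, rep(s)=b, zero(s)=c, max(s)=d equals the number with rep(s)=a, asc(s)=b, rmin(s)=c, zero(s)=d. -/
def ascN (s : List ℕ) : ℕ :=
  ((Finset.range (s.length - 1)).filter fun i => s.getD i 0 < s.getD (i+1) 0).card

def repN (s : List ℕ) : ℕ := s.length - s.dedup.length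

def zeroN (s : List ℕ) : ℕ :=
  ((Finset.range s.length).filter fun i => s.getD i 0 = 0).card

def maxN (s : List ℕ) : ℕ :=
  ((Finset.range s.length).filter fun i => s.getD i 0 = i).card

def rminN (s : List ℕ) : ℕ :=
  ((Finset.range s.length).filter fun i =>
    ∀ j ∈ Finset.range s.length, i < j → s.getD i 0 < s.getD j 0).card

/-- `s` is an inversion sequence: 0-indexed, `s i ≤ i` (i.e. 1-indexed `0 ≤ s_i < i`). -/
def IsInvSeq (s : List ℕ) : Prop := ∀ i < s.length, s.getD i 0 ≤ i

/-- `s` is an ascent sequence. -/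
def IsAscSeq (s : List ℕ) : Prop :=
  IsInvSeq s ∧ ∀ i < s.length, s.getD i 0 ≤ ascN (s.take i) + 1

def AscSeqs (n : ℕ) : Set (List ℕ) := {s | IsAscSeq s ∧ s.length = n}

section LetterSum

variable {S : Type*} [CommRing S]

/-- One step of the letter automaton: the next letter `k < A` gets weight `l` if `k < c`
(no ascent), and otherwise either opens a new letter (weight `i`) or not (weight `v`). -/
def letterSum (l i v : S) (A c : ℕ) (g : ℕ → ℕ → S) : S :=
  ∑ k ∈ Finset.range A, if k < c then l * g k A else i * g k (A + 1) + v * g k A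

lemma letterSum_succ_succ (l i v : S) (A c : ℕ) (g : ℕ → ℕ → S) :
    letterSum l i v (A + 1) (c + 1) g =
      l * g 0 (A + 1) + letterSum l i v A c (fun k B => g (k + 1) (B + 1)) := by
  simp [letterSum, Finset.sum_range_succ', add_comm]

lemma letterSum_succ_zero (l i v : S) (A : ℕ) (g : ℕ → ℕ → S) :
    letterSum l i v (A + 1) 0 g =
      letterSum l i v (A + 1) 1 g + (v - l) * g 0 (A + 1) + i * g 0 (A + 2) := by
  simp [letterSum, Finset.sum_range_succ']
  ring

lemma letterSum_succ_right (l i v : S) {A c : ℕ} (hc : c < A) (g : ℕ → ℕ → S) :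
    letterSum l i v A (c + 1) g =
      letterSum l i v A c g + (l - v) * g c A - i * g c (A + 1) := by
  have h : ∀ k ∈ Finset.range A, (if k < c + 1 then l * g k A else i * g k (A + 1) + v * g k A) =
      (if k < c then l * g k A else i * g k (A + 1) + v * g k A) +
        (if k = c then (l - v) * g c A - i * g c (A + 1) else 0) := by
    intro k _
    rcases lt_trichotomy k c with h | h | h
    · simp [h, h.ne, Nat.lt_succ_of_lt h]
    · subst h; simp; ring
    · simp [h.ne', not_lt.2 h.le, not_lt.2 (Nat.succ_le_of_lt h)]
  rw [letterSum, Finset.sum_congr rfl h, Finset.sum_add_distrib, Finset.sum_ite_eq' _ c]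
  simp [hc, letterSum]
  ring

lemma letterSum_add (l i v : S) (A c : ℕ) (g h : ℕ → ℕ → S) :
    letterSum l i v A c (fun k B => g k B + h k B) =
      letterSum l i v A c g + letterSum l i v A c h := by
  simp only [letterSum, ← Finset.sum_add_distrib]
  refine Finset.sum_congr rfl fun k _ => ?_
  split_ifs <;> ring

lemma letterSum_mul (l i v a : S) (A c : ℕ) (g : ℕ → ℕ → S) :
    letterSum l i v A c (fun k B => a * g k B) = a * letterSum l i v A c g := by
  simp only [letterSum, Finset.mul_sum]
  refine Finset.sum_congr rfl fun k _ => ?_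
  split_ifs <;> ring

lemma letterSum_sub (l i v : S) (A c : ℕ) (g h : ℕ → ℕ → S) :
    letterSum l i v A c (fun k B => g k B - h k B) =
      letterSum l i v A c g - letterSum l i v A c h := by
  simp only [letterSum, ← Finset.sum_sub_distrib]
  refine Finset.sum_congr rfl fun k _ => ?_
  split_ifs <;> ring

lemma letterSum_congr (l i v : S) (A c : ℕ) {g h : ℕ → ℕ → S}
    (H : ∀ k B, k < B → A ≤ B → g k B = h k B) :
    letterSum l i v A c g = letterSum l i v A c h := by
  refine Finset.sum_congr rfl fun k hk => ?_
  have hk := Finset.mem_range.1 hk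
  rw [H k A hk le_rfl, H k (A + 1) (by omega) (by omega)]

lemma letterSum_dvd (l i v : S) (A c : ℕ) {g : ℕ → ℕ → S} {d : S} (H : ∀ k B, d ∣ g k B) :
    d ∣ letterSum l i v A c g := by
  refine Finset.dvd_sum fun k _ => ?_
  split_ifs
  · exact (H _ _).mul_left _
  · exact ((H _ _).mul_left _).add ((H _ _).mul_left _)

end LetterSum

section Series

open PowerSeries

variable {R : Type*} [CommRing R]

lemma coeff_letterSum (l i v : R) (A c n : ℕ) (g : ℕ → ℕ → R⟦X⟧) :
    coeff n (letterSum (C l) (C i) (C v) A c g) =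
      letterSum l i v A c (fun k B => coeff n (g k B)) := by
  simp only [letterSum, map_sum]
  refine Finset.sum_congr rfl fun k _ => ?_
  split_ifs <;> simp [coeff_C_mul]

lemma PowerSeries.eq_zero_of_forall_X_pow_dvd {f : R⟦X⟧} (h : ∀ n : ℕ, (X : R⟦X⟧) ^ n ∣ f) :
    f = 0 := by
  ext n
  simpa using PowerSeries.X_pow_dvd_iff.1 (h (n + 1)) n (Nat.lt_succ_self n)

lemma eq_zero_of_dvd_succ {E : ℕ → ℕ → R⟦X⟧}
    (h : ∀ n : ℕ, (∀ A c, X ^ n ∣ E A c) → ∀ A c, X ^ (n + 1) ∣ E A c) (A c : ℕ) : E A c = 0 := by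
  have : ∀ n : ℕ, ∀ A c, X ^ n ∣ E A c := by
    intro n
    induction n with
    | zero => simp
    | succ n ih => exact h n ih
  exact PowerSeries.eq_zero_of_forall_X_pow_dvd fun n => this n A c

section Path

variable (l i v : R)

/-- Coefficients of `pathSeries`. -/
noncomputable def pathCoeff (f : ℕ → R⟦X⟧) : ℕ → ℕ → ℕ → R
  | 0, A, _ => coeff 0 (f A)
  | n + 1, A, c => coeff (n + 1) (f A) +
      letterSum l i v A c (fun k B => pathCoeff f n B (k + 1))

/-- Generating function of words of the letter automaton starting in state `(A, c)`, where a word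
ending with `B` available letters gets the extra weight `f B`. -/
noncomputable def pathSeries (f : ℕ → R⟦X⟧) (A c : ℕ) : R⟦X⟧ :=
  PowerSeries.mk fun n => pathCoeff l i v f n A c

lemma pathSeries_eq (f : ℕ → R⟦X⟧) (A c : ℕ) :
    pathSeries l i v f A c = f A +
      X * letterSum (C l) (C i) (C v) A c (fun k B => pathSeries l i v f B (k + 1)) := by
  ext n
  cases n with
  | zero => simp [pathSeries, pathCoeff]
  | succ n =>
    rw [map_add, coeff_succ_X_mul, coeff_letterSum]
    simp [pathSeries, pathCoeff]

variable {l i v}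

lemma eq_pathSeries {f : ℕ → R⟦X⟧} {Y : ℕ → ℕ → R⟦X⟧}
    (h : ∀ A c, Y A c = f A + X * letterSum (C l) (C i) (C v) A c (fun k B => Y B (k + 1)))
    (A c : ℕ) : Y A c = pathSeries l i v f A c := by
  rw [← sub_eq_zero]
  revert A c
  refine eq_zero_of_dvd_succ (E := fun A c => Y A c - pathSeries l i v f A c) fun n ih A c => ?_
  have : Y A c - pathSeries l i v f A c = X * letterSum (C l) (C i) (C v) A c
      (fun k B => Y B (k + 1) - pathSeries l i v f B (k + 1)) := by
    rw [h, pathSeries_eq, letterSum_sub]; ring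
  simp only [this, pow_succ']
  exact mul_dvd_mul_left _ (letterSum_dvd _ _ _ _ _ fun k B => ih _ _)

lemma pathSeries_congr {f g : ℕ → R⟦X⟧} {m : ℕ} (h : ∀ A, m ≤ A → f A = g A) {A : ℕ}
    (hA : m ≤ A) (c : ℕ) : pathSeries l i v f A c = pathSeries l i v g A c := by
  have key : ∀ n A c, m ≤ A → pathCoeff l i v f n A c = pathCoeff l i v g n A c := by
    intro n
    induction n with
    | zero => intro A c hA; simp [pathCoeff, h A hA]
    | succ n ih =>
      intro A c hA
      rw [pathCoeff, pathCoeff, h A hA]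
      congr 1
      exact letterSum_congr _ _ _ _ _ fun k B _ hB => ih _ _ (hA.trans hB)
  ext n
  simp [pathSeries, key n A c hA]

lemma pathSeries_add (f g : ℕ → R⟦X⟧) (A c : ℕ) :
    pathSeries l i v (fun A => f A + g A) A c =
      pathSeries l i v f A c + pathSeries l i v g A c := by
  refine (eq_pathSeries (Y := fun A c => pathSeries l i v f A c + pathSeries l i v g A c)
    (fun A c => ?_) A c).symm
  simp only [letterSum_add]
  rw [pathSeries_eq, pathSeries_eq _ _ _ g]
  ring

lemma pathSeries_mul (a : R⟦X⟧) (f : ℕ → R⟦X⟧) (A c : ℕ) :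
    pathSeries l i v (fun A => a * f A) A c = a * pathSeries l i v f A c := by
  refine (eq_pathSeries (Y := fun A c => a * pathSeries l i v f A c) (fun A c => ?_) A c).symm
  simp only [letterSum_mul]
  rw [pathSeries_eq]
  ring

lemma pathSeries_zero_left (f : ℕ → R⟦X⟧) (c : ℕ) : pathSeries l i v f 0 c = f 0 := by
  rw [pathSeries_eq]; simp [letterSum]

/-- Splitting a word at its first letter `0`. -/
lemma pathSeries_succ_succ (f : ℕ → R⟦X⟧) (A c : ℕ) :
    pathSeries l i v f (A + 1) (c + 1) =
      pathSeries l i v (fun B => f (B + 1) + X * C l * pathSeries l i v f (B + 1) 1) A c := by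
  refine eq_pathSeries (Y := fun A c => pathSeries l i v f (A + 1) (c + 1)) (fun A c => ?_) A c
  rw [pathSeries_eq, letterSum_succ_succ]
  ring

lemma pathSeries_succ_zero (f : ℕ → R⟦X⟧) (A : ℕ) :
    pathSeries l i v f (A + 1) 0 = (1 + X * (C v - C l)) * pathSeries l i v f (A + 1) 1 +
      X * C i * pathSeries l i v f (A + 2) 1 := by
  have h := pathSeries_eq l i v f (A + 1) 1
  rw [pathSeries_eq l i v f (A + 1) 0, letterSum_succ_zero]
  linear_combination -h

variable (l i v) in
/-- The operator summing over all words starting from scratch. -/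
noncomputable def wordOp (f : ℕ → R⟦X⟧) (A : ℕ) : R⟦X⟧ := pathSeries l i v f A 0

lemma eq_zero_of_eq_X_mul_wordOp {E : ℕ → R⟦X⟧}
    (h : ∀ A, E A = X * C l * wordOp l i v E A) (A : ℕ) : E A = 0 := by
  have key : ∀ n : ℕ, ∀ A, (X : R⟦X⟧) ^ n ∣ E A := by
    intro n
    induction n with
    | zero => simp
    | succ n ih =>
      intro A
      choose g hg using ih
      have : E = fun A => X ^ n * g A := funext hg
      rw [h, this, wordOp, pathSeries_mul, pow_succ]
      exact ⟨C l * pathSeries l i v g A 0, by ring⟩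
  exact PowerSeries.eq_zero_of_forall_X_pow_dvd fun n => key n A

lemma wordOp_pred (h : ℕ → R⟦X⟧) (A : ℕ) :
    wordOp l i v (fun B => h (B - 1)) (A + 1) -
        X * C l * wordOp l i v (fun B => wordOp l i v h (B - 1)) (A + 1) =
      (1 + X * (C v - C l)) * wordOp l i v h A + X * C i * wordOp l i v h (A + 1) := by
  set f : ℕ → R⟦X⟧ := fun B => h (B - 1) + (-(X * C l)) * wordOp l i v h (B - 1) with hf
  have hlin : wordOp l i v f (A + 1) = wordOp l i v (fun B => h (B - 1)) (A + 1) -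
        X * C l * wordOp l i v (fun B => wordOp l i v h (B - 1)) (A + 1) := by
    simp only [hf]
    rw [wordOp, pathSeries_add, pathSeries_mul]
    simp only [wordOp]
    ring
  have hZ : ∀ A, pathSeries l i v f (A + 1) 1 = wordOp l i v h A := by
    intro A
    rw [← sub_eq_zero]
    revert A
    refine eq_zero_of_eq_X_mul_wordOp (l := l) (i := i) (v := v)
      (E := fun A => pathSeries l i v f (A + 1) 1 - wordOp l i v h A) fun A => ?_
    have h1 : pathSeries l i v f (A + 1) 1 = wordOp l i v (fun B => h B +
        X * C l * (pathSeries l i v f (B + 1) 1 - wordOp l i v h B)) A := by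
      rw [pathSeries_succ_succ f A 0, wordOp]
      congr 1
      funext B
      simp only [hf, Nat.add_sub_cancel]
      ring
    nth_rewrite 1 [h1]
    rw [wordOp, pathSeries_add, pathSeries_mul]
    simp only [wordOp]
    ring
  rw [← hlin, wordOp, pathSeries_succ_zero, hZ, hZ]

end Path

end Series

section ClosedSystem

open PowerSeries

variable {R : Type*} [CommRing R]

section Iterate

variable {l i v : R}

lemma wordOp_iterate_add (n : ℕ) (f g : ℕ → R⟦X⟧) (A : ℕ) :
    (wordOp l i v)^[n] (fun B => f B + g B) A =
      (wordOp l i v)^[n] f A + (wordOp l i v)^[n] g A := by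
  induction n generalizing f g with
  | zero => rfl
  | succ n ih =>
    simp only [Function.iterate_succ_apply]
    rw [← ih]
    exact congrArg (fun h => (wordOp l i v)^[n] h A) (funext fun B => pathSeries_add f g B 0)

lemma wordOp_iterate_mul (n : ℕ) (a : R⟦X⟧) (f : ℕ → R⟦X⟧) (A : ℕ) :
    (wordOp l i v)^[n] (fun B => a * f B) A = a * (wordOp l i v)^[n] f A := by
  induction n generalizing f with
  | zero => rfl
  | succ n ih =>
    simp only [Function.iterate_succ_apply]
    rw [← ih]
    exact congrArg (fun h => (wordOp l i v)^[n] h A) (funext fun B => pathSeries_mul a f B 0)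

lemma wordOp_iterate_congr {f g : ℕ → R⟦X⟧} {m : ℕ} (h : ∀ A, m ≤ A → f A = g A) (n : ℕ)
    {A : ℕ} (hA : m ≤ A) : (wordOp l i v)^[n] f A = (wordOp l i v)^[n] g A := by
  induction n generalizing f g with
  | zero => exact h A hA
  | succ n ih => exact ih fun A hA => pathSeries_congr h hA 0

lemma wordOp_iterate_zero (n : ℕ) (f : ℕ → R⟦X⟧) : (wordOp l i v)^[n] f 0 = f 0 := by
  induction n generalizing f with
  | zero => rfl
  | succ n ih => rw [Function.iterate_succ_apply, ih, wordOp, pathSeries_zero_left]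

variable (l i v) in
/-- `wordOp` iterated, with a shift of the argument inserted. -/
noncomputable def shiftedIterate (r : ℕ → R⟦X⟧) (a b : ℕ) : R⟦X⟧ :=
  (wordOp l i v)^[a] (fun B => (wordOp l i v)^[b] r (B - 1)) 1

lemma shiftedIterate_succ (r : ℕ → R⟦X⟧) (a b : ℕ) :
    shiftedIterate l i v r (a + 1) b - X * C l * shiftedIterate l i v r (a + 1) (b + 1) =
      (1 + X * (C v - C l)) * shiftedIterate l i v r a (b + 1) +
        X * C i * (wordOp l i v)^[a + b + 1] r 1 := by
  set h := (wordOp l i v)^[b] r with hh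
  have h' : (wordOp l i v)^[b + 1] r = wordOp l i v h := Function.iterate_succ_apply' _ _ _
  have hab : (wordOp l i v)^[a + b + 1] r = (wordOp l i v)^[a] (wordOp l i v h) := by
    rw [add_assoc, Function.iterate_add_apply, h']
  have key : (wordOp l i v)^[a] (wordOp l i v fun B => h (B - 1)) 1 =
      (wordOp l i v)^[a] (fun B => X * C l * wordOp l i v (fun B => wordOp l i v h (B - 1)) B +
        ((1 + X * (C v - C l)) * wordOp l i v h (B - 1) + X * C i * wordOp l i v h B)) 1 := by
    refine wordOp_iterate_congr (m := 1) (fun A hA => ?_) a le_rfl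
    obtain ⟨A, rfl⟩ := Nat.exists_eq_add_of_le' hA
    rw [Nat.add_sub_cancel]
    linear_combination wordOp_pred (l := l) (i := i) (v := v) h A
  rw [wordOp_iterate_add, wordOp_iterate_add, wordOp_iterate_mul, wordOp_iterate_mul,
    wordOp_iterate_mul] at key
  simp only [shiftedIterate, Function.iterate_succ_apply (wordOp l i v) a, hab, h', ← hh]
  rw [key]
  ring

lemma shiftedIterate_zero_left {r : ℕ → R⟦X⟧} (hr : r 0 = 1) (b : ℕ) :
    shiftedIterate l i v r 0 b = 1 := by
  simp [shiftedIterate, wordOp_iterate_zero, hr]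

lemma wordOp_iterate_eq_shiftedIterate {r : ℕ → R⟦X⟧} {w : R⟦X⟧}
    (hr : ∀ A, r (A + 1) = r A + w * (C l * wordOp l i v (fun B => r (B - 1)) (A + 1) +
      (C v - C l) * r A + C i * r (A + 1))) (k : ℕ) :
    (wordOp l i v)^[k] r 1 = shiftedIterate l i v r k 0 +
      w * (C l * shiftedIterate l i v r (k + 1) 0 + (C v - C l) * shiftedIterate l i v r k 0 +
        C i * (wordOp l i v)^[k] r 1) := by
  have key : (wordOp l i v)^[k] r 1 = (wordOp l i v)^[k] (fun B =>
      w * C l * wordOp l i v (fun B => r (B - 1)) B +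
        ((1 + w * (C v - C l)) * r (B - 1) + w * C i * r B)) 1 := by
    refine wordOp_iterate_congr (m := 1) (fun A hA => ?_) k le_rfl
    obtain ⟨A, rfl⟩ := Nat.exists_eq_add_of_le' hA
    rw [Nat.add_sub_cancel]
    linear_combination hr A
  rw [wordOp_iterate_add, wordOp_iterate_add, wordOp_iterate_mul, wordOp_iterate_mul,
    wordOp_iterate_mul] at key
  simp only [shiftedIterate, Function.iterate_succ_apply, Function.iterate_zero, id]
  linear_combination key

end Iterate

/-- The triangular system which determines both sides of the equidistribution. -/
structure TriangularSystem (x u z : R) (Y : ℕ → ℕ → R⟦X⟧) : Prop where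
  dvd : ∀ k e, X ^ (k + 1) ∣ Y k e
  succ : ∀ k j, j + 1 ≤ k →
    Y (k + 1) (j + 1) = Y k j - (1 + X * (C (u * (x - 1)) - C x)) * Y k (j + 1)
  diag : ∀ k, Y k k - Y (k + 1) (k + 1) = X * C u *
    (∑ e ∈ Finset.range (k + 1), (if e = 0 then C z else 1) * Y k e +
      C z * C x ^ (k + 1) * X ^ (k + 1))

lemma TriangularSystem.unique {x u z : R} {Y Z : ℕ → ℕ → R⟦X⟧} (hY : TriangularSystem x u z Y)
    (hZ : TriangularSystem x u z Z) {k e : ℕ} (he : e ≤ k) : Y k e = Z k e := by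
  rw [← sub_eq_zero]
  refine PowerSeries.eq_zero_of_forall_X_pow_dvd fun n => ?_
  induction n generalizing k e with
  | zero => simp
  | succ n ih =>
    have key : ∀ m k, n ≤ k + m → ∀ e ≤ k, X ^ (n + 1) ∣ Y k e - Z k e := by
      intro m
      induction m with
      | zero =>
        intro k hk e _
        exact (pow_dvd_pow X (by omega)).trans (dvd_sub (hY.dvd k e) (hZ.dvd k e))
      | succ m ihm =>
        intro k hk e he
        have hn : ∀ e ≤ k + 1, X ^ (n + 1) ∣ Y (k + 1) e - Z (k + 1) e :=
          ihm (k + 1) (by omega)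
        induction he using Nat.decreasingInduction with
        | self =>
          have h1 : Y k k - Z k k = (Y (k + 1) (k + 1) - Z (k + 1) (k + 1)) + X * (C u *
              ∑ e ∈ Finset.range (k + 1), (if e = 0 then C z else 1) * (Y k e - Z k e)) := by
            simp only [mul_sub, Finset.sum_sub_distrib]
            linear_combination hY.diag k - hZ.diag k
          rw [h1]
          refine dvd_add (hn _ le_rfl) ?_
          rw [pow_succ']
          exact mul_dvd_mul_left _ (Dvd.dvd.mul_left (Finset.dvd_sum fun e he =>
            Dvd.dvd.mul_left (ih (Nat.lt_succ_iff.1 (Finset.mem_range.1 he))) _) _)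
        | of_succ j hj ihj =>
          have h1 : Y k j - Z k j = (Y (k + 1) (j + 1) - Z (k + 1) (j + 1)) +
              (1 + X * (C (u * (x - 1)) - C x)) * (Y k (j + 1) - Z k (j + 1)) := by
            linear_combination hZ.succ k j hj - hY.succ k j hj
          rw [h1]
          exact dvd_add (hn _ (by omega)) (ihj.mul_left _)
    exact key n k (by omega) e he

section Solution

variable (x u z : R) (r : ℕ → R⟦X⟧)

/-- The solution of the triangular system built from `shiftedIterate`. -/
noncomputable def shiftedSolution (k : ℕ) : ℕ → R⟦X⟧
  | 0 => C z * C x ^ k * X ^ (k + 1) *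
      (C x * X * shiftedIterate x u (u * (x - 1)) r (k + 1) 0 +
        X * (C (u * (x - 1)) - C x) * shiftedIterate x u (u * (x - 1)) r k 0 +
        C u * X * (wordOp x u (u * (x - 1)))^[k] r 1)
  | j + 1 => C z * C x ^ k * X ^ (k + 1) * (shiftedIterate x u (u * (x - 1)) r (k - j) j -
      shiftedIterate x u (u * (x - 1)) r (k - (j + 1)) (j + 1))

variable {x u z r}

lemma sum_shiftedSolution (hr0 : r 0 = 1)
    (hr : ∀ A, r (A + 1) = r A + C z * X * (C x * wordOp x u (u * (x - 1))
      (fun B => r (B - 1)) (A + 1) + (C (u * (x - 1)) - C x) * r A + C u * r (A + 1))) (k : ℕ) :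
    ∑ e ∈ Finset.range (k + 1), (if e = 0 then C z else 1) * shiftedSolution x u z r k e =
      C z * C x ^ k * X ^ (k + 1) * ((wordOp x u (u * (x - 1)))^[k] r 1 - 1) := by
  rw [Finset.sum_range_succ']
  simp only [Nat.add_eq_zero_iff, one_ne_zero, and_false, if_false, one_mul, if_true,
    shiftedSolution]
  rw [← Finset.mul_sum, Finset.sum_range_sub'
    (fun j => shiftedIterate x u (u * (x - 1)) r (k - j) j), Nat.sub_self,
    shiftedIterate_zero_left hr0, Nat.sub_zero]
  linear_combination -(C z * C x ^ k * X ^ (k + 1)) * wordOp_iterate_eq_shiftedIterate hr k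

lemma triangularSystem_shiftedSolution (hr0 : r 0 = 1)
    (hr : ∀ A, r (A + 1) = r A + C z * X * (C x * wordOp x u (u * (x - 1))
      (fun B => r (B - 1)) (A + 1) + (C (u * (x - 1)) - C x) * r A + C u * r (A + 1))) :
    TriangularSystem x u z (shiftedSolution x u z r) where
  dvd k e := by
    cases e with
    | zero => exact ((dvd_refl _).mul_left _).mul_right _
    | succ j => exact ((dvd_refl _).mul_left _).mul_right _
  succ k j hj := by
    obtain ⟨m, rfl⟩ := Nat.exists_eq_add_of_le hj
    have e1 : j + 1 + m + 1 - j = m + 2 := by omega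
    have e2 : j + 1 + m + 1 - (j + 1) = m + 1 := by omega
    have e3 : j + 1 + m - j = m + 1 := by omega
    have e4 : j + 1 + m - (j + 1) = m := by omega
    have h1 := shiftedIterate_succ (l := x) (i := u) (v := u * (x - 1)) r m j
    cases j with
    | zero =>
      simp only [Nat.zero_add] at *
      simp only [shiftedSolution, Nat.zero_add, e2, e4, Nat.sub_zero]
      rw [add_comm 1 m]
      rw [Nat.add_zero] at h1
      linear_combination C z * C x ^ (m + 1) * X ^ (m + 2) * h1
    | succ j =>
      have e5 : j + 1 + 1 + m - j = m + 2 := by omega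
      have h2 := shiftedIterate_succ (l := x) (i := u) (v := u * (x - 1)) r (m + 1) j
      simp only [shiftedSolution, e1, e2, e3, e4, e5]
      have e6 : m + 1 + j + 1 = m + (j + 1) + 1 := by omega
      rw [e6] at h2
      linear_combination C z * C x ^ (j + 1 + 1 + m) * X ^ (j + 1 + 1 + m + 1) * (h1 - h2)
  diag k := by
    rw [sum_shiftedSolution hr0 hr]
    cases k with
    | zero =>
      simp only [shiftedSolution, shiftedIterate_zero_left hr0]
      simp only [map_mul, map_sub, map_one]
      norm_num
      ring
    | succ k =>
      have h1 := shiftedIterate_succ (l := x) (i := u) (v := u * (x - 1)) r 0 k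
      simp only [Nat.zero_add, shiftedIterate_zero_left hr0] at h1
      have e1 : k + 1 + 1 - (k + 1) = 1 := by omega
      have e2 : k + 1 - k = 1 := by omega
      simp only [shiftedSolution, e1, e2, Nat.sub_self, shiftedIterate_zero_left hr0]
      simp only [map_mul, map_sub, map_one] at h1 ⊢
      linear_combination C z * C x ^ (k + 1) * X ^ (k + 2) * h1

end Solution

end ClosedSystem

section Statistics

lemma rminN_cons (c : ℕ) (w : List ℕ) :
    rminN (c :: w) = rminN w + if ∀ d ∈ w, c < d then 1 else 0 := by
  have h : (∀ j ∈ Finset.range w.length, c < w.getD j 0) ↔ ∀ d ∈ w, c < d := by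
    simp only [List.forall_mem_iff_getElem, Finset.mem_range]
    exact forall₂_congr fun j hj => by rw [List.getD_eq_getElem _ _ hj]
  rw [rminN, Finset.card_filter, List.length_cons, Finset.sum_range_succ', rminN,
    Finset.card_filter]
  congr 1
  · refine Finset.sum_congr rfl fun i _ => ?_
    congr 1
    simp only [Finset.mem_range, List.getD_cons_succ, eq_iff_iff]
    constructor
    · intro H j hj hij
      simpa using H (j + 1) (by omega) (by omega)
    · intro H j hj hij
      obtain ⟨j, rfl⟩ := Nat.exists_eq_add_of_le' (by omega : 1 ≤ j)
      simpa using H j (by omega) (by omega)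
  · congr 1
    rw [← h, eq_iff_iff]
    simp only [Finset.mem_range, List.getD_cons_zero]
    constructor
    · intro H j hj
      simpa using H (j + 1) (by omega) (by omega)
    · intro H j hj hij
      obtain ⟨j, rfl⟩ := Nat.exists_eq_add_of_le' (by omega : 1 ≤ j)
      simpa using H j (by omega)

lemma zeroN_cons (c : ℕ) (w : List ℕ) :
    zeroN (c :: w) = zeroN w + if c = 0 then 1 else 0 := by
  rw [zeroN, Finset.card_filter, List.length_cons, Finset.sum_range_succ', zeroN,
    Finset.card_filter]
  simp

lemma zeroN_eq_zero_iff (w : List ℕ) : zeroN w = 0 ↔ ∀ d ∈ w, 0 < d := by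
  induction w with
  | nil => simp [zeroN]
  | cons c w ih => simp [zeroN_cons, ih, Nat.pos_iff_ne_zero, and_comm]

lemma rminN_zero_cons (w : List ℕ) :
    rminN (0 :: w) = rminN w + if zeroN w = 0 then 1 else 0 := by
  simp [rminN_cons, zeroN_eq_zero_iff]

end Statistics

section WordSeries

open PowerSeries

variable {R : Type*} [CommRing R]

/-- Sum over the words of length `n` read by the letter automaton from state `(A, c)`, with an
extra weight `θ` depending on the word. -/
def wordSum (l i v : R) : ℕ → ℕ → ℕ → (List ℕ → R) → R
  | 0, _, _, θ => θ []
  | n + 1, A, c, θ =>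
      letterSum l i v A c fun k B => wordSum l i v n B (k + 1) fun w => θ (k :: w)

/-- The generating function of `wordSum`. -/
noncomputable def wordSeries (l i v : R) (θ : List ℕ → R) (A c : ℕ) : R⟦X⟧ :=
  PowerSeries.mk fun n => wordSum l i v n A c θ

variable {l i v : R}

lemma wordSeries_eq (θ : List ℕ → R) (A c : ℕ) :
    wordSeries l i v θ A c = C (θ []) + X * letterSum (C l) (C i) (C v) A c
      (fun k B => wordSeries l i v (fun w => θ (k :: w)) B (k + 1)) := by
  ext n
  cases n with
  | zero => simp [wordSeries, wordSum]
  | succ n =>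
    rw [map_add, coeff_succ_X_mul, coeff_letterSum]
    simp [wordSeries, wordSum]

lemma wordSum_add (n A c : ℕ) (θ η : List ℕ → R) :
    wordSum l i v n A c (fun w => θ w + η w) = wordSum l i v n A c θ + wordSum l i v n A c η := by
  induction n generalizing A c θ η with
  | zero => rfl
  | succ n ih => simp only [wordSum, ih, letterSum_add]

lemma wordSum_mul (n A c : ℕ) (a : R) (θ : List ℕ → R) :
    wordSum l i v n A c (fun w => a * θ w) = a * wordSum l i v n A c θ := by
  induction n generalizing A c θ with
  | zero => rfl
  | succ n ih => simp only [wordSum, ih, letterSum_mul]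

lemma wordSeries_add (A c : ℕ) (θ η : List ℕ → R) :
    wordSeries l i v (fun w => θ w + η w) A c =
      wordSeries l i v θ A c + wordSeries l i v η A c := by
  ext n
  simp [wordSeries, wordSum_add]

lemma wordSeries_mul (A c : ℕ) (a : R) (θ : List ℕ → R) :
    wordSeries l i v (fun w => a * θ w) A c = C a * wordSeries l i v θ A c := by
  ext n
  simp [wordSeries, wordSum_mul]

lemma letterSum_shift {S : Type*} [CommRing S] (l i v : S) (b A c : ℕ) (g : ℕ → ℕ → S) :
    letterSum l i v A c (fun k B => if b ≤ k then g (k - b) (B - b) else 0) =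
      letterSum l i v (A - b) (c - b) g := by
  rcases le_total b A with h | h
  · obtain ⟨A, rfl⟩ := Nat.exists_eq_add_of_le h
    rw [letterSum, Finset.sum_range_add, Finset.sum_eq_zero, zero_add, letterSum,
      Nat.add_sub_cancel_left]
    · refine Finset.sum_congr rfl fun k _ => ?_
      have e1 : b + A + 1 - b = A + 1 := by omega
      have e2 : b + k < c ↔ k < c - b := by omega
      simp [e1, e2]
    · intro k hk
      simp [not_le.2 (Finset.mem_range.1 hk)]
  · rw [Nat.sub_eq_zero_of_le h]
    simp only [letterSum, Finset.range_zero, Finset.sum_empty]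
    refine Finset.sum_eq_zero fun k hk => ?_
    simp [not_le.2 ((Finset.mem_range.1 hk).trans_le h)]

/-- The weight `z ^ rminN w` restricted to words with all letters at least `b`. -/
def rminWeight (z : R) (b : ℕ) (w : List ℕ) : R := if ∀ d ∈ w, b ≤ d then z ^ rminN w else 0

lemma rminWeight_cons (z : R) (b k : ℕ) (w : List ℕ) :
    rminWeight z b (k :: w) =
      if b ≤ k then rminWeight z b w + (z - 1) * rminWeight z (k + 1) w else 0 := by
  simp only [rminWeight, rminN_cons, List.forall_mem_cons]
  by_cases hk : b ≤ k
  · by_cases h1 : ∀ d ∈ w, k < d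
    · have h2 : ∀ d ∈ w, b ≤ d := fun d hd => hk.trans (h1 d hd).le
      have h3 : ∀ d ∈ w, k + 1 ≤ d := h1
      rw [if_pos ⟨hk, h2⟩, if_pos h1, if_pos h2, if_pos h3, if_pos hk]
      ring
    · simp [hk, h1]
  · simp [hk]

lemma wordSum_rminWeight (z : R) (n b A c : ℕ) :
    wordSum l i v n A c (rminWeight z b) =
      wordSum l i v n (A - b) (c - b) (rminWeight z 0) := by
  induction n generalizing b A c with
  | zero => simp [wordSum, rminWeight]
  | succ n ih =>
    rw [wordSum, wordSum, ← letterSum_shift l i v b A c]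
    refine letterSum_congr _ _ _ _ _ fun k B hkB hAB => ?_
    by_cases hk : b ≤ k
    · have e1 : k - b + 1 = k + 1 - b := by omega
      have e2 : B - (k + 1) = B - b - (k + 1 - b) := by omega
      simp only [rminWeight_cons, hk, if_true, Nat.zero_le, wordSum_add, wordSum_mul]
      rw [ih b, ih (k + 1), ih (k - b + 1), e1, e2, Nat.sub_self, Nat.sub_self]
    · have h0 := wordSum_mul (l := l) (i := i) (v := v) n B (k + 1) 0 (fun _ => 0)
      simp only [mul_zero, zero_mul] at h0
      simp [rminWeight_cons, hk, h0]

lemma wordSeries_rminWeight (z : R) (b A c : ℕ) :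
    wordSeries l i v (rminWeight z b) A c =
      wordSeries l i v (rminWeight z 0) (A - b) (c - b) := by
  ext n
  simp [wordSeries, wordSum_rminWeight z n b]

lemma wordSeries_rminWeight_eq (z : R) (A c : ℕ) :
    wordSeries l i v (rminWeight z 0) A c = 1 + X * letterSum (C l) (C i) (C v) A c
      (fun k B => wordSeries l i v (rminWeight z 0) B (k + 1) +
        C (z - 1) * wordSeries l i v (rminWeight z 0) (B - (k + 1)) 0) := by
  have h : rminWeight z 0 [] = 1 := by simp [rminWeight, rminN]
  rw [wordSeries_eq, h, map_one]
  simp only [rminWeight_cons, Nat.zero_le, if_true, wordSeries_add, wordSeries_mul]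
  simp only [fun k => wordSeries_rminWeight (l := l) (i := i) (v := v) z (k + 1), Nat.sub_self]

variable (l i v) in
/-- Generating function of words from state `(A, 0)` by number of right-to-left minima. -/
noncomputable def rminSeries (z : R) (A : ℕ) : R⟦X⟧ := wordSeries l i v (rminWeight z 0) A 0

lemma wordSeries_rminWeight_succ (z : R) (A c : ℕ) :
    wordSeries l i v (rminWeight z 0) (A + 1) (c + 1) = wordSeries l i v (rminWeight z 0) A c +
      C z * X * C l * pathSeries l i v (fun B => rminSeries l i v z (B - 1)) (A + 1) (c + 1) := by
  rw [← sub_eq_zero]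
  revert A c
  refine eq_zero_of_dvd_succ (E := fun A c => wordSeries l i v (rminWeight z 0) (A + 1) (c + 1) -
    (wordSeries l i v (rminWeight z 0) A c + C z * X * C l *
      pathSeries l i v (fun B => rminSeries l i v z (B - 1)) (A + 1) (c + 1)))
    fun n ih A c => ?_
  have h1 := wordSeries_rminWeight_eq (l := l) (i := i) (v := v) z (A + 1) (c + 1)
  rw [letterSum_succ_succ, letterSum_add] at h1
  have h2 := wordSeries_rminWeight_eq (l := l) (i := i) (v := v) z A c
  rw [letterSum_add] at h2
  have h3 := pathSeries_eq l i v (fun B => rminSeries l i v z (B - 1)) (A + 1) (c + 1)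
  rw [letterSum_succ_succ] at h3
  simp only [Nat.add_sub_add_right, Nat.add_sub_cancel, Nat.zero_add] at h1 h2 h3
  have h4 : wordSeries l i v (rminWeight z 0) (A + 1) (c + 1) -
    (wordSeries l i v (rminWeight z 0) A c + C z * X * C l *
      pathSeries l i v (fun B => rminSeries l i v z (B - 1)) (A + 1) (c + 1)) = X * (C l *
        (wordSeries l i v (rminWeight z 0) (A + 1) (0 + 1) -
          (wordSeries l i v (rminWeight z 0) A 0 + C z * X * C l *
      pathSeries l i v (fun B => rminSeries l i v z (B - 1)) (A + 1) (0 + 1))) +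
      letterSum (C l) (C i) (C v) A c (fun k B =>
        (wordSeries l i v (rminWeight z 0) (B + 1) (k + 1 + 1) -
          (wordSeries l i v (rminWeight z 0) B (k + 1) + C z * X * C l *
      pathSeries l i v (fun B => rminSeries l i v z (B - 1)) (B + 1) (k + 1 + 1))))) := by
    rw [letterSum_sub, letterSum_add, letterSum_mul]
    simp only [Nat.zero_add]
    simp only [rminSeries, map_sub, map_one] at h1 h2 h3 ⊢
    linear_combination h1 - h2 - C z * X * C l * h3
  simp only [h4, pow_succ']
  exact mul_dvd_mul_left _ (dvd_add ((ih A 0).mul_left _)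
    (letterSum_dvd _ _ _ _ _ fun k B => ih B (k + 1)))

lemma rminSeries_zero (z : R) : rminSeries l i v z 0 = 1 := by
  rw [rminSeries, wordSeries_rminWeight_eq]
  simp [letterSum]

lemma rminSeries_succ (z : R) (A : ℕ) :
    rminSeries l i v z (A + 1) = rminSeries l i v z A + C z * X *
      (C l * wordOp l i v (fun B => rminSeries l i v z (B - 1)) (A + 1) +
        (C v - C l) * rminSeries l i v z A + C i * rminSeries l i v z (A + 1)) := by
  have h1 := wordSeries_rminWeight_eq (l := l) (i := i) (v := v) z (A + 1) 0
  have h2 := wordSeries_rminWeight_eq (l := l) (i := i) (v := v) z (A + 1) 1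
  have h3 := wordSeries_rminWeight_succ (l := l) (i := i) (v := v) z A 0
  have h4 := wordSeries_rminWeight_succ (l := l) (i := i) (v := v) z (A + 1) 0
  have h5 := pathSeries_succ_zero (l := l) (i := i) (v := v)
    (fun B => rminSeries l i v z (B - 1)) A
  rw [letterSum_succ_zero] at h1
  simp only [Nat.zero_add, Nat.add_sub_cancel, Nat.reduceSubDiff] at h1 h2 h3 h4
  simp only [rminSeries, wordOp, map_sub, map_one] at *
  linear_combination h1 - h2 + (1 + X * (C v - C l)) * h3 + X * C i * h4 - C z * X * C l * h5

/-- The weight `z ^ rminN (0 :: w)` restricted to words with `p` zeros. -/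
def zeroWeight (z : R) (p : ℕ) (w : List ℕ) : R :=
  if zeroN w = p then z ^ rminN (0 :: w) else 0

lemma wordSeries_zeroWeight (z : R) (p A : ℕ) :
    wordSeries l i v (zeroWeight z p) (A + 1) 1 =
      C z * (X * C l) ^ p * (wordOp l i v)^[p] (rminSeries l i v z) A := by
  induction p generalizing A with
  | zero =>
    have h : zeroWeight z 0 = fun w => z * rminWeight z 1 w := by
      funext w
      simp only [zeroWeight, rminWeight, rminN_zero_cons]
      by_cases h : zeroN w = 0
      · have h' : ∀ d ∈ w, 1 ≤ d := (zeroN_eq_zero_iff w).1 h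
        rw [if_pos h, if_pos h, if_pos h', pow_succ']
      · have h' : ¬ ∀ d ∈ w, 1 ≤ d := mt (zeroN_eq_zero_iff w).2 h
        rw [if_neg h, if_neg h', mul_zero]
    rw [h, wordSeries_mul, wordSeries_rminWeight]
    simp [rminSeries]
  | succ p ih =>
    have h0 : ∀ w, zeroWeight z (p + 1) (0 :: w) = zeroWeight z p w := fun w => by
      simp [zeroWeight, zeroN_cons, rminN_zero_cons (0 :: w)]
    have h1 : ∀ k w, zeroWeight z (p + 1) ((k + 1) :: w) = zeroWeight z (p + 1) w := fun k w => by
      by_cases h : zeroN w = p + 1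
      · have h2 : ¬ ∀ d ∈ w, k + 1 < d := fun h3 => by
          have := (zeroN_eq_zero_iff w).2 fun d hd => (Nat.succ_pos k).trans (h3 d hd)
          omega
        simp [zeroWeight, zeroN_cons, rminN_zero_cons, h, rminN_cons (k + 1), h2]
      · simp [zeroWeight, zeroN_cons, h]
    have h2 : wordSeries l i v (zeroWeight z (p + 1)) (A + 1) (0 + 1) = pathSeries l i v
        (fun A => X * C l * wordSeries l i v (zeroWeight z p) (A + 1) 1) A 0 := by
      refine eq_pathSeries (Y := fun A c => wordSeries l i v (zeroWeight z (p + 1)) (A + 1) (c + 1))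
        (fun A c => ?_) A 0
      rw [wordSeries_eq, letterSum_succ_succ]
      simp only [h0, h1]
      have : zeroWeight z (p + 1) [] = 0 := by simp [zeroWeight, zeroN]
      rw [this, map_zero]
      ring
    simp only [ih] at h2
    rw [Nat.zero_add, pathSeries_mul, pathSeries_mul] at h2
    rw [h2, Function.iterate_succ_apply', wordOp, pow_succ]
    ring

end WordSeries

section ZeroSeries

open PowerSeries

variable {R : Type*} [CommRing R]

/-- Generating function of words by number of zeros, for the letter automaton whose weights are
`x` per ascent and `u` per repeated letter. -/
noncomputable def zeroSeries (x u z : R) (A c : ℕ) : R⟦X⟧ :=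
  wordSeries u x (x * (u - 1)) (fun w => z ^ zeroN w) A c

variable {x u z : R}

lemma zeroSeries_eq (A c : ℕ) :
    zeroSeries x u z A c = 1 + X * letterSum (C u) (C x) (C (x * (u - 1))) A c
      (fun k B => (if k = 0 then C z else 1) * zeroSeries x u z B (k + 1)) := by
  have h : ∀ k w, z ^ zeroN (k :: w) = (if k = 0 then z else 1) * z ^ zeroN w := fun k w => by
    rw [zeroN_cons]
    split_ifs <;> ring
  rw [zeroSeries, wordSeries_eq]
  simp only [h, wordSeries_mul, zeroSeries]
  simp [zeroN, apply_ite]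

lemma zeroSeries_succ_right {A c : ℕ} (hc : c + 1 < A) :
    zeroSeries x u z A (c + 2) = zeroSeries x u z A (c + 1) +
      X * ((C u - C x * (C u - 1)) * zeroSeries x u z A (c + 2) -
        C x * zeroSeries x u z (A + 1) (c + 2)) := by
  have h1 := zeroSeries_eq (x := x) (u := u) (z := z) A (c + 2)
  rw [letterSum_succ_right _ _ _ hc] at h1
  have h2 := zeroSeries_eq (x := x) (u := u) (z := z) A (c + 1)
  simp only [Nat.add_eq_zero_iff, one_ne_zero, and_false, if_false, map_mul, map_sub,
    map_one] at h1 h2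
  linear_combination h1 - h2

lemma sum_zeroSeries (A : ℕ) :
    X * C u * ∑ e ∈ Finset.range A, (if e = 0 then C z else 1) * zeroSeries x u z A (e + 1) =
      zeroSeries x u z A A - 1 := by
  rw [zeroSeries_eq A A, letterSum, Finset.sum_congr rfl fun k hk =>
    if_pos (Finset.mem_range.1 hk), ← Finset.mul_sum]
  ring

lemma triangularSystem_zeroSeries : TriangularSystem x u z fun k e => C z * C x ^ (k + 1) *
    X ^ (k + 2) * ((C u - 1) * zeroSeries x u z (k + 1) (e + 1) +
      zeroSeries x u z (k + 2) (e + 1)) where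
  dvd k e := by
    refine Dvd.dvd.mul_right (Dvd.dvd.mul_left ?_ _) _
    exact pow_dvd_pow _ (by omega)
  succ k j hj := by
    have h1 := zeroSeries_succ_right (x := x) (u := u) (z := z) (A := k + 1) (c := j) (by omega)
    have h2 := zeroSeries_succ_right (x := x) (u := u) (z := z) (A := k + 2) (c := j) (by omega)
    simp only [map_mul, map_sub, map_one]
    linear_combination C z * C x ^ (k + 1) * X ^ (k + 2) * ((C u - 1) * h1 + h2)
  diag k := by
    have h1 := sum_zeroSeries (x := x) (u := u) (z := z) (k + 1)
    have h2 := sum_zeroSeries (x := x) (u := u) (z := z) (k + 2)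
    have h3 := zeroSeries_succ_right (x := x) (u := u) (z := z) (A := k + 2) (c := k) (by omega)
    rw [Finset.sum_range_succ] at h2
    simp only [Nat.add_eq_zero_iff, one_ne_zero, and_false, if_false] at h2
    have h4 : ∀ e, (if e = 0 then C z else 1) * (C z * C x ^ (k + 1) * X ^ (k + 2) *
        ((C u - 1) * zeroSeries x u z (k + 1) (e + 1) + zeroSeries x u z (k + 2) (e + 1))) =
        C z * C x ^ (k + 1) * X ^ (k + 2) * (C u - 1) *
          ((if e = 0 then C z else 1) * zeroSeries x u z (k + 1) (e + 1)) +
        C z * C x ^ (k + 1) * X ^ (k + 2) *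
          ((if e = 0 then C z else 1) * zeroSeries x u z (k + 2) (e + 1)) := fun e => by ring
    simp only [h4, Finset.sum_add_distrib, ← Finset.mul_sum]
    linear_combination -C z * C x ^ (k + 1) * X ^ (k + 2) * ((C u - 1) * h1 + h2 + h3)

/-- The two solutions of the triangular system agree after summation. -/
lemma sum_zeroSeries_eq_wordOp (k : ℕ) :
    ∑ e ∈ Finset.range (k + 1), (if e = 0 then C z else 1) * (C z * C x ^ (k + 1) * X ^ (k + 2) *
      ((C u - 1) * zeroSeries x u z (k + 1) (e + 1) + zeroSeries x u z (k + 2) (e + 1))) =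
    C z * C x ^ k * X ^ (k + 1) *
      ((wordOp x u (u * (x - 1)))^[k] (rminSeries x u (u * (x - 1)) z) 1 - 1) := by
  rw [← sum_shiftedSolution (rminSeries_zero z) (rminSeries_succ z)]
  refine Finset.sum_congr rfl fun e he => ?_
  rw [triangularSystem_zeroSeries.unique (triangularSystem_shiftedSolution (rminSeries_zero z)
    (rminSeries_succ z)) (Nat.lt_succ_iff.1 (Finset.mem_range.1 he))]

end ZeroSeries

section Concat

lemma ascN_concat {Q : List ℕ} (hQ : Q ≠ []) (c : ℕ) :
    ascN (Q ++ [c]) = ascN Q + if Q.getLastD 0 < c then 1 else 0 := by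
  obtain ⟨P, d, rfl⟩ := (List.eq_nil_or_concat Q).resolve_left hQ
  rw [List.concat_eq_append]
  have e1 : (P ++ [d] ++ [c]).length - 1 = P.length + 1 := by simp
  have e2 : (P ++ [d]).length - 1 = P.length := by simp
  rw [ascN, ascN, Finset.card_filter, Finset.card_filter, e1, e2, Finset.sum_range_succ]
  congr 1
  · refine Finset.sum_congr rfl fun i hi => ?_
    have hi := Finset.mem_range.1 hi
    rw [List.getD_append (P ++ [d]), List.getD_append (P ++ [d])] <;> simp <;> omega
  · rw [List.getD_append (P ++ [d]) _ _ _ (by simp), List.getD_append_right P _ _ _ le_rfl,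
      List.getD_append_right (P ++ [d]) _ _ _ (by simp)]
    simp

lemma repN_concat (Q : List ℕ) (c : ℕ) :
    repN (Q ++ [c]) = repN Q + if c ∈ Q then 1 else 0 := by
  have h : ∀ s : List ℕ, repN s = s.length - s.toFinset.card := fun s => by
    rw [repN, List.card_toFinset]
  have h1 := Q.toFinset_card_le
  rw [h, h, List.toFinset_append, List.toFinset_cons, List.toFinset_nil, Finset.union_insert,
    Finset.union_empty, Finset.card_insert_eq_ite]
  simp only [List.mem_toFinset, List.length_append, List.length_singleton]
  split_ifs <;> omega

lemma zeroN_concat (Q : List ℕ) (c : ℕ) :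
    zeroN (Q ++ [c]) = zeroN Q + if c = 0 then 1 else 0 := by
  rw [zeroN, zeroN, Finset.card_filter, Finset.card_filter, List.length_append,
    List.length_singleton, Finset.sum_range_succ, List.getD_append_right Q _ _ _ le_rfl]
  congr 1
  · refine Finset.sum_congr rfl fun i hi => ?_
    rw [List.getD_append Q _ _ _ (Finset.mem_range.1 hi)]
  · simp

lemma maxN_concat (Q : List ℕ) (c : ℕ) :
    maxN (Q ++ [c]) = maxN Q + if c = Q.length then 1 else 0 := by
  rw [maxN, maxN, Finset.card_filter, Finset.card_filter, List.length_append,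
    List.length_singleton, Finset.sum_range_succ, List.getD_append_right Q _ _ _ le_rfl]
  congr 1
  · refine Finset.sum_congr rfl fun i hi => ?_
    rw [List.getD_append Q _ _ _ (Finset.mem_range.1 hi)]
  · simp

lemma ascN_lt_length {Q : List ℕ} (hQ : Q ≠ []) : ascN Q < Q.length := by
  have h := Finset.card_filter_le (Finset.range (Q.length - 1))
    fun i => Q.getD i 0 < Q.getD (i + 1) 0
  rw [Finset.card_range] at h
  have := List.length_pos_iff.2 hQ
  rw [ascN]
  omega

lemma isAscSeq_concat {Q : List ℕ} (hQ : Q ≠ []) (c : ℕ) :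
    IsAscSeq (Q ++ [c]) ↔ IsAscSeq Q ∧ c ≤ ascN Q + 1 := by
  have hlt := ascN_lt_length hQ
  have h : ∀ p : ℕ → Prop, (∀ i < (Q ++ [c]).length, p i) ↔ (∀ i < Q.length, p i) ∧ p Q.length :=
    fun p => by
      rw [List.length_append, List.length_singleton]
      exact Nat.forall_lt_succ_right
  have h1 : ∀ i < Q.length, (Q ++ [c]).getD i 0 = Q.getD i 0 :=
    fun i hi => List.getD_append Q _ _ _ hi
  have h2 : (Q ++ [c]).getD Q.length 0 = c := by
    rw [List.getD_append_right Q _ _ _ le_rfl]; simp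
  have h3 : ∀ i < Q.length, (Q ++ [c]).take i = Q.take i :=
    fun i hi => List.take_append_of_le_length hi.le
  have h4 : (Q ++ [c]).take Q.length = Q := List.take_left
  rw [IsAscSeq, IsAscSeq, IsInvSeq, IsInvSeq, h, h, h2, h4]
  rw [forall₂_congr fun i hi => by rw [h1 i hi],
    forall₂_congr (p := fun i _ => (Q ++ [c]).getD i 0 ≤ _) fun i hi => by rw [h1 i hi, h3 i hi]]
  constructor
  · rintro ⟨⟨a, -⟩, b, d⟩
    exact ⟨⟨a, b⟩, d⟩
  · rintro ⟨⟨a, b⟩, d⟩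
    exact ⟨⟨a, by omega⟩, b, d⟩

end Concat

section Rank

/-- The number of elements of `L` below `c`. -/
def rankIn (L : Finset ℕ) (c : ℕ) : ℕ := (L.filter (· < c)).card

lemma rankIn_mono (L : Finset ℕ) : Monotone (rankIn L) := fun _ _ h =>
  Finset.card_le_card (Finset.monotone_filter_right L fun _ _ h' => lt_of_lt_of_le h' h)

lemma rankIn_lt_rankIn {L : Finset ℕ} {c d : ℕ} (hc : c ∈ L) (h : c < d) : rankIn L c < rankIn L d :=
  Finset.card_lt_card <| Finset.ssubset_iff_subset_ne.2
    ⟨Finset.monotone_filter_right L fun _ _ h' => lt_trans h' h, fun h' => by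
      have : c ∈ L.filter (· < d) := Finset.mem_filter.2 ⟨hc, h⟩
      rw [← h'] at this
      simp at this⟩

lemma rankIn_lt_rankIn_iff {L : Finset ℕ} {c d : ℕ} (hc : c ∈ L) : rankIn L c < rankIn L d ↔ c < d :=
  ⟨fun h => lt_of_not_ge fun h' => (rankIn_mono L h').not_gt h, rankIn_lt_rankIn hc⟩

lemma rankIn_lt_rankIn_succ_iff {L : Finset ℕ} {c d : ℕ} (hd : d ∈ L) :
    rankIn L c < rankIn L d + 1 ↔ c ≤ d := by
  rw [Nat.lt_succ_iff, ← not_lt, rankIn_lt_rankIn_iff hd, not_lt]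

lemma rankIn_zero (L : Finset ℕ) : rankIn L 0 = 0 := by simp [rankIn]

lemma rankIn_eq_zero_iff {L : Finset ℕ} (h0 : 0 ∈ L) {c : ℕ} : rankIn L c = 0 ↔ c = 0 := by
  have := rankIn_lt_rankIn_iff (d := c) h0
  rw [rankIn_zero] at this
  omega

lemma rankIn_insert {L : Finset ℕ} {m c : ℕ} (h : c ≤ m) : rankIn (insert m L) c = rankIn L c := by
  rw [rankIn, Finset.filter_insert, if_neg (not_lt.2 h), rankIn]

lemma rankIn_range {m c : ℕ} (h : c ≤ m) : rankIn (Finset.range m) c = c := by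
  have : (Finset.range m).filter (· < c) = Finset.range c := by
    ext j; simp only [Finset.mem_filter, Finset.mem_range]; omega
  rw [rankIn, this, Finset.card_range]

lemma sum_rankIn {M : Type*} [AddCommMonoid M] (L : Finset ℕ) (F : ℕ → M) :
    ∑ c ∈ L, F (rankIn L c) = ∑ k ∈ Finset.range L.card, F k := by
  induction L using Finset.induction_on_max with
  | empty => simp
  | insert m L hm ih =>
    have hmL : m ∉ L := fun h => (hm m h).false
    have h1 : rankIn L m = L.card := by rw [rankIn, Finset.filter_true_of_mem hm]
    rw [Finset.sum_insert hmL, Finset.card_insert_of_notMem hmL, Finset.sum_range_succ, ← ih,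
      rankIn_insert le_rfl, h1, add_comm]
    exact congrArg (· + F L.card) (Finset.sum_congr rfl fun c hc => by
      rw [rankIn_insert (hm c hc).le])

end Rank

section Flag

variable {R : Type*} [CommRing R]

lemma sum_Icc_insert {M : Type*} [AddCommMonoid M] {S T : Finset ℕ} {m : ℕ} (hm : m ∉ T)
    (hS : S ⊆ T) (F : Finset ℕ → M) :
    ∑ L ∈ Finset.Icc S (insert m T), F L =
      ∑ L ∈ Finset.Icc S T, F L + ∑ L ∈ Finset.Icc S T, F (insert m L) := by
  have h : ∀ T, Finset.Icc S T = T.powerset.filter (S ⊆ ·) := fun T => by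
    ext L; simp [and_comm]
  have hmS : m ∉ S := fun h => hm (hS h)
  rw [h, h, Finset.sum_filter, Finset.sum_powerset_insert hm, Finset.sum_filter,
    Finset.sum_filter]
  simp only [Finset.subset_insert_iff_of_notMem hmS]

lemma sum_Icc_pow {S T : Finset ℕ} (hS : S ⊆ T) (a : R) :
    ∑ L ∈ Finset.Icc S T, (a - 1) ^ (T.card - L.card) = a ^ (T.card - S.card) := by
  have h := Finset.sum_pow_mul_eq_add_pow (1 : R) (a - 1) (T \ S)
  rw [add_sub_cancel, Finset.card_sdiff_of_subset hS] at h
  rw [← h]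
  refine Finset.sum_nbij' (· \ S) (S ∪ ·) ?_ ?_ ?_ ?_ ?_
  · intro L hL
    exact Finset.mem_powerset.2 (Finset.sdiff_subset_sdiff (Finset.mem_Icc.1 hL).2 le_rfl)
  · intro L hL
    have := Finset.mem_powerset.1 hL
    exact Finset.mem_Icc.2 ⟨Finset.subset_union_left,
      Finset.union_subset hS (this.trans Finset.sdiff_subset)⟩
  · intro L hL
    exact Finset.union_sdiff_of_subset (Finset.mem_Icc.1 hL).1
  · intro L hL
    have := Finset.mem_powerset.1 hL
    exact Finset.union_sdiff_cancel_left
      (Finset.disjoint_of_subset_right this Finset.disjoint_sdiff)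
  · intro L hL
    have hL := Finset.mem_Icc.1 hL
    have h1 := Finset.card_le_card hL.1
    rw [one_pow, one_mul, Finset.card_sdiff_of_subset hL.1]
    congr 1
    omega

/-- Sum over all ways to extend the ascent sequence `Q` by `k` letters, with weight `a` for each
repeated letter, `b` for each ascent, and `χ` of the final sequence. -/
def extensionSum (a b : R) (χ : List ℕ → R) : ℕ → List ℕ → R
  | 0, Q => χ Q
  | k + 1, Q => ∑ c ∈ Finset.range (ascN Q + 2),
      (if c ∈ Q then a else 1) * (if Q.getLastD 0 < c then b else 1) *
        extensionSum a b χ k (Q ++ [c])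

/-- Refining extensions of an ascent sequence by the set of letters which will eventually be used
turns them into words of the letter automaton. -/
lemma extensionSum_eq_wordSum (a b : R) {χ : List ℕ → R}
    (hχ : ∀ (Q : List ℕ) (L : Finset ℕ), 0 ∈ Q → (∀ c ∈ Q, c ∈ L) → χ (Q.map (rankIn L)) = χ Q)
    (k : ℕ) {Q : List ℕ} (h0 : 0 ∈ Q) (hQ : ∀ c ∈ Q, c ≤ ascN Q) :
    a ^ (ascN Q + 2 - Q.toFinset.card) * extensionSum a b χ k Q =
      ∑ L ∈ Finset.Icc Q.toFinset (Finset.range (ascN Q + 2)),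
        (a - 1) ^ (ascN Q + 2 - L.card) * wordSum a b (b * (a - 1)) k L.card
          (rankIn L (Q.getLastD 0) + 1) (fun w => χ (Q.map (rankIn L) ++ w)) := by
  have hST : ∀ {Q : List ℕ}, (∀ c ∈ Q, c ≤ ascN Q) → Q.toFinset ⊆ Finset.range (ascN Q + 2) :=
    fun hQ c hc => by
      have := hQ c (List.mem_toFinset.1 hc)
      rw [Finset.mem_range]; omega
  induction k generalizing Q with
  | zero =>
    have h := sum_Icc_pow (hST hQ) a
    rw [Finset.card_range] at h
    rw [extensionSum, ← h, Finset.sum_mul]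
    refine Finset.sum_congr rfl fun L hL => ?_
    rw [wordSum, List.append_nil, hχ Q L h0 fun c hc =>
      (Finset.mem_Icc.1 hL).1 (List.mem_toFinset.2 hc)]
  | succ k ih =>
    have hne : Q ≠ [] := List.ne_nil_of_mem h0
    have hlast : Q.getLastD 0 ∈ Q := by
      rw [List.getLastD_eq_getLast?, List.getLast?_eq_getLast_of_ne_nil hne]
      exact List.getLast_mem hne
    set N := ascN Q with hN
    set W : Finset ℕ → ℕ → ℕ → R := fun L B c => wordSum a b (b * (a - 1)) k B
      (rankIn L c + 1) (fun w => χ ((Q ++ [c]).map (rankIn L) ++ w)) with hW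
    have key : ∀ L ∈ Finset.Icc Q.toFinset (Finset.range (N + 2)),
        (a - 1) ^ (N + 2 - L.card) * wordSum a b (b * (a - 1)) (k + 1) L.card
          (rankIn L (Q.getLastD 0) + 1) (fun w => χ (Q.map (rankIn L) ++ w)) =
        ∑ c ∈ Finset.range (N + 2), if c ∈ L then (a - 1) ^ (N + 2 - L.card) *
          (if c ≤ Q.getLastD 0 then a * W L L.card c else
            b * W L (L.card + 1) c + b * (a - 1) * W L L.card c) else 0 := by
      intro L hL
      have hL := Finset.mem_Icc.1 hL
      have hlL : Q.getLastD 0 ∈ L := hL.1 (List.mem_toFinset.2 hlast)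
      rw [← Finset.sum_filter, Finset.filter_mem_eq_inter, Finset.inter_eq_right.2 hL.2,
        ← Finset.mul_sum, wordSum, letterSum, ← sum_rankIn]
      simp only [rankIn_lt_rankIn_succ_iff hlL, hW, List.map_append, List.map_cons, List.map_nil,
        List.append_assoc, List.singleton_append]
    rw [Finset.sum_congr rfl key, Finset.sum_comm, extensionSum, Finset.mul_sum]
    refine Finset.sum_congr rfl fun c hc => ?_
    have hcN := Finset.mem_range.1 hc
    have hIcc : (Finset.Icc Q.toFinset (Finset.range (N + 2))).filter (c ∈ ·) =
        Finset.Icc (Q ++ [c]).toFinset (Finset.range (N + 2)) := by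
      ext L
      simp [Finset.insert_subset_iff, List.toFinset_append, and_comm, and_assoc, and_left_comm]
    rw [← Finset.sum_filter, hIcc]
    have h0' : 0 ∈ Q ++ [c] := List.mem_append_left _ h0
    have hasc := ascN_concat hne c
    have hcard : (Q ++ [c]).toFinset.card = Q.toFinset.card + if c ∈ Q then 0 else 1 := by
      rw [List.toFinset_append, List.toFinset_cons, List.toFinset_nil, Finset.union_insert,
        Finset.union_empty, Finset.card_insert_eq_ite]
      simp only [List.mem_toFinset]
      split_ifs <;> rfl
    have hle := Finset.card_le_card (hST hQ)
    rw [Finset.card_range, ← hN] at hle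
    have hlastc : (Q ++ [c]).getLastD 0 = c := by simp
    by_cases hcl : c ≤ Q.getLastD 0
    · rw [if_neg (not_lt.2 hcl), add_zero, ← hN] at hasc
      have hQ' : ∀ d ∈ Q ++ [c], d ≤ ascN (Q ++ [c]) := by
        intro d hd
        rw [hasc]
        rcases List.mem_append.1 hd with hd | hd
        · exact hQ d hd
        · rw [List.mem_singleton.1 hd]
          exact hcl.trans (hQ _ hlast)
      have hle' := Finset.card_le_card (hST hQ')
      rw [Finset.card_range, hasc] at hle'
      have h1 := ih h0' hQ'
      rw [hasc, hlastc] at h1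
      have h2 : a ^ (N + 2 - Q.toFinset.card) * (if c ∈ Q then a else 1) =
          a * a ^ (N + 2 - (Q ++ [c]).toFinset.card) := by
        by_cases hcQ : c ∈ Q
        · rw [hcard, if_pos hcQ, if_pos hcQ, add_zero, mul_comm]
        · rw [if_neg hcQ] at hcard ⊢
          rw [mul_one, ← pow_succ']
          congr 1
          omega
      simp only [if_neg (not_lt.2 hcl), if_pos hcl, mul_one]
      rw [← mul_assoc, h2, mul_assoc, h1, Finset.mul_sum]
      refine Finset.sum_congr rfl fun L _ => ?_
      simp only [hW]
      ring
    · have hcl' := not_le.1 hcl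
      rw [if_pos hcl', ← hN] at hasc
      have hQ' : ∀ d ∈ Q ++ [c], d ≤ ascN (Q ++ [c]) := by
        intro d hd
        rw [hasc]
        rcases List.mem_append.1 hd with hd | hd
        · exact (hQ d hd).trans (Nat.le_succ _)
        · rw [List.mem_singleton.1 hd]
          omega
      have hsub : (Q ++ [c]).toFinset ⊆ Finset.range (N + 2) := by
        intro d hd
        have := hQ' d (List.mem_toFinset.1 hd)
        rw [Finset.mem_range]; omega
      have h1 := ih h0' hQ'
      rw [hasc, hlastc, show N + 1 + 2 = (N + 2) + 1 by ring, Finset.range_add_one,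
        sum_Icc_insert Finset.notMem_range_self hsub, ← Finset.sum_add_distrib] at h1
      have h2 : a ^ (N + 2 - Q.toFinset.card) * (if c ∈ Q then a else 1) =
          a ^ (N + 2 + 1 - (Q ++ [c]).toFinset.card) := by
        by_cases hcQ : c ∈ Q
        · rw [hcard, if_pos hcQ, if_pos hcQ, add_zero, ← pow_succ]
          congr 1
          omega
        · rw [if_neg hcQ] at hcard ⊢
          rw [mul_one]
          congr 1
          omega
      simp only [if_pos hcl', if_neg hcl]
      have h3 : a ^ (N + 2 - Q.toFinset.card) * ((if c ∈ Q then a else 1) * b *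
          extensionSum a b χ k (Q ++ [c])) = b * (a ^ (N + 2 + 1 - (Q ++ [c]).toFinset.card) *
            extensionSum a b χ k (Q ++ [c])) := by
        rw [← h2]; ring
      rw [h3, h1, Finset.mul_sum]
      refine Finset.sum_congr rfl fun L hL => ?_
      have hL := (Finset.mem_Icc.1 hL).2
      have hm : N + 2 ∉ L := fun h => Finset.notMem_range_self (hL h)
      have hcardL := Finset.card_le_card hL
      rw [Finset.card_range] at hcardL
      have hmap : (Q ++ [c]).map (rankIn (insert (N + 2) L)) = (Q ++ [c]).map (rankIn L) :=
        List.map_congr_left fun d hd => rankIn_insert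
          (Finset.mem_range.1 (hsub (List.mem_toFinset.2 hd))).le
      rw [Finset.card_insert_of_notMem hm, rankIn_insert hcN.le, hmap]
      have e1 : N + 2 + 1 - L.card = N + 2 - L.card + 1 := by omega
      have e2 : N + 2 + 1 - (L.card + 1) = N + 2 - L.card := by omega
      rw [e1, e2]
      simp only [hW]
      ring

end Flag

section ExtensionSums

variable {R : Type*} [CommRing R]

lemma zeroN_map_rankIn {L : Finset ℕ} (h0 : 0 ∈ L) (Q : List ℕ) :
    zeroN (Q.map (rankIn L)) = zeroN Q := by
  induction Q with
  | nil => rfl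
  | cons c Q ih => simp only [List.map_cons, zeroN_cons, ih, rankIn_eq_zero_iff h0]

lemma rminN_map_rankIn {L : Finset ℕ} {Q : List ℕ} (hQ : ∀ c ∈ Q, c ∈ L) :
    rminN (Q.map (rankIn L)) = rminN Q := by
  induction Q with
  | nil => rfl
  | cons c Q ih =>
    have h : ∀ d ∈ Q, (rankIn L c < rankIn L d ↔ c < d) :=
      fun d _ => rankIn_lt_rankIn_iff (hQ c List.mem_cons_self)
    simp only [List.map_cons, rminN_cons, List.forall_mem_map,
      ih fun d hd => hQ d (List.mem_cons_of_mem _ hd)]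
    exact congrArg (rminN Q + ·) (if_congr (forall₂_congr h) rfl rfl)

lemma zeroN_append (Q w : List ℕ) : zeroN (Q ++ w) = zeroN Q + zeroN w := by
  induction Q with
  | nil => simp [zeroN]
  | cons c Q ih => rw [List.cons_append, zeroN_cons, zeroN_cons, ih]; ring

/-- Repeated-letter and ascent generating function by right-to-left minima, for a given number of
zeros. -/
lemma mul_extensionSum_rminN (x u z : R) (k n : ℕ) :
    x * extensionSum x u (fun s => if zeroN s = k + 1 then z ^ rminN s else 0) n [0] =
      PowerSeries.coeff (n + 1) (PowerSeries.C z * PowerSeries.C x ^ k * PowerSeries.X ^ (k + 1) *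
        ((wordOp x u (u * (x - 1)))^[k] (rminSeries x u (u * (x - 1)) z) 1 - 1) +
          PowerSeries.C z * PowerSeries.C x ^ (k + 1) * PowerSeries.X ^ (k + 1)) := by
  have hasc : ascN [0] = 0 := rfl
  have h := extensionSum_eq_wordSum x u
    (χ := fun s => if zeroN s = k + 1 then z ^ rminN s else 0)
    (fun Q L h0 hQ => by
      simp only [zeroN_map_rankIn (hQ 0 h0), rminN_map_rankIn hQ]) n (Q := [0]) (by simp) (by simp)
  have hT : Finset.range (0 + 2) = insert 1 {0} := by decide
  have hS : [0].toFinset = ({0} : Finset ℕ) := rfl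
  have hθ : (fun w => if zeroN (0 :: w) = k + 1 then z ^ rminN (0 :: w) else 0) =
      zeroWeight z k := by
    funext w
    simp [zeroWeight, zeroN_cons]
  rw [hasc, hS, hT, sum_Icc_insert (by simp) le_rfl, Finset.Icc_self] at h
  simp only [Finset.sum_singleton, Finset.card_singleton, List.getLastD_cons, List.getLastD_nil,
    rankIn_zero, List.map_cons, List.map_nil, List.singleton_append, hθ] at h
  have h1 : ∀ A, wordSum x u (u * (x - 1)) n (A + 1) 1 (zeroWeight z k) = PowerSeries.coeff n
      (PowerSeries.C z * (PowerSeries.X * PowerSeries.C x) ^ k *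
        (wordOp x u (u * (x - 1)))^[k] (rminSeries x u (u * (x - 1)) z) A) := fun A => by
    rw [← wordSeries_zeroWeight, wordSeries, PowerSeries.coeff_mk]
  have hc : (insert 1 ({0} : Finset ℕ)).card = 1 + 1 := rfl
  rw [hc, Nat.zero_add, h1 1, Nat.zero_add, show (1 : ℕ) = 0 + 1 from rfl, h1 0,
    wordOp_iterate_zero, rminSeries_zero] at h
  simp only [Nat.reduceAdd, Nat.reduceSub, pow_one, pow_zero, one_mul] at h
  have hX : PowerSeries.C z * PowerSeries.C x ^ k * PowerSeries.X ^ (k + 1) *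
        ((wordOp x u (u * (x - 1)))^[k] (rminSeries x u (u * (x - 1)) z) 1 - 1) +
          PowerSeries.C z * PowerSeries.C x ^ (k + 1) * PowerSeries.X ^ (k + 1) =
      PowerSeries.X * (PowerSeries.C (x - 1) *
        (PowerSeries.C z * (PowerSeries.X * PowerSeries.C x) ^ k * 1) +
          PowerSeries.C z * (PowerSeries.X * PowerSeries.C x) ^ k *
            (wordOp x u (u * (x - 1)))^[k] (rminSeries x u (u * (x - 1)) z) 1) := by
    rw [map_sub, map_one]
    ring
  rw [h, hX, PowerSeries.coeff_succ_X_mul, map_add, PowerSeries.coeff_C_mul]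

/-- Once a sequence has fallen behind the staircase, its statistic `maxN` is frozen. -/
lemma extensionSum_maxN_of_lt (a b : R) (ψ : List ℕ → R) (p k : ℕ) {Q : List ℕ} (hne : Q ≠ [])
    (hQ : ascN Q + 1 < Q.length) :
    extensionSum a b (fun s => if maxN s = p then ψ s else 0) k Q =
      if maxN Q = p then extensionSum a b ψ k Q else 0 := by
  induction k generalizing Q with
  | zero => rfl
  | succ k ih =>
    have h : ∀ c ∈ Finset.range (ascN Q + 2),
        extensionSum a b (fun s => if maxN s = p then ψ s else 0) k (Q ++ [c]) =
          if maxN Q = p then extensionSum a b ψ k (Q ++ [c]) else 0 := by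
      intro c hc
      have hc := Finset.mem_range.1 hc
      rw [ih (by simp), maxN_concat, if_neg (show c ≠ Q.length by omega), add_zero]
      rw [ascN_concat hne, List.length_append, List.length_singleton]
      split_ifs <;> omega
    rw [extensionSum, extensionSum, Finset.sum_congr rfl fun c hc => by rw [h c hc]]
    split_ifs <;> simp

lemma extensionSum_maxN_eq_zero (a b : R) (ψ : List ℕ → R) (p k : ℕ) {Q : List ℕ}
    (hQ : p < maxN Q) :
    extensionSum a b (fun s => if maxN s = p then ψ s else 0) k Q = 0 := by
  induction k generalizing Q with
  | zero => exact if_neg hQ.ne'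
  | succ k ih =>
    rw [extensionSum]
    refine Finset.sum_eq_zero fun c _ => ?_
    rw [ih (by rw [maxN_concat]; omega), mul_zero]

lemma ascN_range (p : ℕ) : ascN (List.range (p + 1)) = p := by
  induction p with
  | zero => rfl
  | succ p ih =>
    rw [List.range_succ, ascN_concat (by simp), ih, List.range_succ]
    simp

lemma maxN_range (p : ℕ) : maxN (List.range p) = p := by
  induction p with
  | zero => rfl
  | succ p ih => rw [List.range_succ, maxN_concat, ih]; simp

lemma zeroN_range (p : ℕ) : zeroN (List.range (p + 1)) = 1 := by
  induction p with
  | zero => rfl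
  | succ p ih => rw [List.range_succ, zeroN_concat, ih]; simp

lemma getLastD_range (p : ℕ) : (List.range (p + 1)).getLastD 0 = p := by
  rw [List.range_succ]; simp

/-- Peeling off the initial staircase. -/
lemma extensionSum_range (a b : R) (ψ : List ℕ → R) (m k j : ℕ) :
    extensionSum a b (fun s => if maxN s = j + 1 + m then ψ s else 0) k (List.range (j + 1)) =
      if k < m then 0 else b ^ m * extensionSum a b
        (fun s => if maxN s = j + 1 + m then ψ s else 0) (k - m) (List.range (j + 1 + m)) := by
  induction m generalizing k j with
  | zero => simp
  | succ m ih =>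
    cases k with
    | zero => simp [extensionSum, maxN_range]
    | succ k =>
      rw [extensionSum, ascN_range, Finset.sum_range_succ, Finset.sum_eq_zero, zero_add]
      · rw [← List.range_succ, getLastD_range, if_neg (by simp), if_pos (Nat.lt_succ_self j),
          one_mul]
        have h := ih k (j + 1)
        rw [show j + 1 + 1 + m = j + 1 + (m + 1) by ring] at h
        rw [h]
        split_ifs with h1 h2 h2
        · simp
        · omega
        · omega
        · rw [Nat.add_sub_add_right]; ring
      · intro c hc
        have hc := Finset.mem_range.1 hc
        rw [extensionSum_maxN_of_lt _ _ _ _ _ (by simp), maxN_concat, maxN_range,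
          List.length_range, if_neg hc.ne, add_zero,
          if_neg (show j + 1 ≠ j + 1 + (m + 1) by omega), mul_zero]
        · rw [ascN_concat (by simp), ascN_range, getLastD_range]
          simp; omega

lemma mul_extensionSum_zeroN (x u z : R) (p e k : ℕ) (he : e < p + 1) :
    u * extensionSum u x (fun s => z ^ zeroN s) k (List.range (p + 1) ++ [e]) =
      z * (if e = 0 then z else 1) * PowerSeries.coeff k
        ((PowerSeries.C u - 1) * zeroSeries x u z (p + 1) (e + 1) +
          zeroSeries x u z (p + 2) (e + 1)) := by
  set Q := List.range (p + 1) ++ [e] with hQ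
  have hasc : ascN Q = p := by
    rw [hQ, ascN_concat (by simp), ascN_range, getLastD_range, if_neg (by omega), add_zero]
  have hS : Q.toFinset = Finset.range (p + 1) := by
    ext c; simp [hQ]; omega
  have h0 : 0 ∈ Q := by simp [hQ]
  have h := extensionSum_eq_wordSum u x (χ := fun s => z ^ zeroN s)
    (fun Q L h0 hQ => by simp only [zeroN_map_rankIn (hQ 0 h0)]) k h0
    (fun c hc => by
      have := List.mem_toFinset.2 hc
      rw [hS, Finset.mem_range] at this
      omega)
  have hlast : Q.getLastD 0 = e := by simp [hQ]
  have hz : zeroN Q = 1 + if e = 0 then 1 else 0 := by rw [hQ, zeroN_concat, zeroN_range]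
  rw [hasc, hS, show p + 2 = (p + 1) + 1 by ring, Finset.range_add_one (n := p + 1),
    sum_Icc_insert Finset.notMem_range_self le_rfl, Finset.Icc_self] at h
  have h1 : 0 ∈ Finset.range (p + 1) := by simp
  have h2 : 0 ∈ insert (p + 1) (Finset.range (p + 1)) := by simp
  have hz' : z ^ zeroN Q = z * if e = 0 then z else 1 := by
    rw [hz]; split_ifs <;> ring
  simp only [Finset.sum_singleton, hlast, zeroN_append, zeroN_map_rankIn h1, zeroN_map_rankIn h2,
    rankIn_insert he.le, rankIn_range he.le, Finset.card_insert_of_notMem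
    Finset.notMem_range_self, Finset.card_range, pow_add, wordSum_mul, hz'] at h
  have e1 : p + 1 + 1 - (p + 1) = 1 := by omega
  rw [e1, Nat.sub_self, pow_zero, pow_one, pow_one, one_mul] at h
  have e2 : ∀ f g : PowerSeries R, PowerSeries.coeff k ((PowerSeries.C u - 1) * f + g) =
      (u - 1) * PowerSeries.coeff k f + PowerSeries.coeff k g := fun f g => by
    rw [sub_mul, one_mul, map_add, map_sub, PowerSeries.coeff_C_mul]
    ring
  rw [h, e2]
  simp only [zeroSeries, wordSeries, PowerSeries.coeff_mk]
  ring

/-- Repeated-letter and ascent generating function by zeros, for a given value of `maxN`. -/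
lemma mul_extensionSum_maxN (x u z : R) (p n : ℕ) :
    x * extensionSum u x (fun s => if maxN s = p + 1 then z ^ zeroN s else 0) n [0] =
      PowerSeries.coeff (n + 1) (∑ e ∈ Finset.range (p + 1),
        (if e = 0 then PowerSeries.C z else 1) *
        (PowerSeries.C z * PowerSeries.C x ^ (p + 1) * PowerSeries.X ^ (p + 2) *
          ((PowerSeries.C u - 1) * zeroSeries x u z (p + 1) (e + 1) +
            zeroSeries x u z (p + 2) (e + 1))) +
        PowerSeries.C z * PowerSeries.C x ^ (p + 1) * PowerSeries.X ^ (p + 1)) := by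
  set Z : ℕ → PowerSeries R := fun e => (PowerSeries.C u - 1) * zeroSeries x u z (p + 1) (e + 1) +
    zeroSeries x u z (p + 2) (e + 1) with hZ
  have hX : ∑ e ∈ Finset.range (p + 1), (if e = 0 then PowerSeries.C z else 1) *
        (PowerSeries.C z * PowerSeries.C x ^ (p + 1) * PowerSeries.X ^ (p + 2) * Z e) +
        PowerSeries.C z * PowerSeries.C x ^ (p + 1) * PowerSeries.X ^ (p + 1) =
      PowerSeries.X ^ (p + 1) * (PowerSeries.C (z * x ^ (p + 1)) +
        PowerSeries.X * ∑ e ∈ Finset.range (p + 1),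
          PowerSeries.C (z * x ^ (p + 1) * if e = 0 then z else 1) * Z e) := by
    rw [mul_add, ← mul_assoc, Finset.mul_sum, add_comm]
    congr 1
    · rw [map_mul, map_pow]; ring
    · refine Finset.sum_congr rfl fun e _ => ?_
      rw [map_mul, map_mul, map_pow, apply_ite PowerSeries.C, map_one]
      ring
  have h := extensionSum_range u x (fun s => z ^ zeroN s) p n 0
  rw [show 0 + 1 + p = p + 1 by ring, show List.range (0 + 1) = [0] from rfl] at h
  rw [h, hX]
  split_ifs with hn
  · rw [mul_zero, PowerSeries.X_pow_dvd_iff.1 (dvd_mul_right _ _) _ (Nat.succ_lt_succ hn)]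
  · obtain ⟨t, rfl⟩ := Nat.exists_eq_add_of_le (not_lt.1 hn)
    rw [show p + t + 1 = t + (p + 1) by ring, PowerSeries.coeff_X_pow_mul,
      Nat.add_sub_cancel_left]
    cases t with
    | zero =>
      simp [extensionSum, maxN_range, zeroN_range]
      ring
    | succ t =>
      rw [map_add, PowerSeries.coeff_succ_X_mul, PowerSeries.coeff_C, if_neg (Nat.succ_ne_zero t),
        zero_add, map_sum, extensionSum, ascN_range, Finset.sum_range_succ,
        extensionSum_maxN_eq_zero (Q := List.range (p + 1) ++ [p + 1]), mul_zero, add_zero,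
        Finset.mul_sum, Finset.mul_sum]
      · refine Finset.sum_congr rfl fun e he => ?_
        have he := Finset.mem_range.1 he
        rw [PowerSeries.coeff_C_mul, getLastD_range, if_pos (List.mem_range.2 he),
          if_neg (show ¬ p < e by omega), extensionSum_maxN_of_lt _ _ _ _ _ (by simp),
          maxN_concat, maxN_range, List.length_range, if_neg he.ne, add_zero, if_pos rfl]
        · linear_combination x ^ (p + 1) * mul_extensionSum_zeroN x u z p e t he
        · rw [ascN_concat (by simp), ascN_range, getLastD_range, if_neg (by omega)]
          simp
      · rw [← List.range_succ, maxN_range]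
        exact Nat.lt_succ_self _

lemma mul_extensionSum_eq (x u z : R) (p n : ℕ) :
    x * extensionSum u x (fun s => if maxN s = p + 1 then z ^ zeroN s else 0) n [0] =
      x * extensionSum x u (fun s => if zeroN s = p + 1 then z ^ rminN s else 0) n [0] := by
  rw [mul_extensionSum_maxN, mul_extensionSum_rminN, sum_zeroSeries_eq_wordOp]

end ExtensionSums

section Enumeration

/-- The ascent sequences of length `n + 1`. -/
def ascFinset : ℕ → Finset (List ℕ)
  | 0 => {[0]}
  | n + 1 => ((ascFinset n).sigma fun Q => Finset.range (ascN Q + 2)).image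
      fun q => q.1 ++ [q.2]

lemma mem_ascFinset (n : ℕ) (s : List ℕ) : s ∈ ascFinset n ↔ IsAscSeq s ∧ s.length = n + 1 := by
  induction n generalizing s with
  | zero =>
    rw [ascFinset, Finset.mem_singleton]
    constructor
    · rintro rfl
      simp [IsAscSeq, IsInvSeq]
    · rintro ⟨⟨h, -⟩, hs⟩
      obtain ⟨c, rfl⟩ := List.length_eq_one_iff.1 hs
      simpa using h 0 (by simp)
  | succ n ih =>
    simp only [ascFinset, Finset.mem_image, Finset.mem_sigma, Sigma.exists, ih, Finset.mem_range]
    constructor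
    · rintro ⟨Q, c, ⟨⟨hQ, hl⟩, hc⟩, rfl⟩
      have hne : Q ≠ [] := List.ne_nil_of_length_eq_add_one hl
      exact ⟨(isAscSeq_concat hne c).2 ⟨hQ, by omega⟩, by simp [hl]⟩
    · rintro ⟨hs, hl⟩
      obtain ⟨Q, c, rfl⟩ := (List.eq_nil_or_concat s).resolve_left
        (List.ne_nil_of_length_eq_add_one hl)
      rw [List.concat_eq_append] at hs hl ⊢
      have hl' : Q.length = n + 1 := by simpa using hl
      have hne : Q ≠ [] := List.ne_nil_of_length_eq_add_one hl'
      obtain ⟨hQ, hc⟩ := (isAscSeq_concat hne c).1 hs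
      exact ⟨Q, c, ⟨⟨hQ, hl'⟩, by omega⟩, rfl⟩

lemma sum_ascFinset {R : Type*} [CommRing R] (a b : R) (χ : List ℕ → R) (n : ℕ) :
    ∑ s ∈ ascFinset n, a ^ repN s * b ^ ascN s * χ s = extensionSum a b χ n [0] := by
  have key : ∀ n k, ∑ s ∈ ascFinset n, a ^ repN s * b ^ ascN s * extensionSum a b χ k s =
      extensionSum a b χ (n + k) [0] := by
    intro n
    induction n with
    | zero => intro k; simp [ascFinset, repN, ascN]
    | succ n ih =>
      intro k
      rw [ascFinset, Finset.sum_image, Finset.sum_sigma, Nat.succ_add_eq_add_succ, ← ih (k + 1)]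
      · refine Finset.sum_congr rfl fun Q hQ => ?_
        have hne : Q ≠ [] := List.ne_nil_of_length_eq_add_one ((mem_ascFinset n Q).1 hQ).2
        rw [extensionSum, Finset.mul_sum]
        refine Finset.sum_congr rfl fun c _ => ?_
        rw [repN_concat, ascN_concat hne, pow_add, pow_add]
        split_ifs <;> ring
      · rintro ⟨Q, c⟩ - ⟨Q', c'⟩ - h
        obtain ⟨rfl, h⟩ := List.append_inj' h rfl
        obtain rfl : c = c' := List.singleton_injective h
        rfl
  exact key n 0

open MvPolynomial in
/-- The number of elements with given statistics is a coefficient of a polynomial. -/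
lemma coeff_sum_X_pow (A : Finset (List ℕ)) (P : List ℕ → Prop) [DecidablePred P]
    (f g h : List ℕ → ℕ) (a b c : ℕ) :
    coeff (Finsupp.single 0 a + Finsupp.single 1 b + Finsupp.single 2 c)
      (∑ s ∈ A, X 0 ^ f s * X 1 ^ g s * (if P s then X 2 ^ h s else 0) :
        MvPolynomial (Fin 3) ℤ) =
      ((A.filter fun s => f s = a ∧ g s = b ∧ h s = c ∧ P s).card : ℤ) := by
  rw [coeff_sum, Finset.card_filter, Nat.cast_sum]
  refine Finset.sum_congr rfl fun s _ => ?_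
  by_cases hP : P s
  · rw [if_pos hP, X_pow_eq_monomial, X_pow_eq_monomial, X_pow_eq_monomial, monomial_mul,
      monomial_mul, coeff_monomial]
    have : Finsupp.single (0 : Fin 3) (f s) + Finsupp.single 1 (g s) + Finsupp.single 2 (h s) =
        Finsupp.single 0 a + Finsupp.single 1 b + Finsupp.single 2 c ↔
        f s = a ∧ g s = b ∧ h s = c := by
      constructor
      · intro H
        have h0 := DFunLike.congr_fun H 0
        have h1 := DFunLike.congr_fun H 1
        have h2 := DFunLike.congr_fun H 2
        simp at h0 h1 h2
        exact ⟨h0, h1, h2⟩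
      · rintro ⟨rfl, rfl, rfl⟩
        rfl
    simp [this, hP]
  · simp [hP]

lemma ncard_eq_card_filter_ascFinset (n : ℕ) (P : List ℕ → Prop) [DecidablePred P] :
    {s : List ℕ | IsAscSeq s ∧ s.length = n + 1 ∧ P s}.ncard =
      ((ascFinset n).filter P).card := by
  rw [← Set.ncard_coe_finset]
  congr 1
  ext s
  simp [mem_ascFinset, and_assoc]

lemma card_filter_ascFinset_eq (n p a b c : ℕ) :
    ((ascFinset n).filter fun s => ascN s = a ∧ repN s = b ∧ zeroN s = c ∧ maxN s = p + 1).card =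
      ((ascFinset n).filter fun s =>
        repN s = a ∧ ascN s = b ∧ rminN s = c ∧ zeroN s = p + 1).card := by
  have h := mul_left_cancel₀ (MvPolynomial.X_ne_zero 0)
    (mul_extensionSum_eq (MvPolynomial.X 0 : MvPolynomial (Fin 3) ℤ) (MvPolynomial.X 1)
      (MvPolynomial.X 2) p n)
  rw [← sum_ascFinset, ← sum_ascFinset] at h
  have h' := congrArg (MvPolynomial.coeff
    (Finsupp.single 0 a + Finsupp.single 1 b + Finsupp.single 2 c)) h
  rw [coeff_sum_X_pow, Finset.sum_congr rfl fun s _ => by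
    rw [mul_comm (_ ^ repN s)], coeff_sum_X_pow] at h'
  exact_mod_cast h'

lemma zeroN_pos {s : List ℕ} (hs : IsAscSeq s) (hl : 0 < s.length) : 0 < zeroN s :=
  Finset.card_pos.2 ⟨0, Finset.mem_filter.2 ⟨Finset.mem_range.2 hl, Nat.le_zero.1 (hs.1 0 hl)⟩⟩

lemma maxN_pos {s : List ℕ} (hs : IsAscSeq s) (hl : 0 < s.length) : 0 < maxN s :=
  Finset.card_pos.2 ⟨0, Finset.mem_filter.2 ⟨Finset.mem_range.2 hl, Nat.le_zero.1 (hs.1 0 hl)⟩⟩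

end Enumeration

/-- `(asc, rep, zero, max)` and `(rep, asc, rmin, zero)` are equidistributed on
ascent sequences of length `n ≥ 1`. -/
theorem quadruple_equidistribution (n : ℕ) (hn : 1 ≤ n) (a b c d : ℕ) :
    {s : List ℕ | IsAscSeq s ∧ s.length = n ∧
      ascN s = a ∧ repN s = b ∧ zeroN s = c ∧ maxN s = d}.ncard =
    {s : List ℕ | IsAscSeq s ∧ s.length = n ∧
      repN s = a ∧ ascN s = b ∧ rminN s = c ∧ zeroN s = d}.ncard := by
  obtain ⟨n, rfl⟩ := Nat.exists_eq_add_of_le' hn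
  cases d with
  | zero =>
    congr 1
    ext s
    constructor
    · rintro ⟨hs, hl, -, -, -, h⟩
      exact absurd h (maxN_pos hs (by omega)).ne'
    · rintro ⟨hs, hl, -, -, -, h⟩
      exact absurd h (zeroN_pos hs (by omega)).ne'
  | succ p =>
    rw [ncard_eq_card_filter_ascFinset, ncard_eq_card_filter_ascFinset]
    exact card_filter_ascFinset_eq n p a b c
end

section
/- For every n ≥ 1, the pair (rep, max) is equidistributed over ascent sequences of length n and over (2−1)-avoiding inversion sequences of length n: for all a, b, the number of ascent sequences s with rep(s)=a, max(s)=b equals the number of (2−1)-avoiding inversion sequences s with rep(s)=a, max(s)=b. -/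
/-- `s` avoids the pattern (2-1): no `i < j` with `s_i = s_j + 1`. -/
def Avoids21 (s : List ℕ) : Prop :=
  ∀ i j, i < j → j < s.length → s.getD i 0 ≠ s.getD j 0 + 1

section Algebra

variable {R : Type*} [CommRing R]

/-- The truncated generating function of a doubly indexed family. -/
def gsum (τ : R) (K : ℕ) (f : ℕ → ℕ → R) : R :=
  ∑ l ∈ Finset.range K, ∑ m ∈ Finset.range K, τ ^ (l + m) * f l m

lemma gsum_add (τ : R) (K : ℕ) (f g : ℕ → ℕ → R) :
    gsum τ K (fun l m => f l m + g l m) = gsum τ K f + gsum τ K g := by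
  simp only [gsum, mul_add, Finset.sum_add_distrib]

lemma gsum_sub (τ : R) (K : ℕ) (f g : ℕ → ℕ → R) :
    gsum τ K (fun l m => f l m - g l m) = gsum τ K f - gsum τ K g := by
  simp only [gsum, mul_sub, Finset.sum_sub_distrib]

lemma gsum_mul_left (τ : R) (K : ℕ) (a : R) (f : ℕ → ℕ → R) :
    gsum τ K (fun l m => a * f l m) = a * gsum τ K f := by
  simp only [gsum, Finset.mul_sum]
  exact Finset.sum_congr rfl fun _ _ => Finset.sum_congr rfl fun _ _ => by ring

lemma sum_range_pow_shift {τ : R} {K : ℕ} (hτ : τ ^ K = 0) (f : ℕ → R) :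
    ∑ n ∈ Finset.range K, τ ^ n * f n
      = f 0 * (if K = 0 then 0 else 1) + τ * ∑ n ∈ Finset.range K, τ ^ n * f (n + 1) := by
  have h := Finset.sum_range_succ (fun n => τ ^ n * f n) K
  rw [Finset.sum_range_succ'] at h
  rcases Nat.eq_zero_or_pos K with rfl | hK
  · simp
  · rw [hτ] at h
    simp only [pow_zero, one_mul, zero_mul, add_zero] at h
    rw [← h, if_neg hK.ne', mul_one, Finset.mul_sum, add_comm]
    congr 1
    exact Finset.sum_congr rfl fun _ _ => by ring

lemma gsum_shift_left {τ : R} {K : ℕ} (hτ : τ ^ K = 0) (f : ℕ → ℕ → R) (h0 : ∀ m, f 0 m = 0) :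
    gsum τ K f = τ * gsum τ K fun l m => f (l + 1) m := by
  have := sum_range_pow_shift hτ fun l => ∑ m ∈ Finset.range K, τ ^ m * f l m
  simp only [h0, mul_zero, Finset.sum_const_zero, zero_mul, zero_add] at this
  simp only [gsum, pow_add, mul_assoc]
  simpa only [Finset.mul_sum] using this

lemma gsum_shift_right {τ : R} {K : ℕ} (hτ : τ ^ K = 0) (f : ℕ → ℕ → R) (h0 : ∀ l, f l 0 = 0) :
    gsum τ K f = τ * gsum τ K fun l m => f l (m + 1) := by
  simp only [gsum, Finset.mul_sum]
  refine Finset.sum_congr rfl fun l _ => ?_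
  have := sum_range_pow_shift hτ fun m => f l m
  simp only [h0, zero_mul, zero_add] at this
  calc _ = τ ^ l * ∑ m ∈ Finset.range K, τ ^ m * f l m := by
        rw [Finset.mul_sum]; exact Finset.sum_congr rfl fun _ _ => by ring
    _ = _ := by
        rw [this, Finset.mul_sum, Finset.mul_sum]; exact Finset.sum_congr rfl fun _ _ => by ring

lemma gsum_eq_sum_antidiagonal {τ : R} {K : ℕ} (hτ : τ ^ K = 0) (f : ℕ → ℕ → R) :
    gsum τ K f = ∑ n ∈ Finset.range K, τ ^ n * ∑ p ∈ Finset.HasAntidiagonal.antidiagonal n, f p.1 p.2 := by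
  have h1 : ∑ n ∈ Finset.range K, τ ^ n * ∑ p ∈ Finset.HasAntidiagonal.antidiagonal n, f p.1 p.2
      = ∑ n ∈ Finset.range K, ∑ p ∈ Finset.HasAntidiagonal.antidiagonal n, τ ^ (p.1 + p.2) * f p.1 p.2 := by
    refine Finset.sum_congr rfl fun n _ => ?_
    rw [Finset.mul_sum]
    exact Finset.sum_congr rfl fun p hp => by rw [Finset.HasAntidiagonal.mem_antidiagonal.1 hp]
  have h2 : ∑ n ∈ Finset.range K, ∑ p ∈ Finset.HasAntidiagonal.antidiagonal n, τ ^ (p.1 + p.2) * f p.1 p.2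
      = ∑ p ∈ (Finset.range K ×ˢ Finset.range K).filter (fun p => p.1 + p.2 < K),
        τ ^ (p.1 + p.2) * f p.1 p.2 := by
    rw [Finset.sum_sigma']
    refine Finset.sum_bij' (fun x _ => x.2) (fun p _ => ⟨p.1 + p.2, p⟩) ?_ ?_ ?_ ?_ ?_
    · rintro ⟨n, p⟩ h
      simp only [Finset.mem_sigma, Finset.mem_range, Finset.HasAntidiagonal.mem_antidiagonal] at h
      simp only [Finset.mem_filter, Finset.mem_product, Finset.mem_range]
      omega
    · intro p h
      simp only [Finset.mem_filter] at h
      simpa using h.2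
    · rintro ⟨n, p⟩ h
      simp only [Finset.mem_sigma, Finset.HasAntidiagonal.mem_antidiagonal] at h
      obtain ⟨_, rfl⟩ := h
      rfl
    · intro p _
      rfl
    · intro x _
      rfl
  rw [h1, h2, gsum, ← Finset.sum_product', Finset.sum_filter]
  refine Finset.sum_congr rfl fun p _ => ?_
  split_ifs with h
  · rfl
  · rw [pow_eq_zero_of_le (Nat.le_of_not_lt h) hτ, zero_mul]

lemma sub_mul_sum_pow (α β : R) {d m : ℕ} (hd : d ≤ m) :
    (α - β) * ∑ c ∈ Finset.range d, α ^ c * β ^ (m - c) = β * (α ^ d * β ^ (m - d) - β ^ m) := by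
  have h := (Commute.all α β).geom_sum₂_mul d
  obtain ⟨e, rfl⟩ := Nat.exists_eq_add_of_le hd
  have : ∑ c ∈ Finset.range d, α ^ c * β ^ (d + e - c)
      = β ^ (e + 1) * ∑ c ∈ Finset.range d, α ^ c * β ^ (d - 1 - c) := by
    rw [Finset.mul_sum]
    refine Finset.sum_congr rfl fun c hc => ?_
    have hc := Finset.mem_range.1 hc
    rw [show d + e - c = (e + 1) + (d - 1 - c) by omega, pow_add β (e + 1)]
    ring
  rw [this, Nat.add_sub_cancel_left]
  linear_combination β ^ (e + 1) * h

/-- The functional equation forced by the recursive decomposition of ascent sequences along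
their initial run. -/
theorem functional_equation_of_run_recursion {τ v : R} {K : ℕ} (hK : 0 < K) (hτ : τ ^ K = 0)
    (h : ℕ → ℕ → ℕ → R) (P : ℕ → ℕ → R)
    (h_zero : ∀ m, ∀ c < m, h 0 m c = 0) (h_diag_zero : ∀ m, h 0 m m = 1)
    (h_diag : ∀ l m, h (l + 1) m m = P l (m + 1))
    (hP : ∀ l m, P l m = ∑ c ∈ Finset.range m, h l m c + h l m m)
    (h_rec : ∀ l m, ∀ c < m, h (l + 1) m c
      = v * P l m + ∑ d ∈ Finset.Ioo c m, (h l (m + 1) d - h l m d))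
    (F : R → R)
    (hF : ∀ β, F β = gsum τ K fun l m =>
      (∑ c ∈ Finset.range m, h l m c + if l = 0 then 1 else 0) * β ^ m)
    (β : R) :
    (1 - τ * β) * F β = 1 + v * τ * β * (F (1 + β * (1 - τ)) - F β) := by
  generalize hα : 1 + β * (1 - τ) = α
  have hαβ : α - β = 1 - τ * β := by rw [← hα]; ring
  set V : R → ℕ → ℕ → R := fun a l m => ∑ c ∈ Finset.range m, h l m c * (a ^ c * β ^ (m - c))
    with hV
  have hVβ : ∀ l m, V β l m = (∑ c ∈ Finset.range m, h l m c) * β ^ m := by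
    intro l m
    rw [hV, Finset.sum_mul]
    refine Finset.sum_congr rfl fun c hc => ?_
    rw [← pow_add, Nat.add_sub_cancel' (Finset.mem_range.1 hc).le]
  set N : ℕ → ℕ → R := fun l m => V α l m - V β l m with hN
  have hN' : ∀ l m, N l m = ∑ d ∈ Finset.range m, h l m d * (α ^ d * β ^ (m - d) - β ^ m) := by
    intro l m
    simp only [hN, hV, ← Finset.sum_sub_distrib]
    refine Finset.sum_congr rfl fun c hc => ?_
    rw [← pow_add, Nat.add_sub_cancel' (Finset.mem_range.1 hc).le]
    ring
  have hlast : ∀ l m, h l (m + 1) m = v * (h l m m - if l = 0 then 1 else 0) := by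
    intro l m
    rcases l with _ | l
    · simp [h_zero (m + 1) m (Nat.lt_succ_self m), h_diag_zero]
    · rw [h_rec l (m + 1) m (Nat.lt_succ_self m), h_diag]
      have : Finset.Ioo m (m + 1) = ∅ := by ext; simp
      simp [this]
  have hstep : ∀ l m, (α - β) * V α (l + 1) m
      = v * β * ((∑ c ∈ Finset.range m, h l m c + if l = 0 then 1 else 0) * (α ^ m - β ^ m))
        + (N l (m + 1) - β * N l m) := by
    intro l m
    have e1 : V α (l + 1) m = v * P l m * ∑ c ∈ Finset.range m, α ^ c * β ^ (m - c)
        + ∑ d ∈ Finset.range m, (h l (m + 1) d - h l m d)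
          * ∑ c ∈ Finset.range d, α ^ c * β ^ (m - c) := by
      have : ∀ c ∈ Finset.range m, h (l + 1) m c * (α ^ c * β ^ (m - c))
          = v * P l m * (α ^ c * β ^ (m - c))
            + ∑ d ∈ Finset.Ioo c m, (h l (m + 1) d - h l m d) * (α ^ c * β ^ (m - c)) := by
        intro c hc
        rw [h_rec l m c (Finset.mem_range.1 hc), add_mul, Finset.sum_mul]
      simp only [hV]
      rw [Finset.sum_congr rfl this, Finset.sum_add_distrib, ← Finset.mul_sum]
      congr 1
      simp only [Finset.mul_sum]
      refine Finset.sum_comm' fun c d => ?_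
      simp only [Finset.mem_range, Finset.mem_Ioo]
      omega
    have e2 : (α - β) * ∑ d ∈ Finset.range m, (h l (m + 1) d - h l m d)
          * ∑ c ∈ Finset.range d, α ^ c * β ^ (m - c)
        = ∑ d ∈ Finset.range m, h l (m + 1) d * (α ^ d * β ^ (m + 1 - d) - β ^ (m + 1))
          - β * N l m := by
      rw [hN', Finset.mul_sum, Finset.mul_sum, ← Finset.sum_sub_distrib]
      refine Finset.sum_congr rfl fun d hd => ?_
      have hd := Finset.mem_range.1 hd
      have := sub_mul_sum_pow α β hd.le
      rw [show m + 1 - d = (m - d) + 1 by omega]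
      linear_combination (h l (m + 1) d - h l m d) * this
    have e3 := sub_mul_sum_pow α β (le_refl m)
    have e4 := hN' l (m + 1)
    rw [Finset.sum_range_succ, hlast, Nat.add_sub_cancel_left] at e4
    rw [Nat.sub_self] at e3
    rw [e1, mul_add, e2, e4, hP]
    linear_combination v * (∑ c ∈ Finset.range m, h l m c + h l m m) * e3
  have hVα : (α - β) * gsum τ K (V α)
      = v * τ * β * (F α - F β) + (1 - τ * β) * gsum τ K N := by
    rw [gsum_shift_left hτ (V α) fun m => Finset.sum_eq_zero fun c hc => by
      rw [h_zero m c (Finset.mem_range.1 hc), zero_mul]]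
    have hNshift := gsum_shift_right hτ N fun l => by simp [hN']
    have := congrArg (gsum τ K) (funext fun l => funext fun m => hstep l m)
    simp only [gsum_add, gsum_sub, gsum_mul_left, mul_sub] at this
    rw [hF, hF]
    linear_combination τ * this - hNshift
  have hone : gsum τ K (fun l m => (if l = 0 then 1 else 0) * β ^ m) * (1 - τ * β) = 1 := by
    have : gsum τ K (fun l m => (if l = 0 then 1 else 0) * β ^ m)
        = ∑ m ∈ Finset.range K, (τ * β) ^ m := by
      rw [gsum, Finset.sum_eq_single 0]
      · simp [mul_pow]
      · intro l _ hl; simp [hl]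
      · intro h; exact absurd (Finset.mem_range.2 hK) h
    rw [this, mul_comm, mul_neg_geom_sum, mul_pow, hτ]
    simp
  have hNsum : gsum τ K N = gsum τ K (V α) - gsum τ K (V β) := gsum_sub τ K _ _
  have hFβ : F β = gsum τ K (V β) + gsum τ K (fun l m => (if l = 0 then 1 else 0) * β ^ m) := by
    rw [hF, ← gsum_add]
    simp only [add_mul, hVβ]
  rw [hNsum, hαβ] at hVα
  rw [hFβ] at hVα ⊢
  linear_combination hone + hVα

lemma isUnit_one_sub_of_pow_eq_zero {τ : R} {K : ℕ} (hτ : τ ^ K = 0) (x : R) :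
    IsUnit (1 - τ * x) :=
  IsNilpotent.isUnit_one_sub ⟨K, by rw [mul_pow, hτ, zero_mul]⟩

/-- The functional equation has at most one solution when `τ` is nilpotent. -/
theorem functional_equation_unique {τ v : R} {K : ℕ} (hτ : τ ^ K = 0) {F G : R → R}
    (hF : ∀ β, (1 - τ * β) * F β = 1 + v * τ * β * (F (1 + β * (1 - τ)) - F β))
    (hG : ∀ β, (1 - τ * β) * G β = 1 + v * τ * β * (G (1 + β * (1 - τ)) - G β)) (β : R) :
    F β = G β := by
  have key : ∀ k, ∀ β, τ ^ k ∣ F β - G β := by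
    intro k
    induction k with
    | zero => simp
    | succ k ih =>
      intro β
      rw [← (isUnit_one_sub_of_pow_eq_zero hτ β).dvd_mul_left]
      obtain ⟨a, ha⟩ := ih β
      obtain ⟨b, hb⟩ := ih (1 + β * (1 - τ))
      refine ⟨v * β * (b - a), ?_⟩
      rw [pow_succ]
      linear_combination hF β - hG β + v * τ * β * (hb - ha)
  have := key K β
  rw [hτ, zero_dvd_iff] at this
  exact sub_eq_zero.1 this

/-- If a two-parameter family obeys the recursion of words with holes, then at hole weight `0`
it obeys the functional equation for ascent sequences. -/
theorem functional_equation_of_hole_recursion {τ v : R} {K : ℕ} (hτ : τ ^ K = 0) {G : R → R → R}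
    (hG : ∀ u x y, (1 - τ) * x = 1 + y → (1 + τ * y) * (1 - τ * u) * G u y
      = (1 - τ * u) * (1 + v * τ * y * G u y) + τ * (y + u) * (1 + v * τ * x * G u x))
    (β : R) :
    (1 - τ * β) * G β 0 = 1 + v * τ * β * (G (1 + β * (1 - τ)) 0 - G β 0) := by
  set D : R → R → R := fun u y => (1 - τ * u) * G u y - 1
    - v * τ * ((y + u) * G (1 + u * (1 - τ)) y - u * G u y) with hD
  have hq : IsUnit (1 - τ) := by simpa using isUnit_one_sub_of_pow_eq_zero hτ 1
  have hDrec : ∀ u x y, (1 - τ) * x = 1 + y → (1 + τ * y) * (1 - τ * u) * D u y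
      = (1 - τ * u) * (v * τ * y * D u y) + τ * (y + u) * (v * τ * x * D u x) := by
    intro u x y hxy
    have h1 := hG u x y hxy
    have h2 := hG (1 + u * (1 - τ)) x y hxy
    have h3 : (1 + τ * y) * (1 - τ * u) * G (1 + u * (1 - τ)) y
        = (1 - τ * u) * (1 + v * τ * y * G (1 + u * (1 - τ)) y)
          + τ * (x + u) * (1 + v * τ * x * G (1 + u * (1 - τ)) x) := by
      refine hq.mul_left_cancel ?_
      linear_combination h2
        - τ * (1 + v * τ * x * G (1 + u * (1 - τ)) x) * hxy
    simp only [hD]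
    linear_combination (1 - τ * u + v * τ * u) * h1 - v * τ * (y + u) * h3
  have key : ∀ k, ∀ u y, τ ^ k ∣ D u y := by
    intro k
    induction k with
    | zero => simp
    | succ k ih =>
      intro u y
      obtain ⟨q, hq⟩ := hq.exists_right_inv
      have hu : IsUnit ((1 + τ * y) * (1 - τ * u)) :=
        (by simpa using isUnit_one_sub_of_pow_eq_zero hτ (-y) : IsUnit (1 + τ * y)).mul
          (isUnit_one_sub_of_pow_eq_zero hτ u)
      rw [← hu.dvd_mul_left, hDrec u (q * (1 + y)) y (by rw [← mul_assoc, hq, one_mul])]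
      obtain ⟨a, ha⟩ := ih u y
      obtain ⟨b, hb⟩ := ih u (q * (1 + y))
      rw [ha, hb, pow_succ]
      exact ⟨(1 - τ * u) * (v * y * a) + τ * (y + u) * (v * (q * (1 + y)) * b), by ring⟩
  have := key K β 0
  rw [hτ, zero_dvd_iff] at this
  simp only [hD] at this
  linear_combination this

end Algebra

section InitialRuns

/-- `runValid M w` says that `0, 1, …, M - 1` followed by `w` is an ascent sequence. -/
def runValid : ℕ → List ℕ → Prop
  | _, [] => True
  | M, c :: w =>
    c ≤ M ∧ runValid (if c = M ∨ (c < w.headD M ∧ w.headD M < M) then M + 1 else M) w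

/-- `ascFrom A l w` says that `w` may follow a word with last entry `l` whose next entry is
bounded by `A`. -/
def ascFrom : ℕ → ℕ → List ℕ → Prop
  | _, _, [] => True
  | A, l, c :: w => c ≤ A ∧ ascFrom (if l < c then A + 1 else A) c w

lemma runValid_succ_iff_ascFrom (M : ℕ) (w : List ℕ) :
    runValid (M + 1) w ↔ ascFrom (M + 1) M w := by
  induction w generalizing M with
  | nil => simp [runValid, ascFrom]
  | cons c w ih =>
    simp only [runValid, ascFrom]
    rcases lt_trichotomy c (M + 1) with hc | rfl | hc
    · have h1 : ¬ M < c := by omega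
      simp only [h1, if_false]
      rcases w with _ | ⟨d, w⟩
      · simp [runValid, ascFrom]
      · simp only [List.headD_cons, hc.ne, false_or]
        by_cases hd : c < d ∧ d < M + 1
        · rw [if_pos hd, ih]
          have h2 : ¬ M + 1 < d := by omega
          simp only [ascFrom, h2, if_false, hd.1, if_true]
          grind
        · rw [if_neg hd, ih]
          simp only [ascFrom]
          by_cases hdM : d ≤ M + 1
          · have : M < d ↔ c < d := by omega
            simp [this]
          · simp [hdM]
    · simp [ih]
    · simp [Nat.not_le.2 hc]

lemma ascN_append_pair (q : List ℕ) (l c : ℕ) :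
    ascN (q ++ [l] ++ [c]) = ascN (q ++ [l]) + if l < c then 1 else 0 := by
  have e : (q ++ [l] ++ [c]).length - 1 = q.length + 1 := by simp
  have e' : (q ++ [l]).length - 1 = q.length := by simp
  rw [ascN, ascN, e, e', Finset.card_filter, Finset.card_filter, Finset.sum_range_succ]
  congr 1
  · refine Finset.sum_congr rfl fun i hi => ?_
    have hi := Finset.mem_range.1 hi
    rw [List.getD_append (q ++ [l]) [c] _ i (by simp; omega),
      List.getD_append (q ++ [l]) [c] _ (i + 1) (by simp; omega)]
  · simp [List.getD_eq_getElem?_getD]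

lemma ascN_take_add_one_le (s : List ℕ) (i : ℕ) (hi : 1 ≤ i) : ascN (s.take i) + 1 ≤ i := by
  have h : ascN (s.take i) ≤ (s.take i).length - 1 :=
    (Finset.card_filter_le _ _).trans (by simp)
  have : (s.take i).length ≤ i := by simp
  omega

lemma forall_getD_le_ascN_iff (q : List ℕ) (l : ℕ) (w : List ℕ) :
    (∀ i < w.length, w.getD i 0 ≤ ascN (q ++ [l] ++ w.take i) + 1)
      ↔ ascFrom (ascN (q ++ [l]) + 1) l w := by
  induction w generalizing q l with
  | nil => simp [ascFrom]
  | cons c w ih =>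
    have := ih (q ++ [l]) c
    rw [ascN_append_pair] at this
    have e : ascN (q ++ [l]) + (if l < c then 1 else 0) + 1
        = if l < c then ascN (q ++ [l]) + 1 + 1 else ascN (q ++ [l]) + 1 := by
      split_ifs <;> omega
    rw [e] at this
    rw [ascFrom, ← this]
    constructor
    · intro h
      refine ⟨by simpa using h 0 (by simp), fun i hi => ?_⟩
      simpa using h (i + 1) (by simpa using hi)
    · rintro ⟨h0, h⟩ i hi
      rcases i with _ | i
      · simpa using h0
      · simpa using h i (by simpa using hi)

lemma isAscSeq_iff_runValid (s : List ℕ) : IsAscSeq s ↔ runValid 0 s := by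
  rcases s with _ | ⟨c, w⟩
  · simp [IsAscSeq, IsInvSeq, runValid]
  · have h1 : ascN [c] = 0 := by simp [ascN]
    have key := forall_getD_le_ascN_iff [] c w
    rw [List.nil_append, h1] at key
    rw [runValid]
    constructor
    · rintro ⟨hi, ha⟩
      have hc : c = 0 := by simpa using hi 0 (by simp)
      subst hc
      refine ⟨le_rfl, ?_⟩
      rw [if_pos (Or.inl rfl), runValid_succ_iff_ascFrom]
      refine key.1 fun i hi => ?_
      simpa using ha (i + 1) (by simpa using hi)
    · rintro ⟨hc, h⟩
      have hc : c = 0 := by omega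
      subst hc
      rw [if_pos (Or.inl rfl), runValid_succ_iff_ascFrom] at h
      have ha : ∀ i < (0 :: w).length, (0 :: w).getD i 0 ≤ ascN ((0 :: w).take i) + 1 := by
        rintro (_ | i) hi
        · simp
        · simpa using key.2 h i (by simpa using hi)
      refine ⟨?_, ha⟩
      rintro (_ | i) hi
      · simp
      · exact (ha _ hi).trans (ascN_take_add_one_le _ _ (by omega))

/-- The number of repeated entries that `w` contributes after `0, 1, …, m - 1`. -/
def runRep (m : ℕ) (w : List ℕ) : ℕ := w.length - (w.toFinset.filter (m ≤ ·)).card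

lemma card_filter_toFinset_le (m : ℕ) (w : List ℕ) :
    (w.toFinset.filter (m ≤ ·)).card ≤ w.length :=
  (Finset.card_filter_le _ _).trans w.toFinset_card_le

lemma runRep_cons_self (m : ℕ) (w : List ℕ) : runRep m (m :: w) = runRep (m + 1) w := by
  have : (m :: w).toFinset.filter (m ≤ ·) = insert m (w.toFinset.filter (m + 1 ≤ ·)) := by
    ext x
    simp only [List.toFinset_cons, Finset.mem_filter, Finset.mem_insert, List.mem_toFinset]
    grind
  rw [runRep, runRep, this, Finset.card_insert_of_notMem (by simp), List.length_cons,
    Nat.add_sub_add_right]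

lemma runRep_cons_of_lt {c m : ℕ} (hc : c < m) (w : List ℕ) :
    runRep m (c :: w) = runRep m w + 1 := by
  have : (c :: w).toFinset.filter (m ≤ ·) = w.toFinset.filter (m ≤ ·) := by
    ext x
    simp only [List.toFinset_cons, Finset.mem_filter, Finset.mem_insert, List.mem_toFinset]
    grind
  rw [runRep, runRep, this, List.length_cons, Nat.sub_add_comm (card_filter_toFinset_le m w)]

lemma runRep_succ (m : ℕ) (w : List ℕ) :
    runRep (m + 1) w = runRep m w + if m ∈ w then 1 else 0 := by
  have hle := card_filter_toFinset_le m w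
  split_ifs with h
  · have : w.toFinset.filter (m ≤ ·) = insert m (w.toFinset.filter (m + 1 ≤ ·)) := by
      ext x
      simp only [Finset.mem_filter, Finset.mem_insert, List.mem_toFinset]
      grind
    rw [this, Finset.card_insert_of_notMem (by simp)] at hle
    rw [runRep, runRep, this, Finset.card_insert_of_notMem (by simp)]
    omega
  · have : w.toFinset.filter (m ≤ ·) = w.toFinset.filter (m + 1 ≤ ·) := by
      ext x
      simp only [Finset.mem_filter, List.mem_toFinset]
      grind
    rw [runRep, runRep, this, add_zero]

/-- The increasing map of `ℕ` that omits the value `k`. -/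
def skip (k x : ℕ) : ℕ := if x < k then x else x + 1

lemma skip_injective (k : ℕ) : Function.Injective (skip k) := by
  intro x y h
  unfold skip at h
  split_ifs at h <;> omega

lemma runValid_map_skip {k M : ℕ} (hk : k ≤ M) (w : List ℕ) :
    runValid (M + 1) (w.map (skip k)) ↔ runValid M w := by
  induction w generalizing M with
  | nil => simp [runValid]
  | cons c w ih =>
    have hM : skip k M = M + 1 := by simp [skip, hk]
    have hh : (w.map (skip k)).headD (M + 1) = skip k (w.headD M) := by
      cases w <;> simp [hM]
    simp only [List.map_cons, runValid, hh]
    generalize w.headD M = d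
    have e1 : skip k c ≤ M + 1 ↔ c ≤ M := by unfold skip; split_ifs <;> omega
    have e2 : (skip k c = M + 1 ∨ skip k c < skip k d ∧ skip k d < M + 1)
        ↔ (c = M ∨ c < d ∧ d < M) := by
      unfold skip; split_ifs <;> omega
    rw [e1]
    simp only [e2]
    split_ifs with h
    · rw [ih (hk.trans (Nat.le_succ M))]
    · rw [ih hk]

lemma runRep_map_skip (m : ℕ) (w : List ℕ) :
    runRep (m + 1) (w.map (skip m)) = runRep m w := by
  have : (w.map (skip m)).toFinset.filter (m + 1 ≤ ·)
      = (w.toFinset.filter (m ≤ ·)).image (skip m) := by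
    ext x
    simp only [Finset.mem_filter, Finset.mem_image, List.mem_toFinset, List.mem_map, skip]
    grind
  rw [runRep, runRep, this, Finset.card_image_of_injective _ (skip_injective m), List.length_map]

lemma exists_map_skip_eq {m : ℕ} {w : List ℕ} (hw : m ∉ w) : ∃ w' : List ℕ, w'.map (skip m) = w := by
  refine ⟨w.map fun x => if x < m then x else x - 1, ?_⟩
  rw [List.map_map]
  refine (List.map_congr_left fun x hx => ?_).trans (List.map_id w)
  have : x ≠ m := fun h => hw (h ▸ hx)
  simp only [Function.comp, skip, id]
  split_ifs <;> omega

lemma notMem_map_skip (m : ℕ) (w : List ℕ) : m ∉ w.map (skip m) := by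
  simp only [List.mem_map, not_exists, not_and, skip]
  intro x _
  split_ifs <;> omega

lemma runValid.getD_le {M : ℕ} {w : List ℕ} (hw : runValid M w) :
    (∀ i < w.length, w.getD i 0 ≤ M + i)
      ∧ (w.headD M < M → ∀ i < w.length, w.getD i 0 < M + i) := by
  induction w generalizing M with
  | nil => simp
  | cons c w ih =>
    obtain ⟨hc, hw⟩ := hw
    constructor
    · rintro (_ | i) hi
      · simpa using hc
      · have := (ih hw).1 i (by simpa using hi)
        simp only [List.getD_cons_succ]
        split_ifs at this <;> omega
    · simp only [List.headD_cons]
      intro hcM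
      rintro (_ | i) hi
      · simpa using hcM
      · have hi : i < w.length := by simpa using hi
        simp only [List.getD_cons_succ]
        split_ifs at hw with h
        · refine ((ih hw).2 ?_ i hi).trans_le (by omega)
          rcases w with _ | ⟨d, w⟩
          · simp at hi
          · simp only [List.headD_cons] at h ⊢
            omega
        · have := (ih hw).1 i hi
          omega

lemma maxN_range_append {m : ℕ} {w : List ℕ} (hw : ∀ i < w.length, w.getD i 0 < m + i) :
    maxN (List.range m ++ w) = m := by
  have : (Finset.range (List.range m ++ w).length).filter
      (fun i => (List.range m ++ w).getD i 0 = i) = Finset.range m := by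
    ext i
    simp only [Finset.mem_filter, Finset.mem_range, List.length_append, List.length_range]
    rcases lt_or_ge i m with h | h
    · rw [List.getD_append _ _ _ _ (by simpa using h)]
      simp [h]
      omega
    · rw [List.getD_append_right _ _ _ _ (by simpa using h), List.length_range]
      constructor
      · rintro ⟨h1, h2⟩
        have := hw (i - m) (by omega)
        omega
      · omega
  rw [maxN, this, Finset.card_range]

lemma repN_eq (s : List ℕ) : repN s = s.length - s.toFinset.card := by
  rw [repN, List.card_toFinset]

lemma repN_range_append (m : ℕ) (w : List ℕ) : repN (List.range m ++ w) = runRep m w := by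
  have : (List.range m ++ w).toFinset = Finset.range m ∪ w.toFinset.filter (m ≤ ·) := by
    ext x
    simp only [List.mem_toFinset, List.mem_append, List.mem_range, Finset.mem_union,
      Finset.mem_range, Finset.mem_filter]
    grind
  have hd : Disjoint (Finset.range m) (w.toFinset.filter (m ≤ ·)) := by
    rw [Finset.disjoint_left]
    intro x
    simp only [Finset.mem_filter, Finset.mem_range]
    omega
  rw [repN_eq, this, Finset.card_union_of_disjoint hd, runRep, Finset.card_range,
    List.length_append, List.length_range, Nat.add_sub_add_left]

end InitialRuns

section RunSums

open Classical in
/-- The words of length `l` that extend `0, 1, …, m - 1` to an ascent sequence. -/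
noncomputable def runTails : ℕ → ℕ → Finset (List ℕ)
  | 0, _ => {[]}
  | l + 1, m => ((Finset.range (m + 1)).biUnion fun c =>
      (runTails l m ∪ runTails l (m + 1)).image (c :: ·)).filter (runValid m)

lemma mem_runTails {l m : ℕ} {w : List ℕ} :
    w ∈ runTails l m ↔ w.length = l ∧ runValid m w := by
  induction l generalizing m w with
  | zero =>
    simp only [runTails, Finset.mem_singleton, List.length_eq_zero_iff]
    constructor
    · rintro rfl
      exact ⟨rfl, trivial⟩
    · exact And.left
  | succ l ih =>
    simp only [runTails, Finset.mem_filter, Finset.mem_biUnion, Finset.mem_range,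
      Finset.mem_image, Finset.mem_union, ih]
    constructor
    · rintro ⟨⟨c, hc, w, hw, rfl⟩, h⟩
      refine ⟨?_, h⟩
      rcases hw with hw | hw <;> simp [hw.1]
    · rintro ⟨hl, h⟩
      refine ⟨?_, h⟩
      rcases w with _ | ⟨c, w⟩
      · simp at hl
      · refine ⟨c, Nat.lt_succ_of_le h.1, w, ?_, rfl⟩
        have h2 := h.2
        have hl : w.length = l := by simpa using hl
        split_ifs at h2
        · exact Or.inr ⟨hl, h2⟩
        · exact Or.inl ⟨hl, h2⟩

lemma headD_le_of_mem_runTails {l m : ℕ} {w : List ℕ} (hw : w ∈ runTails l m) :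
    w.headD m ≤ m := by
  have := (mem_runTails.1 hw).2
  cases w with
  | nil => simp
  | cons c w => simpa using this.1

variable {R : Type*} [CommRing R]

/-- The repeat generating function of the words in `runTails l m` that start with `c`. -/
noncomputable def runHead (v : R) (l m c : ℕ) : R :=
  ∑ w ∈ runTails l m, if w.headD m = c then v ^ runRep m w else 0

/-- The repeat generating function of the words in `runTails l m`. -/
noncomputable def runTotal (v : R) (l m : ℕ) : R := ∑ w ∈ runTails l m, v ^ runRep m w

lemma runHead_zero_of_lt (v : R) {m c : ℕ} (hc : c < m) : runHead v 0 m c = 0 := by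
  simp [runHead, runTails, hc.ne']

lemma runHead_zero_self (v : R) (m : ℕ) : runHead v 0 m m = 1 := by
  simp [runHead, runTails, runRep]

lemma runTails_succ_filter_self (l m : ℕ) :
    (runTails (l + 1) m).filter (fun w => w.headD m = m)
      = (runTails l (m + 1)).image (m :: ·) := by
  ext w
  simp only [Finset.mem_filter, Finset.mem_image, mem_runTails]
  constructor
  · rintro ⟨⟨hl, h⟩, hd⟩
    rcases w with _ | ⟨c, w⟩
    · simp at hl
    · have hd : c = m := by simpa using hd
      subst hd
      have := h.2
      rw [if_pos (Or.inl rfl)] at this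
      exact ⟨w, ⟨by simpa using hl, this⟩, rfl⟩
  · rintro ⟨w, ⟨hl, h⟩, rfl⟩
    refine ⟨⟨by simp [hl], le_rfl, ?_⟩, by simp⟩
    rwa [if_pos (Or.inl rfl)]

lemma runTails_succ_filter_of_lt (l : ℕ) {c m : ℕ} (hc : c < m) :
    (runTails (l + 1) m).filter (fun w => w.headD m = c)
      = ((runTails l m).filter (fun w => ¬ (c < w.headD m ∧ w.headD m < m))
        ∪ (runTails l (m + 1)).filter (fun w => c < w.headD m ∧ w.headD m < m)).image
          (c :: ·) := by
  ext w
  simp only [Finset.mem_filter, Finset.mem_image, Finset.mem_union, mem_runTails]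
  constructor
  · rintro ⟨⟨hl, h⟩, hd⟩
    rcases w with _ | ⟨c', w⟩
    · simp at hl
    · have hd : c' = c := by simpa using hd
      subst hd
      have h2 := h.2
      simp only [hc.ne, false_or] at h2
      have hl : w.length = l := by simpa using hl
      refine ⟨w, ?_, rfl⟩
      split_ifs at h2 with h3
      · exact Or.inr ⟨⟨hl, h2⟩, h3⟩
      · exact Or.inl ⟨⟨hl, h2⟩, h3⟩
  · rintro ⟨w, hw, rfl⟩
    have hl : w.length = l := by rcases hw with hw | hw <;> exact hw.1.1
    refine ⟨⟨by simp [hl], hc.le, ?_⟩, by simp⟩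
    simp only [hc.ne, false_or]
    rcases hw with hw | hw
    · rw [if_neg hw.2]
      exact hw.1.2
    · rw [if_pos hw.2]
      exact hw.1.2

lemma cons_injective (c : ℕ) : Function.Injective (c :: · : List ℕ → List ℕ) :=
  fun _ _ h => (List.cons.inj h).2

lemma runHead_succ_self (v : R) (l m : ℕ) : runHead v (l + 1) m m = runTotal v l (m + 1) := by
  rw [runHead, ← Finset.sum_filter, runTails_succ_filter_self,
    Finset.sum_image (cons_injective m).injOn]
  simp only [runRep_cons_self, runTotal]

lemma runTotal_eq (v : R) (l m : ℕ) :
    runTotal v l m = ∑ c ∈ Finset.range m, runHead v l m c + runHead v l m m := by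
  rw [← Finset.sum_range_succ]
  simp only [runHead]
  rw [Finset.sum_comm]
  refine Finset.sum_congr rfl fun w hw => ?_
  rw [Finset.sum_ite_eq, if_pos]
  exact Finset.mem_range.2 (Nat.lt_succ_of_le (headD_le_of_mem_runTails hw))

lemma sum_Ioo_runHead (v : R) (l m' m c : ℕ) (hm : m ≤ m') :
    ∑ d ∈ Finset.Ioo c m, runHead v l m' d
      = ∑ w ∈ (runTails l m').filter (fun w => c < w.headD m ∧ w.headD m < m),
          v ^ runRep m' w := by
  simp only [runHead]
  rw [Finset.sum_comm, Finset.sum_filter]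
  refine Finset.sum_congr rfl fun w _ => ?_
  rw [Finset.sum_ite_eq]
  refine if_congr ?_ rfl rfl
  rw [Finset.mem_Ioo]
  cases w with
  | nil => simp [hm]
  | cons a w => simp

lemma runTails_filter_notMem (l m c : ℕ) :
    ((runTails l (m + 1)).filter (fun w => c < w.headD m ∧ w.headD m < m)).filter (m ∉ ·)
      = ((runTails l m).filter (fun w => c < w.headD m ∧ w.headD m < m)).image
          (List.map (skip m)) := by
  have hh : ∀ w : List ℕ, (c < (w.map (skip m)).headD m ∧ (w.map (skip m)).headD m < m)
      ↔ (c < w.headD m ∧ w.headD m < m) := by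
    intro w
    cases w with
    | nil => simp
    | cons a w =>
      simp only [List.map_cons, List.headD_cons, skip]
      split_ifs <;> omega
  ext w
  simp only [Finset.mem_filter, Finset.mem_image, mem_runTails]
  constructor
  · rintro ⟨⟨⟨hl, h⟩, hd⟩, hm⟩
    obtain ⟨w, rfl⟩ := exists_map_skip_eq hm
    rw [runValid_map_skip le_rfl] at h
    exact ⟨w, ⟨⟨by simpa using hl, h⟩, (hh w).1 hd⟩, rfl⟩
  · rintro ⟨w, ⟨⟨hl, h⟩, hd⟩, rfl⟩
    exact ⟨⟨⟨by simpa using hl, (runValid_map_skip le_rfl w).2 h⟩, (hh w).2 hd⟩,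
      notMem_map_skip m w⟩

lemma runHead_succ_of_lt (v : R) (l : ℕ) {c m : ℕ} (hc : c < m) :
    runHead v (l + 1) m c = v * runTotal v l m
      + ∑ d ∈ Finset.Ioo c m, (runHead v l (m + 1) d - runHead v l m d) := by
  have hdisj : Disjoint ((runTails l m).filter (fun w => ¬ (c < w.headD m ∧ w.headD m < m)))
      ((runTails l (m + 1)).filter (fun w => c < w.headD m ∧ w.headD m < m)) := by
    rw [Finset.disjoint_left]
    intro w h1 h2
    exact (Finset.mem_filter.1 h1).2 (Finset.mem_filter.1 h2).2
  have h1 : ∑ w ∈ (runTails l m).filter (fun w => ¬ (c < w.headD m ∧ w.headD m < m)),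
      v ^ runRep m (c :: w) = v * (runTotal v l m - ∑ d ∈ Finset.Ioo c m, runHead v l m d) := by
    rw [sum_Ioo_runHead v l m m c le_rfl, runTotal,
      ← Finset.sum_filter_add_sum_filter_not (runTails l m)
        (fun w => c < w.headD m ∧ w.headD m < m), add_sub_cancel_left, Finset.mul_sum]
    refine Finset.sum_congr rfl fun w _ => ?_
    rw [runRep_cons_of_lt hc, pow_succ']
  have h2 : ∑ w ∈ (runTails l (m + 1)).filter (fun w => c < w.headD m ∧ w.headD m < m),
      v ^ runRep m (c :: w) = ∑ d ∈ Finset.Ioo c m, runHead v l (m + 1) d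
        + (v - 1) * ∑ d ∈ Finset.Ioo c m, runHead v l m d := by
    rw [sum_Ioo_runHead v l (m + 1) m c (Nat.le_succ m), sum_Ioo_runHead v l m m c le_rfl]
    have h3 : ∑ w ∈ (runTails l m).filter (fun w => c < w.headD m ∧ w.headD m < m),
        v ^ runRep m w
        = ∑ w ∈ (runTails l (m + 1)).filter (fun w => c < w.headD m ∧ w.headD m < m),
          if m ∉ w then v ^ runRep (m + 1) w else 0 := by
      rw [← Finset.sum_filter, runTails_filter_notMem,
        Finset.sum_image (List.map_injective_iff.2 (skip_injective m)).injOn]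
      simp only [runRep_map_skip]
    rw [h3, Finset.mul_sum, ← Finset.sum_add_distrib]
    refine Finset.sum_congr rfl fun w _ => ?_
    rw [runRep_cons_of_lt hc, runRep_succ]
    by_cases hm : m ∈ w
    · simp [hm]
    · simp only [hm, not_false_eq_true, if_true, if_false, add_zero, pow_succ]
      ring
  rw [runHead, ← Finset.sum_filter, runTails_succ_filter_of_lt l hc,
    Finset.sum_image (cons_injective c).injOn, Finset.sum_union hdisj, h1, h2,
    Finset.sum_sub_distrib]
  ring

/-- The joint weight of the statistics `rep` and `max`. -/
def repMaxWeight (u v : R) (s : List ℕ) : R := v ^ repN s * u ^ maxN s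

lemma repMaxWeight_range_append (u v : R) {l m : ℕ} {w : List ℕ} (hw : w ∈ runTails l m)
    (hd : w.headD m < m ∨ w = []) :
    repMaxWeight u v (List.range m ++ w) = v ^ runRep m w * u ^ m := by
  rw [repMaxWeight, repN_range_append, maxN_range_append]
  rcases hd with hd | rfl
  · exact (mem_runTails.1 hw).2.getD_le.2 hd
  · simp

lemma sum_repMaxWeight_range_append (u v : R) (l m : ℕ) :
    ∑ w ∈ runTails l m, repMaxWeight u v (List.range m ++ w)
      = ∑ p ∈ Finset.HasAntidiagonal.antidiagonal l,
        (∑ c ∈ Finset.range (m + p.2), runHead v p.1 (m + p.2) c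
          + if p.1 = 0 then 1 else 0) * u ^ (m + p.2) := by
  induction l generalizing m with
  | zero =>
    rw [Finset.Nat.antidiagonal_zero, Finset.sum_singleton,
      Finset.sum_eq_zero fun c hc => runHead_zero_of_lt v (Finset.mem_range.1 hc), runTails,
      Finset.sum_singleton, repMaxWeight_range_append u v (l := 0) (by simp [runTails])
        (Or.inr rfl)]
    simp [runRep]
  | succ l ih =>
    have ih := ih (m + 1)
    have h1 : ∑ w ∈ (runTails (l + 1) m).filter (fun w => w.headD m = m),
        repMaxWeight u v (List.range m ++ w)
        = ∑ w ∈ runTails l (m + 1), repMaxWeight u v (List.range (m + 1) ++ w) := by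
      rw [runTails_succ_filter_self, Finset.sum_image (cons_injective m).injOn]
      simp [List.range_succ]
    have h2 : ∑ w ∈ (runTails (l + 1) m).filter (fun w => ¬ w.headD m = m),
        repMaxWeight u v (List.range m ++ w)
        = (∑ c ∈ Finset.range m, runHead v (l + 1) m c) * u ^ m := by
      simp only [runHead]
      rw [Finset.sum_comm, Finset.sum_filter, Finset.sum_mul]
      refine Finset.sum_congr rfl fun w hw => ?_
      rw [Finset.sum_ite_eq, ite_mul, zero_mul]
      have hle := headD_le_of_mem_runTails hw
      by_cases hd : w.headD m < m
      · rw [if_pos hd.ne, if_pos (Finset.mem_range.2 hd),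
          repMaxWeight_range_append u v hw (Or.inl hd)]
      · rw [if_neg (by omega), if_neg (by simpa using hd)]
    rw [← Finset.sum_filter_add_sum_filter_not _ (fun w => w.headD m = m), h1, h2, ih,
      Finset.Nat.sum_antidiagonal_succ']
    simp only [Nat.succ_ne_zero, if_false, add_zero]
    rw [add_comm]
    simp only [Nat.add_comm, Nat.add_left_comm]

/-- The truncated generating function of ascent sequences satisfies the functional equation. -/
theorem functional_equation_ascent {τ v : R} {K : ℕ} (hK : 0 < K) (hτ : τ ^ K = 0) (β : R) :
    (1 - τ * β) * ∑ n ∈ Finset.range K, τ ^ n * ∑ s ∈ runTails n 0, repMaxWeight β v s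
      = 1 + v * τ * β
        * (∑ n ∈ Finset.range K,
            τ ^ n * ∑ s ∈ runTails n 0, repMaxWeight (1 + β * (1 - τ)) v s
          - ∑ n ∈ Finset.range K, τ ^ n * ∑ s ∈ runTails n 0, repMaxWeight β v s) := by
  refine functional_equation_of_run_recursion hK hτ (runHead v) (runTotal v)
    (fun m c hc => runHead_zero_of_lt v hc) (runHead_zero_self v) (runHead_succ_self v)
    (runTotal_eq v) (fun l m c hc => runHead_succ_of_lt v l hc)
    (fun β => ∑ n ∈ Finset.range K, τ ^ n * ∑ s ∈ runTails n 0, repMaxWeight β v s)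
    (fun β => ?_) β
  rw [gsum_eq_sum_antidiagonal hτ]
  refine Finset.sum_congr rfl fun n _ => ?_
  have := sum_repMaxWeight_range_append β v n 0
  simp only [List.range_zero, List.nil_append, Nat.zero_add] at this
  rw [this]

end RunSums

section HoleWords

/-- The lifts of `l` under `List.map Nat.pred` in which no entry `2` precedes an entry `1`. -/
def lifts : List ℕ → Finset (List ℕ)
  | [] => {[]}
  | 0 :: l => (lifts l).image (0 :: ·) ∪ (lifts l).image (1 :: ·)
  | 1 :: l => {2 :: l.map fun x => if x = 0 then 0 else x + 1}
  | (k + 2) :: l => (lifts l).image ((k + 3) :: ·)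

lemma mem_lifts {l w : List ℕ} :
    w ∈ lifts l ↔ w.map Nat.pred = l ∧ w.Pairwise fun a b => a = 2 → b ≠ 1 := by
  induction l using lifts.induct generalizing w with
  | case1 =>
    simp only [lifts, Finset.mem_singleton, List.map_eq_nil_iff]
    constructor
    · rintro rfl
      simp
    · exact And.left
  | case2 l ih =>
    simp only [lifts, Finset.mem_union, Finset.mem_image, ih]
    constructor
    · rintro (⟨w, ⟨rfl, hw⟩, rfl⟩ | ⟨w, ⟨rfl, hw⟩, rfl⟩) <;> simpa using hw
    · rintro ⟨hm, hw⟩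
      rcases w with _ | ⟨a, w⟩
      · simp at hm
      · obtain ⟨ha, hmw⟩ := List.cons.inj hm
        have hww := (List.pairwise_cons.1 hw).2
        have : a = 0 ∨ a = 1 := by simp only [Nat.pred_eq_sub_one] at ha; omega
        rcases this with rfl | rfl
        · exact Or.inl ⟨w, ⟨hmw, hww⟩, rfl⟩
        · exact Or.inr ⟨w, ⟨hmw, hww⟩, rfl⟩
  | case3 l =>
    simp only [lifts, Finset.mem_singleton]
    constructor
    · rintro rfl
      refine ⟨?_, ?_⟩
      · rw [List.map_cons, List.map_map]
        congr 1
        refine (List.map_congr_left fun x _ => ?_).trans (List.map_id l)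
        simp only [Function.comp, id]
        split_ifs with h <;> simp [h]
      · refine List.pairwise_cons.2 ⟨?_, ?_⟩
        · intro b hb _
          obtain ⟨x, _, rfl⟩ := List.mem_map.1 hb
          split_ifs with h <;> omega
        · refine List.pairwise_of_forall_mem_list ?_
          intro a _ b hb _
          obtain ⟨x, _, rfl⟩ := List.mem_map.1 hb
          split_ifs with h <;> omega
    · rintro ⟨hm, hw⟩
      rcases w with _ | ⟨a, w⟩
      · simp at hm
      · obtain ⟨ha, rfl⟩ := List.cons.inj hm
        have ha : a = 2 := by simp only [Nat.pred_eq_sub_one] at ha; omega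
        have hw := (List.pairwise_cons.1 hw).1
        rw [ha, List.map_map]
        congr 1
        refine ((List.map_congr_left fun x hx => ?_).trans (List.map_id w)).symm
        have := hw x hx ha
        simp only [Function.comp, Nat.pred_eq_sub_one, id]
        split_ifs with h <;> omega
  | case4 k l ih =>
    simp only [lifts, Finset.mem_image, ih]
    constructor
    · rintro ⟨w, ⟨rfl, hw⟩, rfl⟩
      simpa using hw
    · rintro ⟨hm, hw⟩
      rcases w with _ | ⟨a, w⟩
      · simp at hm
      · obtain ⟨ha, hmw⟩ := List.cons.inj hm
        have hww := (List.pairwise_cons.1 hw).2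
        have : a = k + 3 := by simp only [Nat.pred_eq_sub_one] at ha; omega
        exact ⟨w, ⟨hmw, hww⟩, by rw [this]⟩

/-- Words of length `n` in which a positive entry `k` stands for the value `k - 1` of a
(2-1)-avoiding inversion sequence and an entry `0` stands for a hole. -/
def holeWords : ℕ → Finset (List ℕ)
  | 0 => {[]}
  | n + 1 => (holeWords n).biUnion fun l =>
      (lifts l).image (0 :: ·) ∪ (lifts l).image (1 :: ·)

lemma pairwise_iff_of_map_pred (w : List ℕ) :
    (w.Pairwise fun a b => b ≠ 0 → a ≠ b + 1)
      ↔ ((w.map Nat.pred).Pairwise fun a b => b ≠ 0 → a ≠ b + 1)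
        ∧ w.Pairwise fun a b => a = 2 → b ≠ 1 := by
  rw [List.pairwise_map, ← List.pairwise_and_iff]
  refine List.Pairwise.iff fun a b => ?_
  simp only [Nat.pred_eq_sub_one]
  omega

lemma mem_holeWords {n : ℕ} {l : List ℕ} :
    l ∈ holeWords n ↔ l.length = n ∧ (∀ i < l.length, l.getD i 0 ≤ i + 1)
      ∧ l.Pairwise fun a b => b ≠ 0 → a ≠ b + 1 := by
  induction n generalizing l with
  | zero =>
    simp only [holeWords, Finset.mem_singleton, List.length_eq_zero_iff]
    constructor
    · rintro rfl
      simp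
    · exact And.left
  | succ n ih =>
    have key : ∀ e w, e ≤ 1 → (w.map Nat.pred ∈ holeWords n ∧ w ∈ lifts (w.map Nat.pred)
        ↔ (e :: w).length = n + 1 ∧ (∀ i < (e :: w).length, (e :: w).getD i 0 ≤ i + 1)
          ∧ (e :: w).Pairwise fun a b => b ≠ 0 → a ≠ b + 1) := by
      intro e w he
      have h1 : (∀ i < (e :: w).length, (e :: w).getD i 0 ≤ i + 1)
          ↔ ∀ i < (w.map Nat.pred).length, (w.map Nat.pred).getD i 0 ≤ i + 1 := by
        have h0 : ∀ i, (w.map Nat.pred).getD i 0 = w.getD i 0 - 1 := fun i =>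
          List.getD_map (d := 0) (f := Nat.pred) ..
        simp only [h0, List.length_map]
        constructor
        · intro h i hi
          have := h (i + 1) (by simpa using hi)
          simp only [List.getD_cons_succ] at this
          omega
        · rintro h (_ | i) hi
          · simpa using he
          · have := h i (by simpa using hi)
            simp only [List.getD_cons_succ]
            omega
      have h2 : ((e :: w).Pairwise fun a b => b ≠ 0 → a ≠ b + 1)
          ↔ w.Pairwise fun a b => b ≠ 0 → a ≠ b + 1 := by
        rw [List.pairwise_cons]
        exact and_iff_right fun b _ hb => by omega
      rw [ih, mem_lifts, h1, h2, pairwise_iff_of_map_pred w]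
      simp only [List.length_map, List.length_cons, Nat.add_right_cancel_iff, true_and,
        and_assoc]
    simp only [holeWords, Finset.mem_biUnion, Finset.mem_union, Finset.mem_image]
    constructor
    · rintro ⟨l', hl', ⟨w, hw, rfl⟩ | ⟨w, hw, rfl⟩⟩ <;>
      · obtain rfl := (mem_lifts.1 hw).1
        exact (key _ w (by decide)).1 ⟨hl', hw⟩
    · intro h
      rcases l with _ | ⟨e, w⟩
      · simp at h
      · have he : e ≤ 1 := by simpa using h.2.1 0 (by simp)
        obtain ⟨h1, h2⟩ := (key e w he).2 h
        refine ⟨_, h1, ?_⟩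
        rcases Nat.le_one_iff_eq_zero_or_eq_one.1 he with rfl | rfl
        · exact Or.inl ⟨w, h2, rfl⟩
        · exact Or.inr ⟨w, h2, rfl⟩

lemma sum_union_cons_zero_one {R : Type*} [AddCommMonoid R] (S : Finset (List ℕ))
    (f : List ℕ → R) :
    ∑ w ∈ S.image (0 :: ·) ∪ S.image (1 :: ·), f w = ∑ w ∈ S, (f (0 :: w) + f (1 :: w)) := by
  have hd : Disjoint (S.image (0 :: ·)) (S.image (1 :: ·)) := by
    rw [Finset.disjoint_left]
    intro w h0 h1
    obtain ⟨w0, _, rfl⟩ := Finset.mem_image.1 h0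
    obtain ⟨w1, _, h⟩ := Finset.mem_image.1 h1
    simp at h
  rw [Finset.sum_union hd, Finset.sum_image (cons_injective 0).injOn,
    Finset.sum_image (cons_injective 1).injOn, Finset.sum_add_distrib]

lemma sum_holeWords_succ {R : Type*} [AddCommMonoid R] (n : ℕ) (f : List ℕ → R) :
    ∑ w ∈ holeWords (n + 1), f w
      = ∑ l ∈ holeWords n, ∑ w ∈ lifts l, (f (0 :: w) + f (1 :: w)) := by
  rw [holeWords, Finset.sum_biUnion]
  · exact Finset.sum_congr rfl fun l _ => sum_union_cons_zero_one _ f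
  · have : ∀ l, ∀ w ∈ (lifts l).image (0 :: ·) ∪ (lifts l).image (1 :: ·),
        w.tail.map Nat.pred = l := by
      intro l w hw
      simp only [Finset.mem_union, Finset.mem_image] at hw
      rcases hw with ⟨w, hw, rfl⟩ | ⟨w, hw, rfl⟩ <;> exact (mem_lifts.1 hw).1
    intro l _ l' _ hne
    refine Finset.disjoint_left.2 fun w hw hw' => hne ?_
    rw [← this l w hw, ← this l' w hw']

/-- The number of holes before the first entry `1`. -/
def holesBefore : List ℕ → ℕ
  | [] => 0
  | 0 :: l => holesBefore l + 1
  | 1 :: _ => 0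
  | (_ + 2) :: l => holesBefore l

/-- The number of holes after the first entry `1`. -/
def holesAfter : List ℕ → ℕ
  | [] => 0
  | 0 :: l => holesAfter l
  | 1 :: l => l.count 0
  | (_ + 2) :: l => holesAfter l

lemma holesBefore_add_holesAfter (l : List ℕ) :
    holesBefore l + holesAfter l = l.count 0 := by
  induction l using holesBefore.induct with
  | case1 => rfl
  | case2 l ih =>
    rw [holesBefore, holesAfter, List.count_cons_self, ← ih]
    omega
  | case3 l => simp [holesBefore, holesAfter]
  | case4 k l ih => simp [holesBefore, holesAfter, ih]

lemma holesAfter_eq_zero {l : List ℕ} (h : 1 ∉ l) : holesAfter l = 0 := by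
  induction l using holesAfter.induct with
  | case1 => rfl
  | case2 l ih => exact ih fun h1 => h (List.mem_cons_of_mem _ h1)
  | case3 l => simp at h
  | case4 k l ih => exact ih fun h1 => h (List.mem_cons_of_mem _ h1)

/-- The number of values that do not occur. -/
def missing (l : List ℕ) : ℕ := ((Finset.range l.length).filter fun k => k + 1 ∉ l).card

/-- The number of entries of maximal possible value. -/
def maximal (l : List ℕ) : ℕ :=
  ((Finset.range l.length).filter fun i => l.getD i 0 = i + 1).card

lemma missing_cons (e : ℕ) (he : e ≤ 1) (w : List ℕ) :
    missing (e :: w) = missing (w.map Nat.pred) + if 1 ∈ e :: w then 0 else 1 := by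
  rw [missing, missing, Finset.card_filter, Finset.card_filter, List.length_cons,
    Finset.sum_range_succ', List.length_map]
  congr 1
  · refine Finset.sum_congr rfl fun k _ => if_congr (not_congr ?_) rfl rfl
    simp only [List.mem_cons, List.mem_map, Nat.pred_eq_sub_one]
    constructor
    · rintro (h | h)
      · omega
      · exact ⟨_, h, rfl⟩
    · rintro ⟨x, hx, h⟩
      obtain rfl : x = k + 1 + 1 := by omega
      exact Or.inr hx
  · simp only [Nat.zero_add, ite_not]

lemma maximal_cons (e : ℕ) (w : List ℕ) :
    maximal (e :: w) = maximal (w.map Nat.pred) + if e = 1 then 1 else 0 := by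
  rw [maximal, maximal, Finset.card_filter, Finset.card_filter, List.length_cons,
    Finset.sum_range_succ', List.length_map]
  congr 1
  refine Finset.sum_congr rfl fun i _ => if_congr ?_ rfl rfl
  have h0 : (w.map Nat.pred).getD i 0 = w.getD i 0 - 1 :=
    List.getD_map (d := 0) (f := Nat.pred) ..
  rw [h0, List.getD_cons_succ]
  omega

variable {R : Type*} [CommRing R]

lemma sum_lifts_pow_count (y : R) (l : List ℕ) :
    ∑ w ∈ lifts l, y ^ w.count 0 = (1 + y) ^ holesBefore l * y ^ holesAfter l := by
  induction l using lifts.induct with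
  | case1 => simp [lifts, holesBefore, holesAfter]
  | case2 l ih =>
    rw [lifts, sum_union_cons_zero_one, holesBefore, holesAfter, pow_succ, mul_right_comm, ← ih,
      Finset.sum_mul]
    refine Finset.sum_congr rfl fun w _ => ?_
    rw [List.count_cons_self, List.count_cons_of_ne (by decide)]
    ring
  | case3 l =>
    have : (l.map fun x => if x = 0 then 0 else x + 1).count 0 = l.count 0 := by
      rw [List.count_eq_countP, List.countP_map, List.count_eq_countP]
      refine List.countP_congr fun x _ => ?_
      simp only [Function.comp]
      split_ifs with h <;> simp [h]
    simp [lifts, holesBefore, holesAfter, this]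
  | case4 k l ih =>
    rw [lifts, Finset.sum_image (cons_injective _).injOn, holesBefore, holesAfter, ← ih]
    refine Finset.sum_congr rfl fun w _ => ?_
    rw [List.count_cons_of_ne (Nat.succ_ne_zero _)]

lemma sum_lifts_pow_holes (v x y : R) (l : List ℕ) :
    ∑ w ∈ lifts l, (if 1 ∈ w then 1 else v) * (x ^ holesBefore w * y ^ holesAfter w)
      = v * x ^ (holesBefore l + holesAfter l)
        + (∑ i ∈ Finset.range (holesBefore l), x ^ i * (1 + y) ^ (holesBefore l - 1 - i))
          * y ^ holesAfter l := by
  induction l using lifts.induct with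
  | case1 => simp [lifts, holesBefore, holesAfter]
  | case2 l ih =>
    have h1 : ∑ w ∈ lifts l,
        (if 1 ∈ 0 :: w then 1 else v) * (x ^ holesBefore (0 :: w) * y ^ holesAfter (0 :: w))
        = x * ∑ w ∈ lifts l,
          (if 1 ∈ w then 1 else v) * (x ^ holesBefore w * y ^ holesAfter w) := by
      rw [Finset.mul_sum]
      refine Finset.sum_congr rfl fun w _ => ?_
      simp only [List.mem_cons, one_ne_zero, false_or, holesBefore, holesAfter]
      ring
    have h2 : ∑ w ∈ lifts l,
        (if 1 ∈ 1 :: w then 1 else v) * (x ^ holesBefore (1 :: w) * y ^ holesAfter (1 :: w))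
        = (1 + y) ^ holesBefore l * y ^ holesAfter l := by
      rw [← sum_lifts_pow_count]
      refine Finset.sum_congr rfl fun w _ => ?_
      simp [holesBefore, holesAfter]
    rw [lifts, sum_union_cons_zero_one, Finset.sum_add_distrib, h1, h2, ih, holesBefore,
      holesAfter, Finset.sum_range_succ']
    have h3 : ∑ i ∈ Finset.range (holesBefore l),
        x ^ (i + 1) * (1 + y) ^ (holesBefore l + 1 - 1 - (i + 1))
        = x * ∑ i ∈ Finset.range (holesBefore l), x ^ i * (1 + y) ^ (holesBefore l - 1 - i) := by
      rw [Finset.mul_sum]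
      refine Finset.sum_congr rfl fun i _ => ?_
      rw [show holesBefore l + 1 - 1 - (i + 1) = holesBefore l - 1 - i by omega]
      ring
    rw [h3]
    simp only [Nat.add_sub_cancel, Nat.sub_zero]
    ring
  | case3 l =>
    have h1 : 1 ∉ 2 :: l.map fun x => if x = 0 then 0 else x + 1 := by
      simp only [List.mem_cons, List.mem_map, not_or, not_exists, not_and]
      refine ⟨by decide, fun x _ => ?_⟩
      grind
    have h2 : (2 :: l.map fun x => if x = 0 then 0 else x + 1).count 0 = l.count 0 := by
      rw [List.count_cons_of_ne (by decide), List.count_eq_countP, List.countP_map,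
        List.count_eq_countP]
      refine List.countP_congr fun x _ => ?_
      simp only [Function.comp]
      split_ifs with h <;> simp [h]
    have h3 := holesBefore_add_holesAfter (2 :: l.map fun x => if x = 0 then 0 else x + 1)
    rw [holesAfter_eq_zero h1, add_zero, h2] at h3
    rw [lifts, Finset.sum_singleton, if_neg h1, h3, holesAfter_eq_zero h1]
    simp [holesBefore, holesAfter]
  | case4 k l ih =>
    rw [lifts, Finset.sum_image (cons_injective _).injOn, holesBefore, holesAfter, ← ih]
    refine Finset.sum_congr rfl fun w _ => ?_
    simp [holesBefore, holesAfter]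

/-- The generating function of words with holes of length `n`. -/
def holeSum (v u : R) (n : ℕ) (x y : R) : R :=
  ∑ l ∈ holeWords n,
    v ^ missing l * u ^ maximal l * (x ^ holesBefore l * y ^ holesAfter l)

/-- The divided difference of `holeSum v u n · y` at `x` and `1 + y`. -/
def holeQuotient (v u : R) (n : ℕ) (x y : R) : R :=
  ∑ l ∈ holeWords n, v ^ missing l * u ^ maximal l
    * ((∑ i ∈ Finset.range (holesBefore l), x ^ i * (1 + y) ^ (holesBefore l - 1 - i))
      * y ^ holesAfter l)

lemma sub_mul_holeQuotient (v u : R) (n : ℕ) (x y : R) :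
    (x - (1 + y)) * holeQuotient v u n x y = holeSum v u n x y - holeSum v u n (1 + y) y := by
  rw [holeQuotient, holeSum, holeSum, Finset.mul_sum, ← Finset.sum_sub_distrib]
  refine Finset.sum_congr rfl fun l _ => ?_
  have := (Commute.all x (1 + y)).geom_sum₂_mul (holesBefore l)
  linear_combination (v ^ missing l * u ^ maximal l * y ^ holesAfter l) * this

lemma holeSum_zero (v u x y : R) : holeSum v u 0 x y = 1 := by
  simp [holeSum, holeWords, missing, maximal, holesBefore, holesAfter]

lemma holeSum_succ (v u : R) (n : ℕ) (x y : R) :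
    holeSum v u (n + 1) x y
      = v * x * holeSum v u n x x + x * holeQuotient v u n x y
        + u * holeSum v u n (1 + y) y := by
  simp only [holeSum, holeQuotient]
  rw [sum_holeWords_succ, Finset.mul_sum, Finset.mul_sum, Finset.mul_sum,
    ← Finset.sum_add_distrib, ← Finset.sum_add_distrib]
  refine Finset.sum_congr rfl fun l _ => ?_
  have h : ∀ w ∈ lifts l,
      v ^ missing (0 :: w) * u ^ maximal (0 :: w)
          * (x ^ holesBefore (0 :: w) * y ^ holesAfter (0 :: w))
        + v ^ missing (1 :: w) * u ^ maximal (1 :: w)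
          * (x ^ holesBefore (1 :: w) * y ^ holesAfter (1 :: w))
      = v ^ missing l * u ^ maximal l
        * (x * ((if 1 ∈ w then 1 else v) * (x ^ holesBefore w * y ^ holesAfter w))
          + u * y ^ w.count 0) := by
    intro w hw
    rw [missing_cons 0 (by decide), missing_cons 1 le_rfl, maximal_cons, maximal_cons,
      (mem_lifts.1 hw).1]
    simp only [holesBefore, holesAfter, List.mem_cons, one_ne_zero, zero_ne_one, false_or,
      true_or, if_true, if_false, add_zero, pow_zero, one_mul, pow_succ]
    split_ifs <;> ring
  rw [Finset.sum_congr rfl h, ← Finset.mul_sum, Finset.sum_add_distrib, ← Finset.mul_sum,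
    ← Finset.mul_sum, sum_lifts_pow_holes, sum_lifts_pow_count]
  ring

/-- The truncated generating function of hole-free words satisfies the functional equation. -/
theorem functional_equation_avoiding {τ v : R} {K : ℕ} (hK : 0 < K) (hτ : τ ^ K = 0) (β : R) :
    (1 - τ * β) * ∑ n ∈ Finset.range K, τ ^ n * holeSum v β n 0 0
      = 1 + v * τ * β
        * (∑ n ∈ Finset.range K, τ ^ n * holeSum v (1 + β * (1 - τ)) n 0 0
          - ∑ n ∈ Finset.range K, τ ^ n * holeSum v β n 0 0) := by
  set W : R → R → R → R := fun u x y => ∑ n ∈ Finset.range K, τ ^ n * holeSum v u n x y with hW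
  set Q : R → R → R → R := fun u x y =>
    ∑ n ∈ Finset.range K, τ ^ n * holeQuotient v u n x y with hQ
  have hWrec : ∀ u x y, W u x y
      = 1 + τ * (v * x * W u x x + x * Q u x y + u * W u (1 + y) y) := by
    intro u x y
    have := sum_range_pow_shift hτ fun n => holeSum v u n x y
    simp only [holeSum_zero, hK.ne', if_false, mul_one, holeSum_succ, mul_add,
      Finset.sum_add_distrib] at this
    simp only [mul_left_comm (τ ^ _), ← Finset.mul_sum] at this
    simp only [hW, hQ]
    linear_combination this
  have hWQ : ∀ u x y, (x - (1 + y)) * Q u x y = W u x y - W u (1 + y) y := by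
    intro u x y
    simp only [hW, hQ, Finset.mul_sum, ← Finset.sum_sub_distrib]
    refine Finset.sum_congr rfl fun n _ => ?_
    linear_combination τ ^ n * sub_mul_holeQuotient v u n x y
  refine functional_equation_of_hole_recursion hτ (G := fun u y => W u y y) ?_ β
  intro u x y hxy
  linear_combination (1 - τ * u) * (hWrec u y y) - (1 - τ * u) * τ * y * hWQ u y y
    + τ * (y + u) * (hWrec u x y) + τ * (y + u) * hWQ u x y
    - τ * (y + u) * Q u x y * hxy

end HoleWords

section Equidistribution

/-- The (2-1)-avoiding inversion sequences of length `n`, obtained from the hole-free words. -/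
noncomputable def avoidingSeqs (n : ℕ) : Finset (List ℕ) :=
  (holeWords n).preimage (List.map Nat.succ) (List.map_injective_iff.2 Nat.succ_injective).injOn

lemma mem_avoidingSeqs {n : ℕ} {s : List ℕ} :
    s ∈ avoidingSeqs n ↔ IsInvSeq s ∧ Avoids21 s ∧ s.length = n := by
  rw [avoidingSeqs, Finset.mem_preimage, mem_holeWords, List.length_map]
  have h1 : (∀ i < s.length, (s.map Nat.succ).getD i 0 ≤ i + 1) ↔ IsInvSeq s := by
    refine forall₂_congr fun i hi => ?_
    rw [List.getD_eq_getElem _ _ (by simpa using hi), List.getD_eq_getElem _ _ hi,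
      List.getElem_map]
    omega
  have h2 : ((s.map Nat.succ).Pairwise fun a b => b ≠ 0 → a ≠ b + 1) ↔ Avoids21 s := by
    rw [List.pairwise_map, List.pairwise_iff_getElem, Avoids21]
    constructor
    · intro h i j hij hj
      have := h i j (hij.trans hj) hj hij
      rw [List.getD_eq_getElem _ _ hj, List.getD_eq_getElem _ _ (hij.trans hj)]
      omega
    · intro h i j hi hj hij
      have := h i j hij hj
      rw [List.getD_eq_getElem _ _ hj, List.getD_eq_getElem _ _ hi] at this
      omega
  rw [h1, h2]
  tauto

lemma missing_map_succ {s : List ℕ} (hs : IsInvSeq s) : missing (s.map Nat.succ) = repN s := by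
  have h : s.toFinset ⊆ Finset.range s.length := by
    intro x hx
    obtain ⟨i, hi, rfl⟩ := List.mem_iff_getElem.1 (List.mem_toFinset.1 hx)
    have := hs i hi
    rw [List.getD_eq_getElem _ _ hi] at this
    exact Finset.mem_range.2 (this.trans_lt hi)
  have h' : (Finset.range (s.map Nat.succ).length).filter (fun k => k + 1 ∉ s.map Nat.succ)
      = Finset.range s.length \ s.toFinset := by
    ext k
    simp
  rw [missing, h', Finset.card_sdiff_of_subset h, Finset.card_range, repN_eq]

lemma maximal_map_succ (s : List ℕ) : maximal (s.map Nat.succ) = maxN s := by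
  rw [maximal, maxN, List.length_map]
  refine congrArg Finset.card (Finset.filter_congr fun i hi => ?_)
  have hi := Finset.mem_range.1 hi
  rw [List.getD_eq_getElem _ _ (by simpa using hi), List.getD_eq_getElem _ _ hi,
    List.getElem_map]
  omega

lemma holeSum_zero_zero {R : Type*} [CommRing R] (v u : R) (n : ℕ) :
    holeSum v u n 0 0 = ∑ s ∈ avoidingSeqs n, repMaxWeight u v s := by
  rw [holeSum, ← Finset.sum_preimage (List.map Nat.succ) (holeWords n)
    (List.map_injective_iff.2 Nat.succ_injective).injOn]
  · refine Finset.sum_congr rfl fun s hs => ?_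
    rw [← pow_add, holesBefore_add_holesAfter, List.count_eq_zero.2 (by simp), pow_zero, mul_one,
      missing_map_succ (mem_avoidingSeqs.1 hs).1, maximal_map_succ, repMaxWeight]
  · intro l _ hl
    rw [← pow_add, holesBefore_add_holesAfter, zero_pow, mul_zero]
    rw [Ne, List.count_eq_zero, not_not]
    by_contra h0
    refine hl ⟨l.map Nat.pred, ?_⟩
    rw [List.map_map]
    refine (List.map_congr_left fun x hx => ?_).trans (List.map_id l)
    exact Nat.succ_pred fun hx0 => h0 (hx0 ▸ hx)

lemma map_repMaxWeight {A B : Type*} [CommRing A] [CommRing B] (φ : A →+* B) (u v : A)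
    (s : List ℕ) : repMaxWeight (φ u) (φ v) s = φ (repMaxWeight u v s) := by
  simp [repMaxWeight]

theorem sum_repMaxWeight_eq {A : Type*} [CommRing A] (u v : A) (n : ℕ) :
    ∑ s ∈ runTails n 0, repMaxWeight u v s = ∑ s ∈ avoidingSeqs n, repMaxWeight u v s := by
  set π := Ideal.Quotient.mk (Ideal.span {(Polynomial.X : Polynomial A) ^ (n + 1)}) with hπ
  have hτ : π Polynomial.X ^ (n + 1) = 0 := by
    rw [← map_pow, hπ, Ideal.Quotient.eq_zero_iff_mem]
    exact Ideal.subset_span rfl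
  have key := functional_equation_unique hτ
    (functional_equation_ascent (v := π (Polynomial.C v)) n.succ_pos hτ)
    (functional_equation_avoiding (v := π (Polynomial.C v)) n.succ_pos hτ) (π (Polynomial.C u))
  simp only [holeSum_zero_zero, map_repMaxWeight, ← map_sum, ← map_pow, ← map_mul] at key
  rw [hπ, Ideal.Quotient.eq, Ideal.mem_span_singleton, Polynomial.X_pow_dvd_iff] at key
  have hcoeff : ∀ f : ℕ → A, (∑ k ∈ Finset.range (n + 1),
      Polynomial.X ^ k * Polynomial.C (f k) : Polynomial A).coeff n = f n := by
    intro f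
    rw [Polynomial.finsetSum_coeff, Finset.sum_eq_single n]
    · rw [mul_comm, Polynomial.coeff_C_mul_X_pow, if_pos rfl]
    · intro k _ hk
      rw [mul_comm, Polynomial.coeff_C_mul_X_pow, if_neg hk.symm]
    · simp
  have := key n n.lt_succ_self
  rw [Polynomial.coeff_sub, hcoeff, hcoeff] at this
  exact sub_eq_zero.1 this

lemma coeff_sum_repMaxWeight (S : Finset (List ℕ)) (a b : ℕ) :
    ((∑ s ∈ S, repMaxWeight (Polynomial.C Polynomial.X) Polynomial.X s :
      Polynomial (Polynomial ℤ)).coeff a).coeff b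
      = (S.filter fun s => repN s = a ∧ maxN s = b).card := by
  rw [Polynomial.finsetSum_coeff, Polynomial.finsetSum_coeff, Finset.card_filter,
    Nat.cast_sum]
  refine Finset.sum_congr rfl fun s _ => ?_
  rw [repMaxWeight, ← Polynomial.C_pow, mul_comm, Polynomial.coeff_C_mul_X_pow]
  by_cases ha : a = repN s
  · by_cases hb : b = maxN s
    · simp [ha, hb]
    · simp [ha, hb, Ne.symm hb, Polynomial.coeff_X_pow]
  · simp [ha, Ne.symm ha]

end Equidistribution

/-- `(rep, max)` is equidistributed over ascent sequences and over (2-1)-avoiding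
inversion sequences of length `n ≥ 1`. -/
theorem rep_max_equidistributed_ascent_avoiding (n : ℕ) (hn : 1 ≤ n) (a b : ℕ) :
    {s : List ℕ | IsAscSeq s ∧ s.length = n ∧ repN s = a ∧ maxN s = b}.ncard =
    {s : List ℕ | IsInvSeq s ∧ Avoids21 s ∧ s.length = n ∧
      repN s = a ∧ maxN s = b}.ncard := by
  have h1 : {s : List ℕ | IsAscSeq s ∧ s.length = n ∧ repN s = a ∧ maxN s = b}
      = ((runTails n 0).filter fun s => repN s = a ∧ maxN s = b : Finset (List ℕ)) := by
    ext s
    simp only [Set.mem_ofPred_eq, Finset.coe_filter, mem_runTails, isAscSeq_iff_runValid]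
    tauto
  have h2 : {s : List ℕ | IsInvSeq s ∧ Avoids21 s ∧ s.length = n ∧ repN s = a ∧ maxN s = b}
      = ((avoidingSeqs n).filter fun s => repN s = a ∧ maxN s = b : Finset (List ℕ)) := by
    ext s
    simp only [Set.mem_ofPred_eq, Finset.coe_filter, mem_avoidingSeqs]
    tauto
  rw [h1, h2, Set.ncard_coe_finset, Set.ncard_coe_finset]
  have := congrArg (fun p : Polynomial (Polynomial ℤ) => (p.coeff a).coeff b)
    (sum_repMaxWeight_eq (Polynomial.C Polynomial.X) Polynomial.X n)
  simp only [coeff_sum_repMaxWeight] at this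
  exact_mod_cast this
end

section
/- For every n ≥ 1, the pair (asc, zero) is equidistributed with the pair (rep, max) on ascent sequences of length n: for all a, b, the number of ascent sequences s of length n with asc(s)=a, zero(s)=b equals the number with rep(s)=a, max(s)=b. -/
namespace AscSeq

open Finset

section Lists

def lastN (s : List ℕ) : ℕ := s.getD (s.length - 1) 0

lemma getD_append_of_lt {s : List ℕ} {v i : ℕ} (h : i < s.length) :
    (s ++ [v]).getD i 0 = s.getD i 0 := by
  simp [List.getD_eq_getElem?_getD, List.getElem?_append_left h]

lemma getD_append_length (s : List ℕ) (v : ℕ) : (s ++ [v]).getD s.length 0 = v := by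
  simp

@[simp] lemma lastN_append (s : List ℕ) (v : ℕ) : lastN (s ++ [v]) = v := by
  simp [lastN]

lemma card_filter_range_succ (n : ℕ) (p : ℕ → Prop) [DecidablePred p] :
    ((range (n + 1)).filter p).card = ((range n).filter p).card + if p n then 1 else 0 := by
  rw [range_add_one, filter_insert]
  split_ifs with h <;> simp

lemma ascN_append {s : List ℕ} (hs : s ≠ []) (v : ℕ) :
    ascN (s ++ [v]) = ascN s + if lastN s < v then 1 else 0 := by
  obtain ⟨m, hm⟩ : ∃ m, s.length = m + 1 :=
    Nat.exists_eq_succ_of_ne_zero (by simpa using hs)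
  have e : (s ++ [v]).getD (m + 1) 0 = v := hm ▸ getD_append_length s v
  have e' : (s ++ [v]).getD m 0 = s.getD m 0 := getD_append_of_lt (by omega)
  have key : ascN (s ++ [v]) = ((range (m + 1)).filter fun i =>
      (s ++ [v]).getD i 0 < (s ++ [v]).getD (i + 1) 0).card := by
    simp only [ascN, List.length_append, hm, List.length_singleton, Nat.add_sub_cancel]
  rw [key, card_filter_range_succ, e, e', ascN, lastN, hm]
  congr 2
  apply filter_congr
  intro i hi
  have hi := mem_range.1 hi
  rw [getD_append_of_lt (by omega), getD_append_of_lt (by omega)]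

lemma card_filter_append (s : List ℕ) (v : ℕ) (p : ℕ → ℕ → Prop) [∀ i x, Decidable (p i x)] :
    ((range (s ++ [v]).length).filter fun i => p i ((s ++ [v]).getD i 0)).card =
      ((range s.length).filter fun i => p i (s.getD i 0)).card +
        if p s.length v then 1 else 0 := by
  rw [List.length_append, List.length_singleton, card_filter_range_succ, getD_append_length]
  congr 2
  apply filter_congr
  intro i hi
  rw [getD_append_of_lt (mem_range.1 hi)]

lemma zeroN_append (s : List ℕ) (v : ℕ) :
    zeroN (s ++ [v]) = zeroN s + if v = 0 then 1 else 0 :=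
  card_filter_append s v fun _ x => x = 0

lemma maxN_append (s : List ℕ) (v : ℕ) :
    maxN (s ++ [v]) = maxN s + if v = s.length then 1 else 0 :=
  card_filter_append s v fun i x => x = i

lemma repN_append (s : List ℕ) (v : ℕ) :
    repN (s ++ [v]) = repN s + if v ∈ s then 1 else 0 := by
  have h1 : s.toFinset.card ≤ s.length := s.toFinset_card_le
  have h2 : (s ++ [v]).toFinset = insert v s.toFinset := by ext; simp
  simp only [repN, ← List.card_toFinset, h2, List.length_append, List.length_singleton]
  split_ifs with h
  · rw [insert_eq_of_mem (List.mem_toFinset.2 h)]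
    omega
  · rw [card_insert_of_notMem (by simpa using h)]
    omega

lemma ascN_lt_length {s : List ℕ} (hs : s ≠ []) : ascN s < s.length := by
  have h := card_filter_le (range (s.length - 1)) fun i => s.getD i 0 < s.getD (i + 1) 0
  have := List.length_pos_iff.2 hs
  rw [card_range] at h
  unfold ascN
  omega

lemma isAscSeq_append {s : List ℕ} (hs : s ≠ []) (v : ℕ) :
    IsAscSeq (s ++ [v]) ↔ IsAscSeq s ∧ v < ascN s + 2 := by
  have hlt := ascN_lt_length hs
  have h1 : ∀ i < s.length, (s ++ [v]).take i = s.take i := fun i hi =>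
    List.take_append_of_le_length hi.le
  have h2 : (s ++ [v]).take s.length = s := by simp
  simp only [IsAscSeq, IsInvSeq, List.length_append, List.length_singleton, Nat.forall_lt_succ_right,
    getD_append_length, h2]
  constructor
  · rintro ⟨⟨h3, h4⟩, h5, h6⟩
    refine ⟨⟨fun i hi => ?_, fun i hi => ?_⟩, by omega⟩
    · rw [← getD_append_of_lt hi (v := v)]; exact h3 i hi
    · rw [← getD_append_of_lt hi (v := v), ← h1 i hi]; exact h5 i hi
  · rintro ⟨⟨h3, h4⟩, h5⟩
    refine ⟨⟨fun i hi => ?_, by omega⟩, fun i hi => ?_, by omega⟩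
    · rw [getD_append_of_lt hi]; exact h3 i hi
    · rw [getD_append_of_lt hi, h1 i hi]; exact h4 i hi

/-- The finite set of ascent sequences of length `n + 1`. -/
def ascF : ℕ → Finset (List ℕ)
  | 0 => {[0]}
  | n + 1 => (ascF n).biUnion fun s => (range (ascN s + 2)).image fun v => s ++ [v]

lemma mem_ascF {n : ℕ} {s : List ℕ} : s ∈ ascF n ↔ IsAscSeq s ∧ s.length = n + 1 := by
  induction n generalizing s with
  | zero =>
    simp only [ascF, mem_singleton, zero_add]
    constructor
    · rintro rfl
      simp [IsAscSeq, IsInvSeq]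
    · rintro ⟨⟨h, -⟩, hl⟩
      obtain ⟨x, rfl⟩ := List.length_eq_one_iff.1 hl
      simpa [IsInvSeq] using h
  | succ n ih =>
    simp only [ascF, mem_biUnion, mem_image, mem_range]
    constructor
    · rintro ⟨s, hs, v, hv, rfl⟩
      obtain ⟨h1, h2⟩ := ih.1 hs
      have hne : s ≠ [] := List.ne_nil_of_length_eq_add_one h2
      exact ⟨(isAscSeq_append hne v).2 ⟨h1, hv⟩, by simp [h2]⟩
    · rintro ⟨h1, h2⟩
      rcases List.eq_nil_or_concat s with rfl | ⟨s, v, rfl⟩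
      · simp at h2
      · simp only [List.concat_eq_append, List.length_append, List.length_singleton] at h1 h2 ⊢
        have hne : s ≠ [] := List.ne_nil_of_length_eq_add_one (n := n) (by omega)
        obtain ⟨h3, h4⟩ := (isAscSeq_append hne v).1 h1
        exact ⟨s, ih.2 ⟨h3, by omega⟩, v, h4, rfl⟩

variable {R : Type*} [CommRing R]

/-- Sum of `f` over the admissible one-letter extensions of a sequence. -/
def extend (f : List ℕ → R) (s : List ℕ) : R := ∑ v ∈ range (ascN s + 2), f (s ++ [v])

lemma sum_ascF (n : ℕ) (f : List ℕ → R) : ∑ s ∈ ascF n, f s = extend^[n] f [0] := by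
  induction n generalizing f with
  | zero => simp [ascF]
  | succ n ih =>
    rw [Function.iterate_succ_apply, ← ih, ascF, sum_biUnion]
    · refine sum_congr rfl fun s _ => ?_
      rw [sum_image fun a _ b _ h => by simpa using h]
      rfl
    · intro s _ s' _ hne
      refine disjoint_left.2 fun x hx hx' => hne ?_
      simp only [mem_image] at hx hx'
      obtain ⟨v, -, rfl⟩ := hx
      obtain ⟨v', -, h⟩ := hx'
      exact (List.append_inj' h rfl).1.symm

lemma iterate_extend_succ (r : ℕ) (f : List ℕ → R) (s : List ℕ) :
    extend^[r + 1] f s = ∑ v ∈ range (ascN s + 2), extend^[r] f (s ++ [v]) := by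
  rw [Function.iterate_succ_apply']
  rfl

end Lists

section Algebra

variable {R : Type*} [CommRing R]

/-- Truncated power series; when `q ^ M = 0` it is the full series `∑ q ^ k * f k`. -/
def psum (M : ℕ) (q : R) (f : ℕ → R) : R := ∑ k ∈ range M, q ^ k * f k

lemma psum_add (M : ℕ) (q : R) (f g : ℕ → R) :
    psum M q (fun k => f k + g k) = psum M q f + psum M q g := by
  simp [psum, mul_add, sum_add_distrib]

lemma psum_sub (M : ℕ) (q : R) (f g : ℕ → R) :
    psum M q (fun k => f k - g k) = psum M q f - psum M q g := by
  simp [psum, mul_sub, sum_sub_distrib]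

lemma psum_mul_left (M : ℕ) (q c : R) (f : ℕ → R) :
    psum M q (fun k => c * f k) = c * psum M q f := by
  simp only [psum, mul_sum]
  exact sum_congr rfl fun _ _ => by ring

lemma psum_sum {ι : Type*} (M : ℕ) (q : R) (S : Finset ι) (f : ι → ℕ → R) :
    psum M q (fun k => ∑ i ∈ S, f i k) = ∑ i ∈ S, psum M q (f i) := by
  simp only [psum, mul_sum]
  exact sum_comm

lemma mul_psum_succ {M : ℕ} {q : R} (hq : q ^ M = 0) (f : ℕ → R) :
    q * psum M q (fun k => f (k + 1)) = psum M q f - f 0 := by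
  have h1 := sum_range_succ (fun k => q ^ k * f k) M
  rw [sum_range_succ', hq] at h1
  simp only [pow_zero, one_mul, zero_mul, add_zero] at h1
  rw [psum, psum, ← h1, add_sub_cancel_right, mul_sum]
  exact sum_congr rfl fun _ _ => by ring

lemma psum_of_recurrence {M : ℕ} {q : R} (hq : q ^ M = 0) {F d : ℕ → R}
    (h : ∀ k, F k = d k + q * F (k + 1)) : F 0 = psum M q d := by
  have h1 := mul_psum_succ hq F
  rw [← psum_mul_left] at h1
  have h2 : psum M q d = psum M q F - psum M q fun k => q * F (k + 1) := by
    rw [← psum_sub]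
    congr 1
    ext k
    rw [h k]
    ring
  rw [h2, h1]
  ring

lemma isUnit_one_sub_mul {M : ℕ} {t : R} (ht : t ^ M = 0) (c : R) : IsUnit (1 - t * c) :=
  IsNilpotent.isUnit_one_sub ⟨M, by rw [mul_pow, ht, zero_mul]⟩

/-- Sum of `φ` over the states (number of ascents, last letter) reachable by appending a letter,
where the letter `0` has weight `y`. -/
def step (y : R) : (ℕ → ℕ → R) →ₗ[R] (ℕ → ℕ → R) where
  toFun φ A e := ∑ v ∈ range (A + 2), (if v = 0 then y else 1) * φ (A + if e < v then 1 else 0) v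
  map_add' φ ψ := by
    ext A e
    simp [mul_add, sum_add_distrib]
  map_smul' c φ := by
    ext A e
    simp only [Pi.smul_apply, smul_eq_mul, mul_sum, RingHom.id_apply]
    exact sum_congr rfl fun _ _ => by ring

lemma step_apply (y : R) (φ : ℕ → ℕ → R) (A e : ℕ) :
    step y φ A e =
      ∑ v ∈ range (A + 2), (if v = 0 then y else 1) * φ (A + if e < v then 1 else 0) v := rfl

lemma step_pow_succ (y : R) (r : ℕ) (φ : ℕ → ℕ → R) :
    (step y ^ (r + 1)) φ = step y ((step y ^ r) φ) := by
  rw [pow_succ']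
  rfl

lemma sum_range_split (A e : ℕ) (he : e ≤ A) (f g : ℕ → R) :
    ∑ v ∈ range (A + 2), (if e < v then g v else f v) =
      ∑ v ∈ range (e + 1), f v + ∑ v ∈ Ico (e + 1) (A + 2), g v := by
  rw [← sum_range_add_sum_Ico _ (show e + 1 ≤ A + 2 by omega)]
  congr 1
  · refine sum_congr rfl fun v hv => if_neg ?_
    have := mem_range.1 hv
    omega
  · refine sum_congr rfl fun v hv => if_pos ?_
    have := mem_Ico.1 hv
    omega

lemma step_apply_of_le (y : R) (φ : ℕ → ℕ → R) {A e : ℕ} (he : e ≤ A) :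
    step y φ A e = (y - 1) * φ A 0 + ∑ v ∈ range (e + 1), φ A v +
      ∑ v ∈ Ico (e + 1) (A + 2), φ (A + 1) v := by
  rw [step_apply, add_assoc, ← sum_range_split A e he, sum_range_succ', sum_range_succ' _ (A + 1)]
  simp only [Nat.add_eq_zero_iff, one_ne_zero, and_false, if_false, one_mul, if_true, Nat.not_lt_zero,
    add_zero]
  have : ∀ v ∈ range (A + 1), φ (A + if e < v + 1 then 1 else 0) (v + 1) =
      if e < v + 1 then φ (A + 1) (v + 1) else φ A (v + 1) := fun v _ => by
    split_ifs <;> rfl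
  rw [sum_congr rfl this]
  ring

lemma step_pow_congr (y : R) {φ ψ : ℕ → ℕ → R} (h : ∀ A e, e ≤ A → φ A e = ψ A e) (r : ℕ) :
    ∀ A e, e ≤ A → (step y ^ r) φ A e = (step y ^ r) ψ A e := by
  induction r with
  | zero => simpa using h
  | succ r ih =>
    intro A e he
    rw [step_pow_succ, step_pow_succ, step_apply, step_apply]
    refine sum_congr rfl fun v hv => ?_
    have := mem_range.1 hv
    rw [ih]
    split_ifs <;> omega

lemma iterate_extend_asc_zero (y : R) (φ : ℕ → ℕ → R) (r : ℕ) {s : List ℕ} (hs : s ≠ []) :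
    extend^[r] (fun s => y ^ zeroN s * φ (ascN s) (lastN s)) s =
      y ^ zeroN s * (step y ^ r) φ (ascN s) (lastN s) := by
  induction r generalizing s with
  | zero => simp
  | succ r ih =>
    rw [iterate_extend_succ, step_pow_succ, step_apply, mul_sum]
    refine sum_congr rfl fun v _ => ?_
    rw [ih (by simp), lastN_append, ascN_append hs, zeroN_append, pow_add]
    split_ifs <;> simp [mul_assoc]

/-- Generating function in `t` of the sums of `φ` over states, started in the state `(0, 0)`. -/
def pathSum (M : ℕ) (t y : R) (φ : ℕ → ℕ → R) : R := psum M t fun n => (step y ^ n) φ 0 0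

lemma pathSum_sub_step {M : ℕ} {t : R} (ht : t ^ M = 0) (y : R) (φ : ℕ → ℕ → R) :
    pathSum M t y φ - t * pathSum M t y (step y φ) = φ 0 0 := by
  have h := mul_psum_succ ht fun n => (step y ^ n) φ 0 0
  have h2 : ∀ n, (step y ^ (n + 1)) φ = (step y ^ n) (step y φ) := fun n => by
    rw [pow_succ]
    rfl
  simp only [h2] at h
  rw [pathSum, pathSum, h]
  simp

lemma pathSum_congr (M : ℕ) (t y : R) {φ ψ : ℕ → ℕ → R} (h : ∀ A e, e ≤ A → φ A e = ψ A e) :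
    pathSum M t y φ = pathSum M t y ψ := by
  unfold pathSum
  congr 1
  ext n
  exact step_pow_congr y h n 0 0 le_rfl

lemma pathSum_sub (M : ℕ) (t y : R) (φ ψ : ℕ → ℕ → R) :
    pathSum M t y (φ - ψ) = pathSum M t y φ - pathSum M t y ψ := by
  simp [pathSum, ← psum_sub]

lemma pathSum_smul (M : ℕ) (t y c : R) (φ : ℕ → ℕ → R) :
    pathSum M t y (c • φ) = c * pathSum M t y φ := by
  simp [pathSum, ← psum_mul_left]

/-- Ascent sequences by ascents (`a`) and zeros (`y`). -/
def ascGF (M : ℕ) (t y a : R) : R := pathSum M t y fun A _ => a ^ A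

lemma sub_step_geometric (t y : R) {a b : R} (hb : b * (1 - t + t * a) = 1) {A e : ℕ} (he : e ≤ A) :
    (1 - a) * (a ^ A * b ^ e - t * step y (fun A e => a ^ A * b ^ e) A e) =
      (1 - y * t * (1 - a)) * a ^ A - a * b * (a * b) ^ A := by
  have hT : step y (fun A e => a ^ A * b ^ e) A e = (y - 1) * a ^ A +
      a ^ A * (1 + b * ∑ i ∈ range e, b ^ i) + a ^ (A + 1) * (∑ i ∈ range (A + 2), b ^ i -
        (1 + b * ∑ i ∈ range e, b ^ i)) := by
    have h2 : 1 + b * ∑ i ∈ range e, b ^ i = ∑ i ∈ range (e + 1), b ^ i := by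
      rw [geom_sum_succ]
      ring
    rw [step_apply_of_le y _ he, h2, ← sum_range_add_sum_Ico _ (show e + 1 ≤ A + 2 by omega)]
    simp only [← mul_sum]
    ring
  have h1 := geom_sum_mul b e
  have h2 := geom_sum_mul b (A + 2)
  rw [hT]
  set g := ∑ i ∈ range e, b ^ i
  set G := ∑ i ∈ range (A + 2), b ^ i
  have hb1 : b - 1 = t * b * (1 - a) := by linear_combination hb
  have hg : b ^ e = 1 + t * b * (1 - a) * g := by rw [← hb1]; linear_combination -h1
  have hG : t * b * (1 - a) * G = b ^ (A + 2) - 1 := by rw [← hb1]; linear_combination h2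
  have hG' : t * (1 - a) * G = (1 - t + t * a) * (b ^ (A + 2) - 1) := by
    linear_combination (1 - t + t * a) * hG - t * (1 - a) * G * hb
  rw [hg, mul_pow]
  linear_combination (- a ^ (A + 1)) * hG' - a ^ (A + 1) * b ^ (A + 1) * hb

lemma ascGF_geometric {M : ℕ} {t : R} (ht : t ^ M = 0) (y : R) {a b : R}
    (hb : b * (1 - t + t * a) = 1) :
    ascGF M t y a * (1 - y * t * (1 - a)) = (1 - a) + a * b * ascGF M t y (a * b) := by
  have h := pathSum_sub_step ht y fun A e => a ^ A * b ^ e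
  rw [← pathSum_smul, ← pathSum_sub] at h
  set φ : ℕ → ℕ → R := fun A e => a ^ A * b ^ e with hφ
  set α : ℕ → ℕ → R := fun A _ => a ^ A with hα
  set β : ℕ → ℕ → R := fun A _ => (a * b) ^ A with hβ
  have h2 : pathSum M t y ((1 - a) • (φ - t • step y φ)) =
      pathSum M t y ((1 - y * t * (1 - a)) • α - (a * b) • β) :=
    pathSum_congr M t y fun A e he => sub_step_geometric t y hb he
  rw [pathSum_smul, h, pathSum_sub, pathSum_smul, pathSum_smul] at h2
  have h3 : φ 0 0 = 1 := by simp [hφ]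
  rw [ascGF, ascGF, ← hα, ← hβ]
  linear_combination -h2 + (1 - a) * h3

lemma eq_of_iterated {a : R} {M : ℕ} (ha : a ^ M = 0) {d c σ : R → R}
    (hσ : ∀ x, x ∣ σ x) (h : ∀ x, d x = x * c x * d (σ x)) : d a = 0 := by
  have key : ∀ k x, x ^ k ∣ d x := by
    intro k
    induction k with
    | zero => simp
    | succ k ih =>
      intro x
      rw [h x, pow_succ', mul_assoc]
      exact mul_dvd_mul_left x (((pow_dvd_pow_of_dvd (hσ x) k).trans (ih _)).mul_left _)
  simpa [ha] using key M a

/-- Merging the letters `0` and `1`. -/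
lemma ascGF_merge {M : ℕ} {t a : R} (ht : t ^ M = 0) (ha : a ^ M = 0) (y : R) :
    ascGF M t y a * (1 - y * t * (1 - a)) =
      1 + a * (t * (1 + (1 - t) * y)) * ascGF M t (1 + (1 - t) * y) a := by
  set y' := 1 + (1 - t) * y with hy'
  have hinv : ∀ x : R, ∃ b : R, b * (1 - t + t * x) = 1 := fun x => by
    obtain ⟨b, hb⟩ := (isUnit_one_sub_mul ht (1 - x)).exists_left_inv
    exact ⟨b, by linear_combination hb⟩
  choose b hb using hinv
  have hinv' : ∀ x : R, ∃ c : R, c * (1 - y' * t * (1 - x)) = 1 := fun x => by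
    obtain ⟨c, hc⟩ := (isUnit_one_sub_mul ht (y' * (1 - x))).exists_left_inv
    exact ⟨c, by linear_combination hc⟩
  choose c hc using hinv'
  have key := eq_of_iterated ha (c := fun x => c x * b x) (σ := fun x => x * b x)
    (d := fun x => b x * ascGF M t y (x * b x) - 1 - t * y' * ascGF M t y' x)
    (fun x => dvd_mul_right _ _) fun x => by
      have h1 := ascGF_geometric ht y (hb (x * b x))
      have h2 := ascGF_geometric ht y' (hb x)
      have e : 1 - y' * t * (1 - x) = (1 - t + t * x) * (1 - y * t * (1 - x * b x)) := by
        rw [hy']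
        linear_combination (-(y * t * x)) * hb x
      have h3 : (b x * ascGF M t y (x * b x) - 1 - t * y' * ascGF M t y' x) *
          (1 - y' * t * (1 - x)) = x * b x * (b (x * b x) * ascGF M t y (x * b x * b (x * b x))
            - 1 - t * y' * ascGF M t y' (x * b x)) := by
        linear_combination b x * ascGF M t y (x * b x) * e +
          ascGF M t y (x * b x) * (1 - y * t * (1 - x * b x)) * hb x + h1 - t * y' * h2
      linear_combination c x * h3 - (b x * ascGF M t y (x * b x) - 1 - t * y' * ascGF M t y' x) * hc x
  have h := ascGF_geometric ht y (hb a)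
  linear_combination h + a * key

end Algebra

section Repeats

variable {R : Type*} [CommRing R]

/-- Weighted number of ways to append `r` letters to an ascent sequence with `A` ascents, last
letter `e` and set of letters `U`, where each letter which is not new has weight `u`. -/
def repSum (u : R) : ℕ → ℕ → ℕ → Finset ℕ → R
  | 0, _, _, _ => 1
  | r + 1, A, e, U => ∑ v ∈ range (A + 2),
      (if v ∈ U then u else 1) * repSum u r (A + if e < v then 1 else 0) v (insert v U)

/-- The increasing map skipping `g`. -/
def skip (g x : ℕ) : ℕ := if x < g then x else x + 1

lemma skip_ne (g x : ℕ) : skip g x ≠ g := by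
  unfold skip
  split_ifs <;> omega

lemma skip_lt_skip {g x z : ℕ} : skip g x < skip g z ↔ x < z := by
  unfold skip
  split_ifs <;> omega

lemma skip_injective (g : ℕ) : Function.Injective (skip g) := by
  intro x z h
  unfold skip at h
  split_ifs at h <;> omega

lemma range_succ_eq_insert_skip {g n : ℕ} (hg : g ≤ n) :
    range (n + 1) = insert g ((range n).image (skip g)) := by
  ext x
  simp only [mem_range, mem_insert, mem_image]
  constructor
  · intro hx
    rcases lt_trichotomy x g with h | h | h
    · exact Or.inr ⟨x, by omega, by simp [skip, h]⟩
    · exact Or.inl h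
    · exact Or.inr ⟨x - 1, by omega, by rw [skip, if_neg (by omega)]; omega⟩
  · rintro (h | ⟨z, hz, rfl⟩)
    · omega
    · unfold skip
      split_ifs <;> omega

lemma sum_range_succ_skip {g n : ℕ} (hg : g ≤ n) (f : ℕ → R) :
    ∑ v ∈ range (n + 1), f v = f g + ∑ v ∈ range n, f (skip g v) := by
  rw [range_succ_eq_insert_skip hg, sum_insert, sum_image (skip_injective g).injOn]
  simp [skip_ne]

/-- Effect of declaring an unused letter `g` to be used. -/
lemma repSum_insert (u : R) (r : ℕ) : ∀ {B g : ℕ} (e : ℕ) (U : Finset ℕ), g ≤ B + 2 →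
    repSum u r (B + 1) (skip g e) (insert g (U.image (skip g))) =
      u * repSum u r (B + 1) (skip g e) (U.image (skip g)) + (1 - u) * repSum u r B e U := by
  induction r with
  | zero => intros; simp [repSum]
  | succ r ih =>
    intro B g e U hg
    simp only [repSum]
    rw [sum_range_succ_skip (n := B + 2) hg, sum_range_succ_skip (n := B + 2) hg, mul_add, mul_sum,
      mul_sum, add_assoc (u * _), ← sum_add_distrib]
    have hgU : g ∉ U.image (skip g) := by simp [skip_ne]
    congr 1
    · simp [hgU]
    · refine sum_congr rfl fun v _ => ?_
      have h1 : skip g v ∈ insert g (U.image (skip g)) ↔ v ∈ U := by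
        simp [skip_ne, (skip_injective g).eq_iff]
      have h2 : skip g v ∈ U.image (skip g) ↔ v ∈ U := by
        simp [(skip_injective g).eq_iff]
      have h3 := ih (B := B + if e < v then 1 else 0) (g := g) v (insert v U) (by omega)
      simp only [h1, h2, skip_lt_skip, insert_comm (skip g v) g, ← image_insert]
      rw [add_right_comm B 1, h3]
      ring

/-- The sum `repSum` when all letters up to the number of ascents are in use. -/
def fullSum (u : R) (r A e : ℕ) : R := repSum u r A e (range (A + 1))

lemma mul_repSum_range (u : R) (r : ℕ) {A e : ℕ} (he : e ≤ A) :
    u * repSum u r (A + 1) e (range (A + 1)) = fullSum u r (A + 1) e - (1 - u) * fullSum u r A e := by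
  have h := repSum_insert u r (B := A) (g := A + 1) e (range (A + 1)) (by omega)
  have h1 : skip (A + 1) e = e := if_pos (by omega)
  have h2 : (range (A + 1)).image (skip (A + 1)) = range (A + 1) := by
    conv_rhs => rw [← image_id (s := range (A + 1))]
    exact image_congr fun x hx => if_pos (by simpa using hx)
  rw [h1, h2, ← range_add_one] at h
  rw [fullSum, fullSum, h]
  ring

lemma fullSum_succ (u : R) (r : ℕ) {A e : ℕ} (he : e ≤ A) :
    fullSum u (r + 1) A e = u * ∑ v ∈ range (e + 1), fullSum u r A v +
      ∑ v ∈ Ico (e + 1) (A + 1), (fullSum u r (A + 1) v - (1 - u) * fullSum u r A v) +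
      fullSum u r (A + 1) (A + 1) := by
  rw [fullSum, repSum, sum_range_succ]
  congr 1
  · rw [← sum_range_add_sum_Ico _ (show e + 1 ≤ A + 1 by omega), mul_sum]
    congr 1
    · refine sum_congr rfl fun v hv => ?_
      have hv := mem_range.1 hv
      have hm : v ∈ range (A + 1) := mem_range.2 (by omega)
      rw [if_pos hm, if_neg (by omega), insert_eq_of_mem hm, add_zero, fullSum]
    · refine sum_congr rfl fun v hv => ?_
      have hv := mem_Ico.1 hv
      have hm : v ∈ range (A + 1) := mem_range.2 (by omega)
      rw [if_pos hm, if_pos (by omega), insert_eq_of_mem hm, mul_repSum_range u r (by omega)]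
  · rw [if_neg (by simp), if_pos (by omega), one_mul, ← range_add_one, fullSum]

lemma fullSum_succ_right (u : R) (r : ℕ) {A e : ℕ} (he : e + 1 ≤ A) :
    fullSum u (r + 1) A e =
      fullSum u (r + 1) A (e + 1) - fullSum u r A (e + 1) + fullSum u r (A + 1) (e + 1) := by
  rw [fullSum_succ u r he, fullSum_succ u r (by omega : e ≤ A), sum_range_succ _ (e + 1),
    sum_eq_sum_Ico_succ_bot (by omega : e + 1 < A + 1)]
  ring

lemma fullSum_diag (u : R) (r A : ℕ) :
    fullSum u (r + 1) A A = u * ∑ v ∈ range (A + 1), fullSum u r A v +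
      fullSum u r (A + 1) (A + 1) := by
  rw [fullSum_succ u r le_rfl]
  simp

/-- Weighted number of ways to append `r` letters to `0, 1, …, k`, where `y` marks the letters
continuing the initial run. -/
def runSum (u y : R) : ℕ → ℕ → R
  | 0, _ => 1
  | r + 1, k => y * runSum u y r (k + 1) + u * ∑ v ∈ range (k + 1), fullSum u r k v

lemma iterate_extend_rep (u y : R) (r : ℕ) {s : List ℕ} (hs : s ≠ []) (h : ascN s + 1 < s.length) :
    extend^[r] (fun s => u ^ repN s * y ^ maxN s) s =
      u ^ repN s * y ^ maxN s * repSum u r (ascN s) (lastN s) s.toFinset := by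
  induction r generalizing s with
  | zero => simp [repSum]
  | succ r ih =>
    rw [iterate_extend_succ, repSum, mul_sum]
    refine sum_congr rfl fun v hv => ?_
    have hv := mem_range.1 hv
    have ha := ascN_append hs v
    have ht : (s ++ [v]).toFinset = insert v s.toFinset := by ext; simp
    rw [ih (by simp) (by rw [ha, List.length_append, List.length_singleton]; split_ifs <;> omega),
      lastN_append, ha, repN_append, maxN_append, if_neg (by omega : v ≠ s.length), ht]
    simp only [List.mem_toFinset]
    split_ifs <;> ring

lemma ascN_range (k : ℕ) : ascN (List.range (k + 1)) = k := by
  induction k with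
  | zero => simp [ascN]
  | succ k ih =>
    rw [List.range_succ, ascN_append (by simp), ih, List.range_succ, lastN_append, if_pos (by omega)]

lemma maxN_range (k : ℕ) : maxN (List.range k) = k := by
  induction k with
  | zero => simp [maxN]
  | succ k ih =>
    rw [List.range_succ, maxN_append, ih, List.length_range, if_pos rfl]

lemma repN_range (k : ℕ) : repN (List.range k) = 0 := by
  rw [repN, List.nodup_range.dedup, Nat.sub_self]

lemma iterate_extend_rep_range (u y : R) (r k : ℕ) :
    extend^[r] (fun s => u ^ repN s * y ^ maxN s) (List.range (k + 1)) =
      y ^ (k + 1) * runSum u y r k := by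
  induction r generalizing k with
  | zero => simp [runSum, maxN_range, repN_range]
  | succ r ih =>
    rw [iterate_extend_succ, ascN_range, sum_range_succ, ← List.range_succ, ih, runSum, mul_add,
      mul_sum, mul_sum, add_comm]
    congr 1
    · ring
    · refine sum_congr rfl fun v hv => ?_
      have hv := mem_range.1 hv
      have hl : lastN (List.range (k + 1)) = k := by rw [List.range_succ, lastN_append]
      have ha : ascN (List.range (k + 1) ++ [v]) = k := by
        rw [ascN_append (by simp), ascN_range, hl, if_neg (by omega), add_zero]
      have hr : repN (List.range (k + 1) ++ [v]) = 1 := by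
        rw [repN_append, repN_range, if_pos (List.mem_range.2 hv)]
      have hm : maxN (List.range (k + 1) ++ [v]) = k + 1 := by
        rw [maxN_append, maxN_range, List.length_range, if_neg (by omega), add_zero]
      have ht : (List.range (k + 1) ++ [v]).toFinset = range (k + 1) := by
        ext x
        simp only [List.mem_toFinset, List.mem_append, List.mem_range, List.mem_singleton, mem_range]
        omega
      rw [iterate_extend_rep u y r (by simp) (by simp [ha]), hr, hm, lastN_append, ha, ht, fullSum]
      ring

/-- Ascent sequences by repeated entries (`u`) and maximal entries (`y`). -/
def repGF (M : ℕ) (t y u : R) : R := psum M t fun r => runSum u y r 0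

def fullGF (M : ℕ) (t u : R) (A e : ℕ) : R := psum M t fun r => fullSum u r A e

lemma psum_eq_add {M : ℕ} {t : R} (ht : t ^ M = 0) (f : ℕ → R) :
    psum M t f = f 0 + t * psum M t fun r => f (r + 1) := by
  rw [mul_psum_succ ht]
  ring

lemma fullGF_succ_right {M : ℕ} {t : R} (ht : t ^ M = 0) (u : R) {A e : ℕ} (he : e + 1 ≤ A) :
    fullGF M t u A e = (1 - t) * fullGF M t u A (e + 1) + t * fullGF M t u (A + 1) (e + 1) := by
  have h1 := psum_eq_add ht fun r => fullSum u r A e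
  have h2 := psum_eq_add ht fun r => fullSum u r A (e + 1)
  simp only [fullSum_succ_right u _ he, psum_add, psum_sub] at h1
  simp only [fullGF]
  have h3 : fullSum u 0 A e = 1 := rfl
  have h4 : fullSum u 0 A (e + 1) = 1 := rfl
  linear_combination h1 - h2 + h3 - h4

/-- The contribution of the non-maximal continuations of `0, 1, …, k`. -/
def runTerm (M : ℕ) (t u : R) (k : ℕ) : R := 1 + u * t * ∑ v ∈ range (k + 1), fullGF M t u k v

lemma fullGF_diag {M : ℕ} {t : R} (ht : t ^ M = 0) (u : R) (A : ℕ) :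
    fullGF M t u A A = runTerm M t u A + t * fullGF M t u (A + 1) (A + 1) := by
  have h1 := psum_eq_add ht fun r => fullSum u r A A
  simp only [fullSum_diag, psum_add, psum_mul_left, psum_sum] at h1
  have h3 : fullSum u 0 A A = 1 := rfl
  simp only [fullGF, runTerm]
  linear_combination h1 + h3

lemma repGF_eq_psum {M : ℕ} {t : R} (ht : t ^ M = 0) (u y : R) :
    repGF M t y u = psum M (t * y) (runTerm M t u) := by
  refine psum_of_recurrence (F := fun k => psum M t fun r => runSum u y r k)
    (by rw [mul_pow, ht, zero_mul]) fun k => ?_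
  have h1 := psum_eq_add ht fun r => runSum u y r k
  simp only [runSum, psum_add, psum_mul_left, psum_sum] at h1
  simp only [fullGF, runTerm]
  linear_combination h1

lemma psum_fullGF_zero {M : ℕ} {t : R} (ht : t ^ M = 0) (u y : R) :
    psum M (t * y) (fun A => fullGF M t u A 0) = repGF M t (1 + (1 - t) * y) u := by
  have hz : (t * y) ^ M = 0 := by rw [mul_pow, ht, zero_mul]
  have h := psum_of_recurrence (q := t * (1 + (1 - t) * y)) (by rw [mul_pow, ht, zero_mul])
    (F := fun e => psum M (t * y) fun j => fullGF M t u (e + j) e) (d := runTerm M t u) fun e => by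
      have h1 := psum_eq_add hz fun j => fullGF M t u (e + j) e
      have h2 : ∀ j, fullGF M t u (e + (j + 1)) e = (1 - t) * fullGF M t u (e + 1 + j) (e + 1) +
          t * fullGF M t u (e + 1 + (j + 1)) (e + 1) := fun j => by
        rw [fullGF_succ_right ht u (by omega)]
        congr 3 <;> ring
      have h3 := mul_psum_succ hz fun j => fullGF M t u (e + 1 + j) (e + 1)
      simp only [h2, psum_add, psum_mul_left] at h1
      have h4 := fullGF_diag ht u e
      simp only [add_zero] at h1 h3
      linear_combination h1 + h4 + t * h3
  simpa [repGF_eq_psum ht] using h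

lemma repGF_merge {M : ℕ} {t : R} (ht : t ^ M = 0) (u y : R) :
    repGF M t y u * (1 - y * t * (1 - u)) =
      1 + u * (t * (1 + (1 - t) * y)) * repGF M t (1 + (1 - t) * y) u := by
  have hz : (t * y) ^ M = 0 := by rw [mul_pow, ht, zero_mul]
  set c : ℕ → R := fun A => ∑ v ∈ range (A + 1), fullGF M t u A v with hc
  have hrec : ∀ A, c A = runTerm M t u A + (1 - t) * (c A - fullGF M t u A 0) +
      t * (c (A + 1) - fullGF M t u (A + 1) 0) := fun A => by
    have h1 : c A = ∑ e ∈ range A, fullGF M t u A e + fullGF M t u A A := sum_range_succ _ _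
    have h2 : ∑ e ∈ range A, fullGF M t u A e =
        ∑ e ∈ range A, ((1 - t) * fullGF M t u A (e + 1) + t * fullGF M t u (A + 1) (e + 1)) :=
      sum_congr rfl fun e he => fullGF_succ_right ht u (mem_range.1 he)
    rw [sum_add_distrib, ← mul_sum, ← mul_sum] at h2
    have h3 : c A = _ := sum_range_succ' _ _
    have h4 : c (A + 1) = _ := sum_range_succ' _ _
    rw [sum_range_succ] at h4
    linear_combination h1 + h2 + fullGF_diag ht u A - (1 - t) * h3 - t * h4
  have h1 := mul_psum_succ hz c
  have h2 := mul_psum_succ hz fun A => fullGF M t u A 0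
  have h3 : psum M (t * y) c = psum M (t * y) (fun A => runTerm M t u A +
      (1 - t) * (c A - fullGF M t u A 0) + t * (c (A + 1) - fullGF M t u (A + 1) 0)) := by
    congr 1
    exact funext hrec
  simp only [psum_add, psum_sub, psum_mul_left] at h3
  have h4 : psum M (t * y) (runTerm M t u) =
      psum M (t * y) (fun _ => 1) + u * t * psum M (t * y) c := by
    rw [← psum_mul_left, ← psum_add]
    rfl
  have h5 := mul_psum_succ hz fun _ => (1 : R)
  have h6 : c 0 = fullGF M t u 0 0 := by simp [hc]
  rw [psum_fullGF_zero ht] at h2 h3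
  rw [← repGF_eq_psum ht] at h3 h4
  linear_combination (1 - t * y) * h4 - h5 - u * (t * y * h3 + t * h1 - t * h2 - t * h6)

theorem ascGF_eq_repGF {M : ℕ} {t u : R} (ht : t ^ M = 0) (hu : u ^ M = 0) (y : R) :
    ascGF M t y u = repGF M t y u := by
  have hinv : ∀ x : R, ∃ b : R, b * (1 - x * t * (1 - u)) = 1 := fun x => by
    obtain ⟨b, hb⟩ := (isUnit_one_sub_mul ht (x * (1 - u))).exists_left_inv
    exact ⟨b, by linear_combination hb⟩
  choose b hb using hinv
  have key : ∀ k x, u ^ k ∣ ascGF M t x u - repGF M t x u := by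
    intro k
    induction k with
    | zero => simp
    | succ k ih =>
      intro x
      have h1 := ascGF_merge ht hu x
      have h2 := repGF_merge ht u x
      have h3 : ascGF M t x u - repGF M t x u = u * (b x * (t * (1 + (1 - t) * x)) *
          (ascGF M t (1 + (1 - t) * x) u - repGF M t (1 + (1 - t) * x) u)) := by
        linear_combination b x * (h1 - h2) - (ascGF M t x u - repGF M t x u) * hb x
      rw [h3, pow_succ']
      exact mul_dvd_mul_left u ((ih _).mul_left _)
  have h := key M y
  rw [hu, zero_dvd_iff] at h
  exact sub_eq_zero.1 h

theorem sum_asc_zero_eq_sum_rep_max {M : ℕ} {t u : R} (ht : t ^ M = 0) (hu : u ^ M = 0) (y : R) :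
    ∑ n ∈ range M, t ^ n * ∑ s ∈ ascF n, u ^ ascN s * y ^ zeroN s =
      ∑ n ∈ range M, t ^ n * ∑ s ∈ ascF n, u ^ repN s * y ^ maxN s := by
  have h := congrArg (y * ·) (ascGF_eq_repGF ht hu y)
  simp only [ascGF, repGF, pathSum, psum, mul_sum _ _ y] at h
  have h1 : ∀ n, ∑ s ∈ ascF n, u ^ ascN s * y ^ zeroN s = y * (step y ^ n) (fun A _ => u ^ A) 0 0 := by
    intro n
    have h2 := iterate_extend_asc_zero y (fun A _ => u ^ A) n (List.cons_ne_nil 0 [])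
    rw [← sum_ascF] at h2
    simp only [mul_comm (u ^ _)]
    rw [h2]
    simp [zeroN, ascN, lastN]
  have h2 : ∀ n, ∑ s ∈ ascF n, u ^ repN s * y ^ maxN s = y * runSum u y n 0 := by
    intro n
    have h3 := iterate_extend_rep_range u y n 0
    rw [show List.range (0 + 1) = [0] from rfl, ← sum_ascF] at h3
    simpa using h3
  simp only [h1, h2, mul_left_comm _ y]
  exact h

end Repeats

section Extraction

open MvPolynomial

/-- The exponent vector of the monomial `t ^ n * u ^ a * y ^ b`. -/
noncomputable def expo (n a b : ℕ) : Fin 3 →₀ ℕ :=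
  Finsupp.single 0 n + Finsupp.single 1 a + Finsupp.single 2 b

lemma expo_inj {n a b n' a' b' : ℕ} :
    expo n a b = expo n' a' b' ↔ n = n' ∧ a = a' ∧ b = b' := by
  constructor
  · intro h
    have h0 := DFunLike.congr_fun h 0
    have h1 := DFunLike.congr_fun h 1
    have h2 := DFunLike.congr_fun h 2
    simp [expo] at h0 h1 h2
    exact ⟨h0, h1, h2⟩
  · rintro ⟨rfl, rfl, rfl⟩
    rfl

lemma monomial_expo (n a b : ℕ) :
    (X 0 ^ n * (X 1 ^ a * X 2 ^ b) : MvPolynomial (Fin 3) ℤ) = monomial (expo n a b) 1 := by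
  simp only [X_pow_eq_monomial, monomial_mul, expo, mul_one, add_assoc]

/-- Generating polynomial of two statistics on ascent sequences of length at most `M`. -/
noncomputable def statPoly (M : ℕ) (f g : List ℕ → ℕ) : MvPolynomial (Fin 3) ℤ :=
  ∑ n ∈ range M, X 0 ^ n * ∑ s ∈ ascF n, X 1 ^ f s * X 2 ^ g s

lemma coeff_statPoly {M n : ℕ} (hn : n < M) (a b : ℕ) (f g : List ℕ → ℕ) :
    coeff (expo n a b) (statPoly M f g) = ((ascF n).filter fun s => f s = a ∧ g s = b).card := by
  simp only [statPoly, mul_sum, monomial_expo, coeff_sum, coeff_monomial, expo_inj]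
  rw [sum_eq_single n, card_filter]
  · push_cast
    simp
  · intro m _ hm
    exact sum_eq_zero fun s _ => if_neg fun h => hm h.1
  · intro h
    exact absurd (mem_range.2 hn) h

lemma card_filter_asc_zero (n a b : ℕ) :
    ((ascF n).filter fun s => ascN s = a ∧ zeroN s = b).card =
      ((ascF n).filter fun s => repN s = a ∧ maxN s = b).card := by
  set M := n + a + 1 with hM
  set S : Set (Fin 3 →₀ ℕ) := {expo M 0 0, expo 0 M 0} with hS
  set I : Ideal (MvPolynomial (Fin 3) ℤ) := Ideal.span ((fun s => monomial s 1) '' S) with hI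
  have hmk : ∀ e ∈ S, Ideal.Quotient.mk I (monomial e 1) = 0 := fun e he =>
    Ideal.Quotient.eq_zero_iff_mem.2 (Ideal.subset_span ⟨e, he, rfl⟩)
  have ht : Ideal.Quotient.mk I (X 0) ^ M = 0 := by
    rw [← map_pow, ← hmk (expo M 0 0) (by simp [hS]), ← monomial_expo]
    simp
  have hu : Ideal.Quotient.mk I (X 1) ^ M = 0 := by
    rw [← map_pow, ← hmk (expo 0 M 0) (by simp [hS]), ← monomial_expo]
    simp
  have h := sum_asc_zero_eq_sum_rep_max ht hu (Ideal.Quotient.mk I (X 2))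
  have h' : Ideal.Quotient.mk I (statPoly M ascN zeroN) =
      Ideal.Quotient.mk I (statPoly M repN maxN) := by
    simpa [statPoly] using h
  rw [Ideal.Quotient.eq, hI, mem_ideal_span_monomial_image] at h'
  have hc : coeff (expo n a b) (statPoly M ascN zeroN - statPoly M repN maxN) = 0 := by
    by_contra hne
    obtain ⟨e, he, hle⟩ := h' _ (mem_support_iff.2 hne)
    rcases he with rfl | rfl
    · have := hle 0
      simp [expo] at this
      omega
    · have := hle 1
      simp [expo] at this
      omega
  rw [coeff_sub, coeff_statPoly (by omega), coeff_statPoly (by omega), sub_eq_zero] at hc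
  exact_mod_cast hc

lemma ncard_eq_card_filter (n : ℕ) (f g : List ℕ → ℕ) (a b : ℕ) :
    {s : List ℕ | IsAscSeq s ∧ s.length = n + 1 ∧ f s = a ∧ g s = b}.ncard =
      ((ascF n).filter fun s => f s = a ∧ g s = b).card := by
  rw [← Set.ncard_coe_finset]
  congr 1
  ext s
  simp [mem_ascF, and_assoc]

end Extraction

end AscSeq

/-- `(asc, zero)` and `(rep, max)` are equidistributed on ascent sequences of length `n ≥ 1`. -/
theorem asc_zero_eq_rep_max (n : ℕ) (hn : 1 ≤ n) (a b : ℕ) :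
    {s : List ℕ | IsAscSeq s ∧ s.length = n ∧ ascN s = a ∧ zeroN s = b}.ncard =
    {s : List ℕ | IsAscSeq s ∧ s.length = n ∧ repN s = a ∧ maxN s = b}.ncard := by
  obtain ⟨m, rfl⟩ : ∃ m, n = m + 1 := Nat.exists_eq_succ_of_ne_zero (by omega)
  rw [AscSeq.ncard_eq_card_filter, AscSeq.ncard_eq_card_filter, AscSeq.card_filter_asc_zero]
end
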